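/- arXiv:quant-ph/0603009 — 4 statements merged into one kernel-verified Lean document; each statement's English description precedes it below -/
import Mathlib

section
/- Let d ≥ 2 and n ≥ 2. Every complete n-qudit gate set Γ is N-universal for every N ≥ n. -/
open Matrix

/-- Index set of the standard basis of `(ℂ^d)^{⊗n}`. -/
abbrev QIdx (d n : ℕ) := Fin n → Fin d

/-- The unitary group on `(ℂ^d)^{⊗n}`. -/
abbrev UG (d n : ℕ) := Matrix.unitaryGroup (QIdx d n) ℂ

/-- The unitary scalar matrices inside a unitary group. -/
def scalarSet (ι : Type*) [Fintype ι] [DecidableEq ι] : Set (Matrix.unitaryGroup ι ℂ) :=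
  {s | ∃ α : ℂ, (s : Matrix ι ι ℂ) = α • (1 : Matrix ι ι ℂ)}

/-- A set of gates is complete if together with the unitary scalars it generates a dense
subgroup of the unitary group. -/
def IsCompleteGateSet {ι : Type*} [Fintype ι] [DecidableEq ι]
    (Γ : Set (Matrix.unitaryGroup ι ℂ)) : Prop :=
  Dense (↑(Subgroup.closure (Γ ∪ scalarSet ι)) : Set (Matrix.unitaryGroup ι ℂ))

/-- The unitary operator on `(ℂ^d)^{⊗N}` permuting the tensor factors according to `σ`. -/
def permMatrix (d N : ℕ) (σ : Equiv.Perm (Fin N)) : Matrix (QIdx d N) (QIdx d N) ℂ :=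
  Matrix.of fun f g => if f = g ∘ σ then 1 else 0

/-- `u ⊗ I` : the extension of an `n`-qudit gate `u` to `N` qudits, acting as `u` on the
first `n` tensor factors and as the identity on the remaining `N - n` factors. -/
def tensorExt {d n N : ℕ} (h : n ≤ N) (u : Matrix (QIdx d n) (QIdx d n) ℂ) :
    Matrix (QIdx d N) (QIdx d N) ℂ :=
  Matrix.of fun f g =>
    u (fun i => f (Fin.castLE h i)) (fun i => g (Fin.castLE h i)) *
      (if ∀ j : Fin N, n ≤ (j : ℕ) → f j = g j then 1 else 0)

/-- `Γ^N`: all gates `σ (u ⊗ I) σ⁻¹` for `u ∈ Γ` and `σ ∈ S_N`. -/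
def gateConj (d n N : ℕ) (h : n ≤ N) (Γ : Set (UG d n)) : Set (UG d N) :=
  {v | ∃ u ∈ Γ, ∃ σ : Equiv.Perm (Fin N),
    (v : Matrix (QIdx d N) (QIdx d N) ℂ) =
      permMatrix d N σ * tensorExt h (u : Matrix (QIdx d n) (QIdx d n) ℂ) * permMatrix d N σ⁻¹}

/-- `Γ` is `N`-universal if `Γ^N` is complete. -/
def IsNUniversal (d n N : ℕ) (Γ : Set (UG d n)) : Prop :=
  ∃ h : n ≤ N, IsCompleteGateSet (gateConj d n N h Γ)

/-- `Γ` is universal if it is `N`-universal for all sufficiently large `N`. -/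
def IsUniversal (d n : ℕ) (Γ : Set (UG d n)) : Prop :=
  ∃ N₀, n ≤ N₀ ∧ ∀ N, N₀ ≤ N → IsNUniversal d n N Γ

section Isometry

variable {ι κ μ : Type*} [Fintype ι] [DecidableEq ι] [Fintype κ] [DecidableEq κ]
  [Fintype μ] [DecidableEq μ]

/-- The operator acting as `M` on the image of the isometry `Q` and as the identity on its
orthogonal complement. -/
def isoExt (Q : Matrix ι κ ℂ) (M : Matrix κ κ ℂ) : Matrix ι ι ℂ := 1 + Q * (M - 1) * Qᴴ

theorem isoExt_mul {Q : Matrix ι κ ℂ} (hQ : Qᴴ * Q = 1) (M M' : Matrix κ κ ℂ) :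
    isoExt Q M * isoExt Q M' = isoExt Q (M * M') := by
  have h : Q * (M - 1) * Qᴴ * (Q * (M' - 1) * Qᴴ) = Q * ((M - 1) * (M' - 1)) * Qᴴ := by
    calc _ = Q * (M - 1) * (Qᴴ * Q) * (M' - 1) * Qᴴ := by simp only [Matrix.mul_assoc]
      _ = _ := by rw [hQ]; simp only [Matrix.mul_assoc, Matrix.one_mul]
  have h' : M * M' - 1 = (M - 1) + (M' - 1) + (M - 1) * (M' - 1) := by noncomm_ring
  simp only [isoExt]
  rw [Matrix.mul_add, Matrix.add_mul, Matrix.add_mul, h, h']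
  simp only [Matrix.mul_add, Matrix.add_mul, Matrix.one_mul, Matrix.mul_one]
  abel

omit [Fintype ι] in
theorem conjTranspose_isoExt (Q : Matrix ι κ ℂ) (M : Matrix κ κ ℂ) :
    (isoExt Q M)ᴴ = isoExt Q Mᴴ := by
  simp [isoExt, Matrix.conjTranspose_add, Matrix.conjTranspose_mul, Matrix.mul_assoc]

omit [Fintype ι] in
@[simp] theorem isoExt_one (Q : Matrix ι κ ℂ) : isoExt Q 1 = 1 := by simp [isoExt]

omit [Fintype ι] in
theorem isoExt_isoExt (Q : Matrix ι κ ℂ) (R : Matrix κ μ ℂ) (M : Matrix μ μ ℂ) :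
    isoExt Q (isoExt R M) = isoExt (Q * R) M := by
  simp [isoExt, Matrix.conjTranspose_mul, Matrix.mul_assoc]

theorem isoExt_eq_conj {g : Matrix ι ι ℂ} (hg : g ∈ unitaryGroup ι ℂ) (M : Matrix ι ι ℂ) :
    isoExt g M = g * M * gᴴ := by
  have : g * gᴴ = 1 := mem_unitaryGroup_iff.1 hg
  simp [isoExt, Matrix.mul_sub, Matrix.sub_mul, this]

theorem conj_isoExt {g : Matrix ι ι ℂ} (hg : g ∈ unitaryGroup ι ℂ) (Q : Matrix ι κ ℂ)
    (M : Matrix κ κ ℂ) : g * isoExt Q M * gᴴ = isoExt (g * Q) M := by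
  rw [← isoExt_eq_conj hg, isoExt_isoExt]

theorem det_isoExt {Q : Matrix ι κ ℂ} (hQ : Qᴴ * Q = 1) (M : Matrix κ κ ℂ) :
    (isoExt Q M).det = M.det := by
  rw [isoExt, Matrix.mul_assoc, Matrix.det_one_add_mul_comm, Matrix.mul_assoc, hQ]
  simp

theorem isoExt_mem_unitaryGroup {Q : Matrix ι κ ℂ} (hQ : Qᴴ * Q = 1) {M : Matrix κ κ ℂ}
    (hM : M ∈ unitaryGroup κ ℂ) : isoExt Q M ∈ unitaryGroup ι ℂ := by
  rw [mem_unitaryGroup_iff, star_eq_conjTranspose, conjTranspose_isoExt, isoExt_mul hQ,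
    ← star_eq_conjTranspose, mem_unitaryGroup_iff.1 hM, isoExt_one]

end Isometry

section TwoByTwo

/-- The diagonal matrix with entries `z` and `conj z`. -/
def phaseMat (z : ℂ) : Matrix (Fin 2) (Fin 2) ℂ := !![z, 0; 0, star z]

/-- The rotation matrix with cosine `c` and sine `s`. -/
def rotMat (c s : ℝ) : Matrix (Fin 2) (Fin 2) ℂ := !![(c : ℂ), s; -s, c]

/-- The unitary conjugating phase matrices to rotations. -/
noncomputable def phaseToRot : Matrix (Fin 2) (Fin 2) ℂ :=
  ((√2 : ℝ) : ℂ)⁻¹ • !![1, Complex.I; Complex.I, 1]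

theorem inv_sqrt_two_mul_self : ((√2 : ℝ) : ℂ)⁻¹ * ((√2 : ℝ) : ℂ)⁻¹ = 1 / 2 := by
  rw [← mul_inv, ← Complex.ofReal_mul, Real.mul_self_sqrt (by norm_num)]
  norm_num

theorem conjTranspose_phaseToRot :
    phaseToRotᴴ = ((√2 : ℝ) : ℂ)⁻¹ • !![1, -Complex.I; -Complex.I, 1] := by
  ext i j
  fin_cases i <;> fin_cases j <;> simp [phaseToRot]

theorem phaseToRot_mem : phaseToRot ∈ unitaryGroup (Fin 2) ℂ := by
  rw [mem_unitaryGroup_iff, star_eq_conjTranspose, conjTranspose_phaseToRot, phaseToRot,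
    Matrix.smul_mul, Matrix.mul_smul, smul_smul, inv_sqrt_two_mul_self]
  ext i j
  fin_cases i <;> fin_cases j <;> simp <;> norm_num

theorem phaseToRot_conj (c s : ℝ) :
    phaseToRot * phaseMat (c + s * Complex.I) * phaseToRotᴴ = rotMat c s := by
  rw [conjTranspose_phaseToRot, phaseToRot, Matrix.smul_mul, Matrix.smul_mul, Matrix.mul_smul,
    smul_smul, inv_sqrt_two_mul_self]
  ext i j
  have hI := Complex.I_mul_I
  fin_cases i <;> fin_cases j <;>
    simp [phaseMat, rotMat] <;>
    grind

theorem conjTranspose_phaseMat (z : ℂ) : (phaseMat z)ᴴ = phaseMat (star z) := by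
  ext i j
  fin_cases i <;> fin_cases j <;> simp [phaseMat]

theorem phaseMat_mul (z w : ℂ) : phaseMat z * phaseMat w = phaseMat (z * w) := by
  ext i j
  fin_cases i <;> fin_cases j <;> simp [phaseMat]

theorem det_phaseMat {z : ℂ} (hz : ‖z‖ = 1) : (phaseMat z).det = 1 := by
  simp [phaseMat, Matrix.det_fin_two, Complex.mul_conj, Complex.normSq_eq_norm_sq, hz]

theorem star_mul_self_of_norm_eq_one {z : ℂ} (hz : ‖z‖ = 1) : star z * z = 1 := by
  simp [Complex.conj_mul', hz]

theorem phaseMat_mem {z : ℂ} (hz : ‖z‖ = 1) : phaseMat z ∈ unitaryGroup (Fin 2) ℂ := by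
  rw [mem_unitaryGroup_iff', star_eq_conjTranspose, conjTranspose_phaseMat, phaseMat_mul,
    star_mul_self_of_norm_eq_one hz]
  ext i j
  fin_cases i <;> fin_cases j <;> simp [phaseMat]

/-- The submonoid generated by all unitary conjugates of phase matrices. -/
def phaseConj : Submonoid (Matrix (Fin 2) (Fin 2) ℂ) :=
  Submonoid.closure {V | ∃ g ∈ unitaryGroup (Fin 2) ℂ, ∃ z : ℂ, ‖z‖ = 1 ∧ V = g * phaseMat z * gᴴ}

theorem phaseMat_mem_phaseConj {z : ℂ} (hz : ‖z‖ = 1) : phaseMat z ∈ phaseConj :=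
  Submonoid.subset_closure ⟨1, one_mem _, z, hz, by simp⟩

theorem rotMat_mem_phaseConj {c s : ℝ} (h : c ^ 2 + s ^ 2 = 1) : rotMat c s ∈ phaseConj :=
  Submonoid.subset_closure ⟨phaseToRot, phaseToRot_mem, c + s * Complex.I, by
    rw [Complex.norm_add_mul_I, h, Real.sqrt_one], (phaseToRot_conj c s).symm⟩

theorem phaseConj_le : phaseConj ≤ specialUnitaryGroup (Fin 2) ℂ := by
  rw [phaseConj, Submonoid.closure_le]
  rintro _ ⟨g, hg, z, hz, rfl⟩
  have hgs : gᴴ ∈ unitaryGroup (Fin 2) ℂ := Unitary.star_mem hg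
  rw [SetLike.mem_coe, mem_specialUnitaryGroup_iff]
  refine ⟨mul_mem (mul_mem hg (phaseMat_mem hz)) hgs, ?_⟩
  have h1 : g * gᴴ = 1 := mem_unitaryGroup_iff.1 hg
  have h2 := congrArg Matrix.det h1
  rw [Matrix.det_mul, Matrix.det_one] at h2
  rw [Matrix.det_mul, Matrix.det_mul, det_phaseMat hz, mul_one, h2]

theorem exists_phaseConj_kill (x y : ℂ) : ∃ V ∈ phaseConj, (V *ᵥ ![x, y]) 1 = 0 := by
  by_cases h0 : ‖x‖ ^ 2 + ‖y‖ ^ 2 = 0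
  · have hy : y = 0 := by
      have : ‖y‖ ^ 2 = 0 := by nlinarith [sq_nonneg ‖x‖, sq_nonneg ‖y‖]
      simpa using this
    exact ⟨1, one_mem _, by simp [hy]⟩
  set r := √(‖x‖ ^ 2 + ‖y‖ ^ 2) with hr
  have hr2 : r ^ 2 = ‖x‖ ^ 2 + ‖y‖ ^ 2 := Real.sq_sqrt (by positivity)
  have hr0 : r ^ 2 ≠ 0 := by rwa [hr2]
  set t : ℝ := (y.arg - x.arg) / 2
  refine ⟨rotMat (‖x‖ / r) (‖y‖ / r) * phaseMat (Complex.exp (t * Complex.I)),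
    mul_mem (rotMat_mem_phaseConj ?_) (phaseMat_mem_phaseConj (Complex.norm_exp_ofReal_mul_I t)), ?_⟩
  · rw [div_pow, div_pow, ← add_div, ← hr2, div_self hr0]
  have hs : star (Complex.exp (t * Complex.I)) = Complex.exp (-(t * Complex.I)) := by
    rw [Complex.star_def, ← Complex.exp_conj]
    simp
  have key : (‖y‖ : ℂ) * (Complex.exp (t * Complex.I) * x) =
      ‖x‖ * (Complex.exp (-(t * Complex.I)) * y) := by
    conv_lhs => rw [← Complex.norm_mul_exp_arg_mul_I x]
    conv_rhs => rw [← Complex.norm_mul_exp_arg_mul_I y]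
    have : Complex.exp (t * Complex.I) * Complex.exp (x.arg * Complex.I) =
        Complex.exp (-(t * Complex.I)) * Complex.exp (y.arg * Complex.I) := by
      rw [← Complex.exp_add, ← Complex.exp_add]
      congr 1
      simp only [t]
      push_cast
      ring
    linear_combination (‖y‖ * ‖x‖ : ℂ) * this
  rw [← Matrix.mulVec_mulVec]
  have : phaseMat (Complex.exp (t * Complex.I)) *ᵥ ![x, y] =
      ![Complex.exp (t * Complex.I) * x, Complex.exp (-(t * Complex.I)) * y] := by
    ext i
    fin_cases i <;> simp [phaseMat, Matrix.mulVec, dotProduct, Fin.sum_univ_two, ← hs]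
  rw [this]
  simp only [rotMat, Matrix.mulVec, dotProduct, Fin.sum_univ_two]
  simp
  linear_combination (-(r : ℂ)⁻¹) * key

end TwoByTwo

section Elimination

variable {ι : Type*} [Fintype ι] [DecidableEq ι]

/-- The matrix whose columns are the standard basis vectors `e_i` and `e_j`. -/
def basisPair (i j : ι) : Matrix ι (Fin 2) ℂ := Matrix.of fun k l => if k = ![i, j] l then 1 else 0

omit [Fintype ι] in
theorem basisPair_apply_zero (i j k : ι) : basisPair i j k 0 = if k = i then 1 else 0 := rfl

omit [Fintype ι] in
theorem basisPair_apply_one (i j k : ι) : basisPair i j k 1 = if k = j then 1 else 0 := rfl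

theorem basisPair_isometry {i j : ι} (h : i ≠ j) : (basisPair i j)ᴴ * basisPair i j = 1 := by
  ext a b
  fin_cases a <;> fin_cases b <;>
    simp [basisPair_apply_zero, basisPair_apply_one, Matrix.mul_apply, h, h.symm,
      apply_ite (starRingEnd ℂ)]

theorem isoExt_basisPair_mulVec (i j : ι) (M : Matrix (Fin 2) (Fin 2) ℂ) (v : ι → ℂ) :
    isoExt (basisPair i j) M *ᵥ v =
      v + basisPair i j *ᵥ (M *ᵥ ![v i, v j] - ![v i, v j]) := by
  have : (basisPair i j)ᴴ *ᵥ v = ![v i, v j] := by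
    ext a
    fin_cases a <;>
      simp [basisPair_apply_zero, basisPair_apply_one, Matrix.mulVec, dotProduct,
        apply_ite (starRingEnd ℂ)]
  rw [isoExt, Matrix.add_mulVec, Matrix.one_mulVec, ← Matrix.mulVec_mulVec, this,
    ← Matrix.mulVec_mulVec, Matrix.sub_mulVec, Matrix.one_mulVec]

theorem isoExt_basisPair_mulVec_of_ne {i j k : ι} (hi : k ≠ i) (hj : k ≠ j)
    (M : Matrix (Fin 2) (Fin 2) ℂ) (v : ι → ℂ) : (isoExt (basisPair i j) M *ᵥ v) k = v k := by
  rw [isoExt_basisPair_mulVec]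
  simp [basisPair_apply_zero, basisPair_apply_one, Matrix.mulVec, dotProduct, Fin.sum_univ_two,
    hi, hj]

theorem isoExt_basisPair_mulVec_left {i j : ι} (h : i ≠ j)
    (M : Matrix (Fin 2) (Fin 2) ℂ) (v : ι → ℂ) :
    (isoExt (basisPair i j) M *ᵥ v) i = (M *ᵥ ![v i, v j]) 0 := by
  rw [isoExt_basisPair_mulVec]
  simp [basisPair_apply_zero, basisPair_apply_one, Matrix.mulVec, dotProduct, Fin.sum_univ_two, h]

theorem isoExt_basisPair_mulVec_right {i j : ι} (h : i ≠ j)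
    (M : Matrix (Fin 2) (Fin 2) ℂ) (v : ι → ℂ) :
    (isoExt (basisPair i j) M *ᵥ v) j = (M *ᵥ ![v i, v j]) 1 := by
  rw [isoExt_basisPair_mulVec]
  simp [basisPair_apply_zero, basisPair_apply_one, Matrix.mulVec, dotProduct, Fin.sum_univ_two,
    h.symm]

theorem isoExt_basisPair_mulVec_fix {i j : ι} (M : Matrix (Fin 2) (Fin 2) ℂ) {v : ι → ℂ}
    (hi : v i = 0) (hj : v j = 0) : isoExt (basisPair i j) M *ᵥ v = v := by
  have : ![(0 : ℂ), 0] = 0 := by ext a; fin_cases a <;> rfl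
  rw [isoExt_basisPair_mulVec, hi, hj, this]
  simp

/-- A submonoid contains the special unitary operators on the span of `e_i` and `e_j`. -/
def ContainsPair (S : Submonoid (Matrix ι ι ℂ)) (i j : ι) : Prop :=
  ∀ V ∈ phaseConj, isoExt (basisPair i j) V ∈ S

theorem exists_mem_kill {S : Submonoid (Matrix ι ι ℂ)} (hS : ∀ i j, i ≠ j → ContainsPair S i j)
    (v : ι → ℂ) (i : ι) (s : Finset ι) (hi : i ∉ s) :
    ∃ h ∈ S, (∀ j ∈ s, (h *ᵥ v) j = 0) ∧ (∀ j, j ∉ s → j ≠ i → (h *ᵥ v) j = v j) ∧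
      ∀ k, k ∉ s → k ≠ i → h *ᵥ Pi.single k 1 = Pi.single k 1 := by
  induction s using Finset.induction_on with
  | empty => exact ⟨1, one_mem _, by simp, by simp, fun _ _ _ => Matrix.one_mulVec _⟩
  | insert j s hj ih =>
    rw [Finset.mem_insert, not_or] at hi
    obtain ⟨h, hS', h0, h1, h2⟩ := ih hi.2
    obtain ⟨V, hV, hV0⟩ := exists_phaseConj_kill ((h *ᵥ v) i) ((h *ᵥ v) j)
    refine ⟨isoExt (basisPair i j) V * h, mul_mem (hS i j hi.1 V hV) hS', ?_, ?_, ?_⟩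
    · intro k hk
      rw [← Matrix.mulVec_mulVec]
      by_cases hkj : k = j
      · subst hkj
        rw [isoExt_basisPair_mulVec_right hi.1, hV0]
      · have hks : k ∈ s := by simpa [hkj] using hk
        rw [isoExt_basisPair_mulVec_of_ne (by rintro rfl; exact hi.2 hks) hkj, h0 k hks]
    · intro k hk hki
      rw [Finset.mem_insert, not_or] at hk
      rw [← Matrix.mulVec_mulVec, isoExt_basisPair_mulVec_of_ne hki hk.1, h1 k hk.2 hki]
    · intro k hk hki
      rw [Finset.mem_insert, not_or] at hk
      rw [← Matrix.mulVec_mulVec, h2 k hk.2 hki, isoExt_basisPair_mulVec_fix]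
      · simp [Ne.symm hki]
      · simp [Ne.symm hk.1]

theorem norm_eq_one_of_mulVec_single {U : Matrix ι ι ℂ} (hU : U ∈ unitaryGroup ι ℂ) {i : ι} {c : ℂ}
    (h : U *ᵥ Pi.single i 1 = Pi.single i c) : ‖c‖ = 1 := by
  have h1 : (Uᴴ * U) i i = 1 := by
    rw [← star_eq_conjTranspose, mem_unitaryGroup_iff'.1 hU, Matrix.one_apply_eq]
  have h2 : ∀ k, U k i = (Pi.single i c : ι → ℂ) k := fun k => by rw [← h]; simp
  have h3 : (‖c‖ : ℂ) ^ 2 = 1 := by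
    rw [← h1, Matrix.mul_apply]
    simp [h2, Pi.single_apply, Complex.conj_mul', apply_ite]
  have h4 : ‖c‖ ^ 2 = 1 := by exact_mod_cast h3
  nlinarith [norm_nonneg c]

theorem mulVec_single_of_fix {U : Matrix ι ι ℂ} (hU : U ∈ unitaryGroup ι ℂ) {k : ι}
    (hk : U *ᵥ Pi.single k 1 = Pi.single k 1) (j : ι) (hj : j ≠ k) :
    (U *ᵥ Pi.single j 1) k = 0 := by
  have h1 : (Uᴴ * U) k j = 0 := by
    rw [← star_eq_conjTranspose, mem_unitaryGroup_iff'.1 hU, Matrix.one_apply_ne hj.symm]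
  have h2 : ∀ l, U l k = (Pi.single k 1 : ι → ℂ) l := fun k => by rw [← hk]; simp
  rw [Matrix.mul_apply] at h1
  simpa [h2, Pi.single_apply, apply_ite] using h1

theorem exists_mem_mul_fix {S : Submonoid (Matrix ι ι ℂ)}
    (hS : ∀ i j, i ≠ j → ContainsPair S i j) (hSU : S ≤ unitaryGroup ι ℂ) (i₀ : ι) (s : Finset ι)
    (hs : i₀ ∉ s) (U : Matrix ι ι ℂ) (hU : U ∈ unitaryGroup ι ℂ)
    (hfix : ∀ k, k ∉ s → k ≠ i₀ → U *ᵥ Pi.single k 1 = Pi.single k 1) :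
    ∃ h ∈ S, ∀ k, k ≠ i₀ → (h * U) *ᵥ Pi.single k 1 = Pi.single k 1 := by
  induction s using Finset.induction_on generalizing U with
  | empty => exact ⟨1, one_mem _, by simpa using hfix⟩
  | insert i s hi ih =>
    rw [Finset.mem_insert, not_or] at hs
    obtain ⟨h, hhS, h0, h1, h2⟩ := exists_mem_kill hS (U *ᵥ Pi.single i 1) i (insert i₀ s)
      (by simp [hi, Ne.symm hs.1])
    set c := (h *ᵥ (U *ᵥ Pi.single i 1)) i with hc
    have hcol : (h * U) *ᵥ Pi.single i 1 = Pi.single i c := by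
      rw [← Matrix.mulVec_mulVec]
      ext k
      by_cases hki : k = i
      · subst hki; simp [hc]
      rw [Pi.single_eq_of_ne hki]
      by_cases hk : k ∈ insert i₀ s
      · exact h0 k hk
      · rw [h1 k hk hki]
        rw [Finset.mem_insert, not_or] at hk
        exact mulVec_single_of_fix hU (hfix k (by simp [hki, hk.2]) hk.1) i (Ne.symm hki)
    have hnorm := norm_eq_one_of_mulVec_single (mul_mem (hSU hhS) hU) hcol
    have hD : isoExt (basisPair i i₀) (phaseMat (star c)) ∈ S :=
      hS i i₀ (Ne.symm hs.1) _ (phaseMat_mem_phaseConj (by simpa using hnorm))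
    obtain ⟨h', hhS', hfix'⟩ := ih hs.2 (isoExt (basisPair i i₀) (phaseMat (star c)) * h * U)
      (mul_mem (hSU (mul_mem hD hhS)) hU) (by
        intro k hk hk0
        rw [Matrix.mul_assoc, ← Matrix.mulVec_mulVec]
        by_cases hki : k = i
        · subst hki
          rw [hcol]
          ext l
          by_cases hlk : l = k
          · subst hlk
            rw [isoExt_basisPair_mulVec_left (Ne.symm hs.1)]
            have := star_mul_self_of_norm_eq_one hnorm
            simpa [phaseMat, Matrix.mulVec, dotProduct, Fin.sum_univ_two] using this
          by_cases hl0 : l = i₀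
          · subst hl0
            rw [isoExt_basisPair_mulVec_right (Ne.symm hs.1)]
            simp [phaseMat, Matrix.mulVec, dotProduct, Fin.sum_univ_two, hlk]
          · rw [isoExt_basisPair_mulVec_of_ne hlk hl0]
            simp [hlk]
        · rw [← Matrix.mulVec_mulVec, hfix k (by simp [hki, hk]) hk0,
            h2 k (by simp [hk0, hk]) hki, isoExt_basisPair_mulVec_fix]
          · simp [Ne.symm hki]
          · simp [Ne.symm hk0])
    exact ⟨h' * (isoExt (basisPair i i₀) (phaseMat (star c)) * h),
      mul_mem hhS' (mul_mem hD hhS), fun k hk => by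
        rw [Matrix.mul_assoc h']
        exact hfix' k hk⟩

theorem eq_one_of_fix {U : Matrix ι ι ℂ} (hU : U ∈ specialUnitaryGroup ι ℂ) (i₀ : ι)
    (hfix : ∀ k, k ≠ i₀ → U *ᵥ Pi.single k 1 = Pi.single k 1) : U = 1 := by
  rw [mem_specialUnitaryGroup_iff] at hU
  have hcol : ∀ k, k ≠ i₀ → ∀ l, U l k = (Pi.single k 1 : ι → ℂ) l := fun k hk l => by
    rw [← hfix k hk]; simp
  have hdiag : U = Matrix.diagonal fun k => if k = i₀ then U i₀ i₀ else 1 := by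
    ext l k
    by_cases hk : k = i₀
    · subst hk
      by_cases hl : l = k
      · subst hl; simp
      · rw [Matrix.diagonal_apply_ne _ hl]
        simpa using mulVec_single_of_fix hU.1 (hfix l hl) k (Ne.symm hl)
    · rw [hcol k hk, Matrix.diagonal_apply]
      by_cases hl : l = k
      · subst hl; simp [hk]
      · simp [hl]
  have hdet : U i₀ i₀ = 1 := by
    have := hU.2
    rw [hdiag, Matrix.det_diagonal] at this
    simpa using this
  rw [hdiag, hdet]
  simp

theorem specialUnitaryGroup_le [Nonempty ι] {S : Submonoid (Matrix ι ι ℂ)}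
    (hS : ∀ i j, i ≠ j → ContainsPair S i j) : specialUnitaryGroup ι ℂ ≤ S := by
  intro U hU
  have hU' : star U ∈ specialUnitaryGroup ι ℂ := by
    rw [mem_specialUnitaryGroup_iff] at hU ⊢
    refine ⟨Unitary.star_mem hU.1, ?_⟩
    rw [star_eq_conjTranspose, Matrix.det_conjTranspose, hU.2, star_one]
  have hS' : ∀ i j, i ≠ j → ContainsPair (S ⊓ specialUnitaryGroup ι ℂ) i j := by
    intro i j hij V hV
    have hV' := mem_specialUnitaryGroup_iff.1 (phaseConj_le hV)
    refine ⟨hS i j hij V hV, mem_specialUnitaryGroup_iff.2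
      ⟨isoExt_mem_unitaryGroup (basisPair_isometry hij) hV'.1, ?_⟩⟩
    rw [det_isoExt (basisPair_isometry hij), hV'.2]
  obtain ⟨i₀⟩ := ‹Nonempty ι›
  obtain ⟨h, hh, hfix⟩ := exists_mem_mul_fix hS'
    (fun A hA => (mem_specialUnitaryGroup_iff.1 hA.2).1) i₀ (Finset.univ.erase i₀) (by simp)
    (star U) (mem_specialUnitaryGroup_iff.1 hU').1 (by
      intro k hk hk0
      exact absurd (Finset.mem_erase.2 ⟨hk0, Finset.mem_univ k⟩) hk)
  have h1 := eq_one_of_fix (mul_mem hh.2 hU') i₀ hfix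
  have h2 : h = U := by
    have := congrArg (· * U) h1
    simpa [Matrix.mul_assoc, mem_unitaryGroup_iff'.1 (mem_specialUnitaryGroup_iff.1 hU).1]
      using this
  exact h2 ▸ hh.1

theorem containsPair_of_gen {S : Submonoid (Matrix ι ι ℂ)} {i j : ι} (hij : i ≠ j)
    (h : ∀ g ∈ unitaryGroup (Fin 2) ℂ, ∀ z : ℂ, ‖z‖ = 1 →
      isoExt (basisPair i j) (g * phaseMat z * gᴴ) ∈ S) : ContainsPair S i j := by
  intro V hV
  induction hV using Submonoid.closure_induction with
  | mem V hV =>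
    obtain ⟨g, hg, z, hz, rfl⟩ := hV
    exact h g hg z hz
  | one => simp
  | mul V W _ _ hV hW => rw [← isoExt_mul (basisPair_isometry hij)]; exact mul_mem hV hW

theorem ContainsPair.trans {S : Submonoid (Matrix ι ι ℂ)} {i j k : ι} (hij : i ≠ j) (hjk : j ≠ k)
    (hik : i ≠ k) (h₁ : ContainsPair S i j) (h₂ : ContainsPair S j k) : ContainsPair S i k := by
  intro V hV
  have hw : rotMat 0 (-1) ∈ phaseConj := rotMat_mem_phaseConj (by norm_num)
  have hw' : rotMat 0 1 ∈ phaseConj := rotMat_mem_phaseConj (by norm_num)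
  have hstar : (rotMat 0 (-1))ᴴ = rotMat 0 1 := by
    ext a b
    fin_cases a <;> fin_cases b <;> simp [rotMat]
  have hu := isoExt_mem_unitaryGroup (basisPair_isometry hjk)
    (mem_specialUnitaryGroup_iff.1 (phaseConj_le hw)).1
  have hQ : isoExt (basisPair j k) (rotMat 0 (-1)) * basisPair i j = basisPair i k := by
    ext a b
    simp only [isoExt, rotMat, Matrix.add_mul, Matrix.mul_assoc]
    fin_cases b <;>
      simp [basisPair_apply_zero, basisPair_apply_one, Matrix.mul_apply, Fin.sum_univ_two, hij, hjk,
        hik]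
  rw [← hQ, ← conj_isoExt hu, conjTranspose_isoExt, hstar]
  exact mul_mem (mul_mem (h₂ _ hw) (h₁ V hV)) (h₂ _ hw')

end Elimination

section ControlledGates

variable {d : ℕ} {ν : Type*} [Fintype ν] [DecidableEq ν]

/-- The gate acting on the qudit `j` by a matrix depending on the state of the other qudits. -/
def ctrlGate (j : ν) (F : ({l // l ≠ j} → Fin d) → Matrix (Fin d) (Fin d) ℂ) :
    Matrix (ν → Fin d) (ν → Fin d) ℂ :=
  (Matrix.blockDiagonal F).submatrix (Equiv.funSplitAt j (Fin d)) (Equiv.funSplitAt j (Fin d))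

theorem ctrlGate_apply (j : ν) (F : ({l // l ≠ j} → Fin d) → Matrix (Fin d) (Fin d) ℂ)
    (f g : ν → Fin d) : ctrlGate j F f g =
      if ∀ l, l ≠ j → f l = g l then F (fun l => f l) (f j) (g j) else 0 := by
  have : ((fun l : {l // l ≠ j} => f l) = fun l : {l // l ≠ j} => g l) ↔
      ∀ l, l ≠ j → f l = g l := by
    simp [funext_iff]
  simp only [ctrlGate, Matrix.submatrix_apply, Equiv.funSplitAt_apply, Matrix.blockDiagonal_apply,
    this]

theorem ctrlGate_mul (j : ν) (F G : ({l // l ≠ j} → Fin d) → Matrix (Fin d) (Fin d) ℂ) :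
    ctrlGate j F * ctrlGate j G = ctrlGate j fun b => F b * G b := by
  simp only [ctrlGate, Matrix.submatrix_mul_equiv, Matrix.blockDiagonal_mul]

theorem conjTranspose_ctrlGate (j : ν)
    (F : ({l // l ≠ j} → Fin d) → Matrix (Fin d) (Fin d) ℂ) :
    (ctrlGate j F)ᴴ = ctrlGate j fun b => (F b)ᴴ := by
  simp only [ctrlGate, Matrix.conjTranspose_submatrix, Matrix.blockDiagonal_conjTranspose]

theorem ctrlGate_one (j : ν) :
    ctrlGate j (fun _ => (1 : Matrix (Fin d) (Fin d) ℂ)) = 1 := by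
  rw [ctrlGate, show (fun _ => 1 : ({l // l ≠ j} → Fin d) → Matrix (Fin d) (Fin d) ℂ) = 1 from rfl,
    Matrix.blockDiagonal_one, Matrix.submatrix_one_equiv]

theorem ctrlGate_mem_unitaryGroup (j : ν)
    {F : ({l // l ≠ j} → Fin d) → Matrix (Fin d) (Fin d) ℂ}
    (hF : ∀ b, F b ∈ unitaryGroup (Fin d) ℂ) : ctrlGate j F ∈ unitaryGroup (ν → Fin d) ℂ := by
  rw [mem_unitaryGroup_iff, star_eq_conjTranspose, conjTranspose_ctrlGate, ctrlGate_mul]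
  simp only [← star_eq_conjTranspose, mem_unitaryGroup_iff.1 (hF _), ctrlGate_one]

/-- The submonoid contains all gates on a qudit controlled by a single other qudit. -/
def ContainsSingleCtrl (S : Submonoid (Matrix (ν → Fin d) (ν → Fin d) ℂ)) : Prop :=
  ∀ (j : ν) (k : {l // l ≠ j}) (c : Fin d → Matrix (Fin d) (Fin d) ℂ),
    (∀ a, c a ∈ unitaryGroup (Fin d) ℂ) → ctrlGate j (fun b => c (b k)) ∈ S

theorem swapMat_mem : (!![0, 1; 1, 0] : Matrix (Fin 2) (Fin 2) ℂ) ∈ unitaryGroup (Fin 2) ℂ := by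
  rw [mem_unitaryGroup_iff]
  ext i j
  fin_cases i <;> fin_cases j <;> simp [Matrix.mul_apply, Fin.sum_univ_two]

theorem phaseMat_commutator (w : ℂ) :
    phaseMat w * !![0, 1; 1, 0] * phaseMat (star w) * !![0, 1; 1, 0] = phaseMat (w ^ 2) := by
  ext i j
  fin_cases i <;> fin_cases j <;> simp [phaseMat, pow_two]

theorem phaseMat_one : phaseMat 1 = 1 := by
  ext i j
  fin_cases i <;> fin_cases j <;> simp [phaseMat]

theorem ctrlGate_mem_of_finset {S : Submonoid (Matrix (ν → Fin d) (ν → Fin d) ℂ)}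
    (hS : ContainsSingleCtrl S) (j : ν) (k₀ : {l // l ≠ j}) (a : {l // l ≠ j} → Fin d)
    {Q : Matrix (Fin d) (Fin 2) ℂ} (hQ : Qᴴ * Q = 1) (T : Finset {l // l ≠ j}) (z : ℂ)
    (hz : ‖z‖ = 1) :
    ctrlGate j (fun b => if ∀ l ∈ T, b l = a l then isoExt Q (phaseMat z) else 1) ∈ S := by
  induction T using Finset.induction_on generalizing z with
  | empty =>
    simpa using hS j k₀ (fun _ => isoExt Q (phaseMat z))
      (fun _ => isoExt_mem_unitaryGroup hQ (phaseMat_mem hz))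
  | insert k T hk ih =>
    obtain ⟨w, hw⟩ := IsAlgClosed.exists_pow_nat_eq z (n := 2) (by norm_num)
    have hwn : ‖w‖ = 1 := by
      have : ‖w‖ ^ 2 = 1 := by rw [← norm_pow, hw, hz]
      nlinarith [norm_nonneg w]
    have hX : ∀ x, (if x = a k then isoExt Q !![0, 1; 1, 0] else 1) ∈ unitaryGroup (Fin d) ℂ := by
      intro x
      split_ifs
      · exact isoExt_mem_unitaryGroup hQ swapMat_mem
      · exact one_mem _
    have hc := hS j k _ hX
    convert mul_mem (mul_mem (mul_mem (ih w hwn) hc) (ih (star w) (by simpa using hwn))) hc using 1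
    rw [ctrlGate_mul, ctrlGate_mul, ctrlGate_mul]
    congr 1
    funext b
    simp only [Finset.forall_mem_insert]
    have hsw : (!![0, 1; 1, 0] : Matrix (Fin 2) (Fin 2) ℂ) * !![0, 1; 1, 0] = 1 := by
      ext i j
      fin_cases i <;> fin_cases j <;> simp
    have hww : w * star w = 1 := by rw [mul_comm, star_mul_self_of_norm_eq_one hwn]
    by_cases h1 : b k = a k <;> by_cases h2 : ∀ l ∈ T, b l = a l
    · rw [if_pos ⟨h1, h2⟩, if_pos h2, if_pos h1, if_pos h2, isoExt_mul hQ, isoExt_mul hQ,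
        isoExt_mul hQ, phaseMat_commutator, hw]
    · rw [if_neg fun h => h2 h.2, if_neg h2, if_pos h1, if_neg h2, Matrix.one_mul, Matrix.mul_one,
        isoExt_mul hQ, hsw, isoExt_one]
    · rw [if_neg fun h => h1 h.1, if_pos h2, if_neg h1, if_pos h2, Matrix.mul_one, Matrix.mul_one,
        isoExt_mul hQ, phaseMat_mul, hww, phaseMat_one, isoExt_one]
    · rw [if_neg fun h => h1 h.1, if_neg h2, if_neg h1, if_neg h2]
      simp

/-- The isometry embedding the states of the qudit `j`, with the other qudits in state `a`. -/
def lineIsometry (j : ν) (a : {l // l ≠ j} → Fin d) : Matrix (ν → Fin d) (Fin d) ℂ :=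
  Matrix.of fun f p => if Equiv.funSplitAt j (Fin d) f = (p, a) then 1 else 0

theorem ctrlGate_eq_isoExt (j : ν) (a : {l // l ≠ j} → Fin d) (V : Matrix (Fin d) (Fin d) ℂ) :
    ctrlGate j (fun b => if b = a then V else 1) = isoExt (lineIsometry j a) V := by
  have hV : ctrlGate j (fun b => if b = a then V else 1) =
      1 + ctrlGate j (fun b => if b = a then V - 1 else 0) := by
    rw [← ctrlGate_one j]
    ext f g
    simp only [Matrix.add_apply, ctrlGate_apply]
    split_ifs <;> simp
  rw [hV, isoExt]
  congr 1
  ext f g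
  rw [Matrix.mul_assoc, Matrix.mul_apply]
  simp only [ctrlGate, Matrix.submatrix_apply, Matrix.blockDiagonal_apply, lineIsometry,
    Matrix.of_apply, Equiv.funSplitAt_apply, Prod.mk.injEq, Matrix.mul_apply, Matrix.conjTranspose_apply]
  generalize V - 1 = W
  by_cases hf : (fun l : {l // l ≠ j} => f l) = a <;>
    by_cases hg : (fun l : {l // l ≠ j} => g l) = a
  · simp [hf, hg, apply_ite (starRingEnd ℂ)]
  · simp [hf, hg, Ne.symm hg]
  · simp [hf, hg]
  · simp [hf, hg]

theorem lineIsometry_mul_basisPair (j : ν) (f g : ν → Fin d)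
    (hfg : ∀ l, l ≠ j → f l = g l) :
    lineIsometry j (fun l => f l) * basisPair (f j) (g j) = basisPair f g := by
  have key : ∀ h x : ν → Fin d, (∀ l, l ≠ j → f l = x l) →
      ((Equiv.funSplitAt j (Fin d)) h = (x j, fun l : {l // l ≠ j} => f l) ↔ h = x) := by
    intro h x hx
    rw [← (Equiv.funSplitAt j (Fin d)).apply_eq_iff_eq (x := h) (y := x)]
    have : (fun l : {l // l ≠ j} => f l) = fun l : {l // l ≠ j} => x l := funext fun l => hx l l.2
    simp only [Equiv.funSplitAt_apply, this]
  ext h l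
  fin_cases l
  · simp [Matrix.mul_apply, lineIsometry, basisPair_apply_zero,
      ← key h f (fun _ _ => rfl)]
  · simp [Matrix.mul_apply, lineIsometry, basisPair_apply_one, ← key h g hfg]

theorem containsPair_of_adj {S : Submonoid (Matrix (ν → Fin d) (ν → Fin d) ℂ)}
    (hS : ContainsSingleCtrl S) (j : ν) (k₀ : {l // l ≠ j}) {f g : ν → Fin d} (hne : f ≠ g)
    (hfg : ∀ l, l ≠ j → f l = g l) : ContainsPair S f g := by
  refine containsPair_of_gen hne fun u hu z hz => ?_
  have hj : f j ≠ g j := fun h => hne <| funext fun l => by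
    by_cases hl : l = j
    · rw [hl, h]
    · exact hfg l hl
  have hQ : (basisPair (f j) (g j) * u)ᴴ * (basisPair (f j) (g j) * u) = 1 := by
    rw [Matrix.conjTranspose_mul, Matrix.mul_assoc, ← Matrix.mul_assoc (basisPair _ _)ᴴ,
      basisPair_isometry hj, Matrix.one_mul]
    exact mem_unitaryGroup_iff'.1 hu
  have h := ctrlGate_mem_of_finset hS j k₀ (fun l => f l) hQ Finset.univ z hz
  simp only [Finset.mem_univ, forall_const, ← funext_iff] at h
  rwa [ctrlGate_eq_isoExt, ← isoExt_isoExt, isoExt_isoExt, lineIsometry_mul_basisPair j f g hfg,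
    isoExt_eq_conj hu] at h

theorem containsPair_all [Nontrivial ν] {S : Submonoid (Matrix (ν → Fin d) (ν → Fin d) ℂ)}
    (hS : ContainsSingleCtrl S) (f g : ν → Fin d) (hne : f ≠ g) : ContainsPair S f g := by
  have key : ∀ T : Finset ν, f ≠ T.piecewise g f → ContainsPair S f (T.piecewise g f) := by
    intro T
    induction T using Finset.induction_on with
    | empty => simp
    | insert j T hj ih =>
      intro h
      obtain ⟨k, hk⟩ := exists_ne j
      rw [Finset.piecewise_insert] at h ⊢
      have hadj : ∀ l, l ≠ j →
          T.piecewise g f l = Function.update (T.piecewise g f) j (g j) l := fun l hl => by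
        rw [Function.update_of_ne hl]
      by_cases h1 : f = T.piecewise g f
      · rw [← h1] at h hadj ⊢
        exact containsPair_of_adj hS j ⟨k, hk⟩ h hadj
      · by_cases h2 : T.piecewise g f = Function.update (T.piecewise g f) j (g j)
        · rw [← h2]; exact ih h1
        · exact (ih h1).trans h1 h2 h (containsPair_of_adj hS j ⟨k, hk⟩ h2 hadj)
  simpa using key Finset.univ (by simpa using hne)

end ControlledGates

section Locality

variable {d n N : ℕ}

theorem permMatrix_conj (σ : Equiv.Perm (Fin N)) (A : Matrix (QIdx d N) (QIdx d N) ℂ) :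
    permMatrix d N σ * A * permMatrix d N σ⁻¹ = A.submatrix (· ∘ ⇑σ⁻¹) (· ∘ ⇑σ⁻¹) := by
  ext f g
  have h : ∀ f' : QIdx d N, f = f' ∘ σ ↔ f' = f ∘ ⇑σ⁻¹ := by
    intro f'
    constructor <;> rintro rfl <;> ext <;> simp
  simp [Matrix.mul_apply, permMatrix, h]

/-- Relabelling of basis states along a permutation of the qudits. -/
def permIdx (d : ℕ) (σ : Equiv.Perm (Fin N)) : QIdx d N ≃ QIdx d N where
  toFun f := f ∘ ⇑σ⁻¹
  invFun f := f ∘ σ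
  left_inv f := by ext; simp
  right_inv f := by ext; simp

theorem tensorExt_eq_kronecker (m : ℕ) (u : Matrix (QIdx d n) (QIdx d n) ℂ) :
    tensorExt (Nat.le_add_right n m) u =
      (Matrix.kronecker u (1 : Matrix (QIdx d m) (QIdx d m) ℂ)).submatrix
        (Fin.appendEquiv n m).symm (Fin.appendEquiv n m).symm := by
  ext f g
  have h : (∀ j : Fin (n + m), n ≤ (j : ℕ) → f j = g j) ↔
      (fun i : Fin m => f (Fin.natAdd n i)) = fun i => g (Fin.natAdd n i) := by
    rw [funext_iff]
    refine ⟨fun h i => h _ (by simp), fun h j hj => ?_⟩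
    have := h ⟨j - n, by omega⟩
    have e : Fin.natAdd n ⟨j - n, by omega⟩ = j := by ext; simp; omega
    rwa [e] at this
  simp only [tensorExt, Matrix.of_apply, h, Matrix.submatrix_apply, Matrix.kronecker,
    Matrix.kroneckerMap_apply, Matrix.one_apply, Fin.appendEquiv]
  rfl

/-- The homomorphism `u ↦ σ (u ⊗ I) σ⁻¹`. -/
noncomputable def localHom (d : ℕ) (h : n ≤ N) (σ : Equiv.Perm (Fin N)) : UG d n →* UG d N where
  toFun u := ⟨(tensorExt h (u : Matrix (QIdx d n) (QIdx d n) ℂ)).submatrix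
      (permIdx d σ) (permIdx d σ), by
    obtain ⟨m, rfl⟩ := Nat.exists_eq_add_of_le h
    rw [mem_unitaryGroup_iff, star_eq_conjTranspose, tensorExt_eq_kronecker,
      Matrix.conjTranspose_submatrix, Matrix.conjTranspose_submatrix, Matrix.submatrix_mul_equiv,
      Matrix.submatrix_mul_equiv, Matrix.kronecker, Matrix.conjTranspose_kronecker,
      ← Matrix.mul_kronecker_mul, ← star_eq_conjTranspose, mem_unitaryGroup_iff.1 u.2]
    simp⟩
  map_one' := by
    obtain ⟨m, rfl⟩ := Nat.exists_eq_add_of_le h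
    ext1
    simp only [tensorExt_eq_kronecker, Matrix.kronecker, OneMemClass.coe_one,
      Matrix.one_kronecker_one, Matrix.submatrix_one_equiv]
  map_mul' u v := by
    obtain ⟨m, rfl⟩ := Nat.exists_eq_add_of_le h
    ext1
    simp only [tensorExt_eq_kronecker, Submonoid.coe_mul, Matrix.kronecker]
    rw [Matrix.submatrix_mul_equiv, Matrix.submatrix_mul_equiv, ← Matrix.mul_kronecker_mul,
      Matrix.one_mul]

theorem coe_localHom (h : n ≤ N) (σ : Equiv.Perm (Fin N)) (u : UG d n) :
    (localHom d h σ u : Matrix (QIdx d N) (QIdx d N) ℂ) =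
      permMatrix d N σ * tensorExt h (u : Matrix (QIdx d n) (QIdx d n) ℂ) * permMatrix d N σ⁻¹ := by
  rw [permMatrix_conj]
  rfl

theorem continuous_localHom (h : n ≤ N) (σ : Equiv.Perm (Fin N)) :
    Continuous (localHom d h σ) := by
  refine Continuous.subtype_mk (continuous_matrix fun f g => ?_) _
  simp only [Matrix.submatrix_apply, tensorExt, Matrix.of_apply]
  exact (continuous_subtype_val.matrix_elem _ _).mul continuous_const

theorem localHom_mem_topologicalClosure {Γ : Set (UG d n)} (hc : IsCompleteGateSet Γ) (h : n ≤ N)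
    (σ : Equiv.Perm (Fin N)) (u : UG d n) :
    localHom d h σ u ∈ (Subgroup.closure
      (gateConj d n N h Γ ∪ scalarSet (QIdx d N))).topologicalClosure := by
  set K := Subgroup.closure (gateConj d n N h Γ ∪ scalarSet (QIdx d N))
  have hle : Subgroup.closure (Γ ∪ scalarSet (QIdx d n)) ≤
      K.topologicalClosure.comap (localHom d h σ) := by
    rw [Subgroup.closure_le]
    intro v hv
    refine K.le_topologicalClosure (Subgroup.subset_closure ?_)
    rcases hv with hv | ⟨α, hα⟩
    · exact Or.inl ⟨v, hv, σ, coe_localHom h σ v⟩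
    · refine Or.inr ⟨α, ?_⟩
      obtain ⟨m, rfl⟩ := Nat.exists_eq_add_of_le h
      change (tensorExt h (v : Matrix (QIdx d n) (QIdx d n) ℂ)).submatrix
        (permIdx d σ) (permIdx d σ) = _
      rw [hα, tensorExt_eq_kronecker, Matrix.kronecker, Matrix.smul_kronecker]
      simp [Matrix.submatrix_smul]
  have hclosed : IsClosed
      ((K.topologicalClosure.comap (localHom d h σ) : Subgroup (UG d n)) : Set (UG d n)) :=
    K.isClosed_topologicalClosure.preimage (continuous_localHom h σ)
  exact hclosed.closure_subset_iff.2 hle (hc u)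

theorem exists_perm_apply_pair {α : Type*} [DecidableEq α] {a b j k : α} (hab : a ≠ b)
    (hjk : k ≠ j) : ∃ τ : Equiv.Perm α, τ a = j ∧ τ b = k := by
  refine ⟨Equiv.swap a j * Equiv.swap b (Equiv.swap a j k), ?_, ?_⟩
  · have : a ≠ Equiv.swap a j k := fun h => hjk (by
      have := congrArg (Equiv.swap a j) h
      simpa using this.symm)
    rw [Equiv.Perm.mul_apply, Equiv.swap_apply_of_ne_of_ne hab this, Equiv.swap_apply_left]
  · simp

theorem tensorExt_ctrlGate_submatrix (h : n ≤ N) (τ : Equiv.Perm (Fin N)) (j₀ : Fin n)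
    (k₀ : {l // l ≠ j₀}) (j : Fin N) (k : {l // l ≠ j}) (hj : τ (Fin.castLE h j₀) = j)
    (hk : τ (Fin.castLE h k₀) = k) (c : Fin d → Matrix (Fin d) (Fin d) ℂ) :
    (tensorExt h (ctrlGate j₀ fun b => c (b k₀))).submatrix (· ∘ ⇑τ) (· ∘ ⇑τ) =
      ctrlGate j fun b => c (b k) := by
  ext f g
  have hcond : ((∀ l, l ≠ j₀ → f (τ (Fin.castLE h l)) = g (τ (Fin.castLE h l))) ∧
      ∀ i : Fin N, n ≤ (i : ℕ) → f (τ i) = g (τ i)) ↔ ∀ l, l ≠ j → f l = g l := by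
    constructor
    · rintro ⟨h1, h2⟩ l hl
      obtain ⟨i, rfl⟩ := τ.surjective l
      by_cases hi : n ≤ (i : ℕ)
      · exact h2 i hi
      · exact h1 ⟨i, by omega⟩ fun e => hl (by rw [← hj, ← e]; rfl)
    · intro h0
      refine ⟨fun l hl => h0 _ fun e => hl ?_, fun i hi => h0 _ fun e => ?_⟩
      · exact Fin.castLE_injective h (τ.injective (e.trans hj.symm))
      · have := τ.injective (e.trans hj.symm)
        subst this
        simp at hi
        omega
  simp only [Matrix.submatrix_apply, tensorExt, Matrix.of_apply, ctrlGate_apply,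
    Function.comp_apply, hj, hk, ← hcond]
  split_ifs <;> simp_all

end Locality

/-- For `d, n ≥ 2`, every complete `n`-qudit gate set is `N`-universal for
every `N ≥ n`. -/
theorem complete_imp_nUniversal {d n : ℕ} (hd : 2 ≤ d) (hn : 2 ≤ n)
    (Γ : Set (UG d n)) (hΓ : Γ.Finite) (hc : IsCompleteGateSet Γ) :
    ∀ N, n ≤ N → IsNUniversal d n N Γ := by
  intro N h
  refine ⟨h, fun U => ?_⟩
  set G := Subgroup.closure (gateConj d n N h Γ ∪ scalarSet (QIdx d N))
  change U ∈ G.topologicalClosure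
  have : NeZero d := ⟨by omega⟩
  have : Nontrivial (Fin N) := Fin.nontrivial_iff_two_le.2 (by omega)
  let S : Submonoid (Matrix (QIdx d N) (QIdx d N) ℂ) :=
    G.topologicalClosure.toSubmonoid.map (unitaryGroup (QIdx d N) ℂ).subtype
  have hS : ContainsSingleCtrl S := by
    intro j k c hcu
    let j₀ : Fin n := ⟨0, by omega⟩
    let k₀ : {l : Fin n // l ≠ j₀} := ⟨⟨1, by omega⟩, by simp [j₀]⟩
    obtain ⟨τ, hj, hk⟩ := exists_perm_apply_pair (a := Fin.castLE h j₀) (b := Fin.castLE h k₀)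
      (fun e => k₀.2 (Fin.castLE_injective h e).symm) k.2
    refine ⟨_, localHom_mem_topologicalClosure hc h τ⁻¹
      ⟨ctrlGate j₀ fun b => c (b k₀), ctrlGate_mem_unitaryGroup j₀ fun b => hcu _⟩, ?_⟩
    rw [← tensorExt_ctrlGate_submatrix h τ j₀ k₀ j k hj hk c]
    rw [Submonoid.subtype_apply, coe_localHom, permMatrix_conj, inv_inv]
  have hSU := specialUnitaryGroup_le (containsPair_all hS)
  have hdet : ‖(U : Matrix (QIdx d N) (QIdx d N) ℂ).det‖ = 1 :=
    CStarRing.norm_of_mem_unitary (Matrix.det_of_mem_unitary U.2)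
  obtain ⟨w, hw⟩ := IsAlgClosed.exists_pow_nat_eq (U : Matrix (QIdx d N) (QIdx d N) ℂ).det
    (n := Fintype.card (QIdx d N)) Fintype.card_pos
  have hwn : ‖w‖ = 1 := by
    rw [← hw, norm_pow] at hdet
    exact (pow_eq_one_iff_of_nonneg (norm_nonneg w) Fintype.card_ne_zero).1 hdet
  have hww := star_mul_self_of_norm_eq_one hwn
  have hscal : ∀ x : ℂ, star x * x = 1 →
      x • (1 : Matrix (QIdx d N) (QIdx d N) ℂ) ∈ unitaryGroup (QIdx d N) ℂ := fun x hx => by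
    rw [mem_unitaryGroup_iff']
    rw [star_smul, star_one, Matrix.smul_mul, Matrix.one_mul, smul_smul, hx, one_smul]
  have hV : star w • (U : Matrix (QIdx d N) (QIdx d N) ℂ) ∈
      specialUnitaryGroup (QIdx d N) ℂ := by
    rw [mem_specialUnitaryGroup_iff]
    constructor
    · have := mul_mem (hscal (star w) (by rw [star_star, mul_comm, hww])) U.2
      simpa using this
    · rw [Matrix.det_smul, ← hw, ← mul_pow, hww, one_pow]
  obtain ⟨V, hVG, hVU⟩ := hSU hV
  have hwG : (⟨w • 1, hscal w hww⟩ : UG d N) ∈ G.topologicalClosure :=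
    G.le_topologicalClosure (Subgroup.subset_closure (Or.inr ⟨w, rfl⟩))
  convert mul_mem hwG hVG
  ext1
  rw [Submonoid.subtype_apply] at hVU
  rw [Submonoid.coe_mul, hVU]
  simp only [Matrix.smul_mul, Matrix.one_mul, smul_smul, mul_comm w, hww, one_smul]
end

section
/- Let d ≥ 2 and n ≥ 2, and let Γ be an n-qudit gate set. Then Γ is universal if and only if there exists an integer N ≥ n such that Γ is N-universal. -/
open Matrix

section Generation

open scoped commutatorElement

variable {ι κ m o : Type*} [Fintype ι] [DecidableEq ι] [Fintype κ] [DecidableEq κ]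
  [Fintype m] [DecidableEq m] [Fintype o] [DecidableEq o]

theorem isometry_one_add_mul {V : Matrix ι κ ℂ} (hV : Vᴴ * V = 1) (P Q : Matrix κ κ ℂ) :
    (1 + V * P * Vᴴ) * (1 + V * Q * Vᴴ) = 1 + V * (P + Q + P * Q) * Vᴴ := by
  have h (X : Matrix κ ι ℂ) : Vᴴ * (V * X) = X := by
    rw [← Matrix.mul_assoc, hV, Matrix.one_mul]
  simp only [Matrix.mul_add, Matrix.add_mul, Matrix.mul_one, Matrix.one_mul, Matrix.mul_assoc, h]
  abel

/-- The embedding of `U(κ)` into `U(ι)` along an isometry `V`, acting as the identity on the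
orthogonal complement of the range of `V`. -/
noncomputable def isometryHom (V : Matrix ι κ ℂ) (hV : Vᴴ * V = 1) :
    unitaryGroup κ ℂ →* unitaryGroup ι ℂ where
  toFun A := ⟨1 + V * ((A : Matrix κ κ ℂ) - 1) * Vᴴ, by
    have hA : (A : Matrix κ κ ℂ) * (A : Matrix κ κ ℂ)ᴴ = 1 := mem_unitaryGroup_iff.1 A.2
    have h : (A : Matrix κ κ ℂ) - 1 + ((A : Matrix κ κ ℂ)ᴴ - 1)
        + ((A : Matrix κ κ ℂ) - 1) * ((A : Matrix κ κ ℂ)ᴴ - 1) = 0 := by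
      rw [Matrix.sub_mul, Matrix.mul_sub, hA]
      simp
    have h' : (1 + V * ((A : Matrix κ κ ℂ) - 1) * Vᴴ)ᴴ =
        1 + V * ((A : Matrix κ κ ℂ)ᴴ - 1) * Vᴴ := by
      simp only [conjTranspose_add, conjTranspose_mul, conjTranspose_sub, conjTranspose_one,
        conjTranspose_conjTranspose, Matrix.mul_assoc]
    rw [mem_unitaryGroup_iff, star_eq_conjTranspose, h', isometry_one_add_mul hV, h]
    simp⟩
  map_one' := Subtype.ext (by simp)
  map_mul' A B := Subtype.ext <| by
    refine Eq.trans ?_ (isometry_one_add_mul hV _ _).symm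
    change 1 + V * ((A : Matrix κ κ ℂ) * (B : Matrix κ κ ℂ) - 1) * Vᴴ = _
    congr 3
    noncomm_ring

theorem isometryHom_val (V : Matrix ι κ ℂ) (hV : Vᴴ * V = 1) (A : unitaryGroup κ ℂ) :
    (isometryHom V hV A : Matrix ι ι ℂ) = 1 + V * ((A : Matrix κ κ ℂ) - 1) * Vᴴ := rfl

omit [DecidableEq ι] [Fintype m] in
theorem isometry_mul {V : Matrix ι κ ℂ} (hV : Vᴴ * V = 1) {W : Matrix κ m ℂ} (hW : Wᴴ * W = 1) :
    (V * W)ᴴ * (V * W) = 1 := by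
  rw [conjTranspose_mul, Matrix.mul_assoc, ← Matrix.mul_assoc Vᴴ, hV, Matrix.one_mul, hW]

theorem isometryHom_isometryHom {V : Matrix ι κ ℂ} (hV : Vᴴ * V = 1) {W : Matrix κ m ℂ}
    (hW : Wᴴ * W = 1) (A : unitaryGroup m ℂ) :
    isometryHom V hV (isometryHom W hW A) = isometryHom (V * W) (isometry_mul hV hW) A := by
  apply Subtype.ext
  simp only [isometryHom_val, conjTranspose_mul, add_sub_cancel_left, Matrix.mul_assoc]

theorem conj_isometryHom (U : unitaryGroup ι ℂ) {V : Matrix ι κ ℂ} (hV : Vᴴ * V = 1)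
    {W : Matrix ι κ ℂ} (hW : Wᴴ * W = 1) (h : (U : Matrix ι ι ℂ) * V = W)
    (A : unitaryGroup κ ℂ) :
    U * isometryHom V hV A * U⁻¹ = isometryHom W hW A := by
  subst h
  have hU := mem_unitaryGroup_iff.1 U.2
  apply Subtype.ext
  simp only [isometryHom_val, conjTranspose_mul, UnitaryGroup.mul_val, UnitaryGroup.inv_val,
    Matrix.mul_add, Matrix.add_mul, Matrix.mul_one, hU]
  simp only [Matrix.mul_assoc, star_eq_conjTranspose]

/-- The isometry sending the basis vector `x` to the basis vector `e x`. -/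
noncomputable def basisIso (e : κ → ι) : Matrix ι κ ℂ := (1 : Matrix ι ι ℂ).submatrix id e

omit [Fintype ι] [Fintype κ] [DecidableEq κ] in
theorem basisIso_apply (e : κ → ι) (i : ι) (x : κ) :
    basisIso e i x = if i = e x then 1 else 0 := by
  simp [basisIso, Matrix.one_apply]

omit [Fintype κ] in
theorem basisIso_isometry {e : κ → ι} (he : Function.Injective e) :
    (basisIso e)ᴴ * basisIso e = 1 := by
  ext x y
  simp [Matrix.mul_apply, basisIso_apply, Matrix.one_apply, he.eq_iff, eq_comm]

omit [Fintype ι] [Fintype m] [DecidableEq m] in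
theorem basisIso_mul (e : κ → ι) (e' : m → κ) :
    basisIso e * basisIso e' = basisIso (e ∘ e') := by
  ext x y
  simp [Matrix.mul_apply, basisIso_apply]

/-- The embedding of `U(κ)` into `U(ι)` on the coordinates in the range of `e`. -/
noncomputable def coordHom (e : κ → ι) (he : Function.Injective e) :
    unitaryGroup κ ℂ →* unitaryGroup ι ℂ :=
  isometryHom (basisIso e) (basisIso_isometry he)

theorem coordHom_coordHom {e : κ → ι} (he : Function.Injective e) {e' : m → κ}
    (he' : Function.Injective e') (A : unitaryGroup m ℂ) :
    coordHom e he (coordHom e' he' A) = coordHom (e ∘ e') (he.comp he') A := by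
  simp only [coordHom, isometryHom_isometryHom, basisIso_mul]

theorem coordHom_mulVec_apply {e : κ → ι} (he : Function.Injective e) (A : unitaryGroup κ ℂ)
    (v : ι → ℂ) (x : κ) :
    ((coordHom e he A : Matrix ι ι ℂ) *ᵥ v) (e x) = ((A : Matrix κ κ ℂ) *ᵥ (v ∘ e)) x := by
  have h1 : (basisIso e)ᴴ *ᵥ v = v ∘ e := by
    ext y; simp [Matrix.mulVec, dotProduct, basisIso_apply]
  have h2 (w : κ → ℂ) : (basisIso e *ᵥ w) (e x) = w x := by
    simp [Matrix.mulVec, dotProduct, basisIso_apply, he.eq_iff]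
  rw [coordHom, isometryHom_val, Matrix.add_mulVec, ← Matrix.mulVec_mulVec,
    ← Matrix.mulVec_mulVec, h1, Pi.add_apply, h2, Matrix.sub_mulVec]
  simp

theorem coordHom_mulVec_apply_of_notMem {e : κ → ι} (he : Function.Injective e)
    (A : unitaryGroup κ ℂ) (v : ι → ℂ) {i : ι} (hi : ∀ x, i ≠ e x) :
    ((coordHom e he A : Matrix ι ι ℂ) *ᵥ v) i = v i := by
  have h2 (w : κ → ℂ) : (basisIso e *ᵥ w) i = 0 := by
    simp [Matrix.mulVec, dotProduct, basisIso_apply, hi]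
  rw [coordHom, isometryHom_val, Matrix.add_mulVec, ← Matrix.mulVec_mulVec,
    ← Matrix.mulVec_mulVec, Pi.add_apply, h2]
  simp

theorem unitary_ext_mulVec {U V : unitaryGroup ι ℂ}
    (h : ∀ v, (U : Matrix ι ι ℂ) *ᵥ v = (V : Matrix ι ι ℂ) *ᵥ v) : U = V :=
  Subtype.ext (Matrix.ext_of_mulVec_single fun _ => h _)

/-- Diagonal unitary matrices. -/
noncomputable def diagHom (ι : Type*) [Fintype ι] [DecidableEq ι] :
    (ι → Circle) →* unitaryGroup ι ℂ where
  toFun z := ⟨diagonal fun i => (z i : ℂ), by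
    rw [mem_unitaryGroup_iff, star_eq_conjTranspose, diagonal_conjTranspose, diagonal_mul_diagonal,
      ← diagonal_one]
    congr 1; ext i
    simp [Complex.mul_conj]⟩
  map_one' := Subtype.ext (by simp)
  map_mul' a b := Subtype.ext (by simp)

theorem diagHom_mulVec (z : ι → Circle) (v : ι → ℂ) (i : ι) :
    ((diagHom ι z : Matrix ι ι ℂ) *ᵥ v) i = z i * v i := by
  simp [diagHom, mulVec_diagonal]

theorem coordHom_diagHom {e : κ → ι} (he : Function.Injective e) (z : κ → Circle)
    {w : ι → Circle} (h1 : ∀ x, w (e x) = z x) (h2 : ∀ i, (∀ x, i ≠ e x) → w i = 1) :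
    coordHom e he (diagHom κ z) = diagHom ι w := by
  refine unitary_ext_mulVec fun v => ?_
  ext i
  by_cases hi : ∃ x, i = e x
  · obtain ⟨x, rfl⟩ := hi
    rw [coordHom_mulVec_apply, diagHom_mulVec, diagHom_mulVec, h1]; rfl
  · push Not at hi
    rw [coordHom_mulVec_apply_of_notMem he _ _ hi, diagHom_mulVec, h2 i hi]; simp

theorem diagHom_fin_two (z w : Circle) :
    (diagHom (Fin 2) ![z, w] : Matrix (Fin 2) (Fin 2) ℂ) = !![(z : ℂ), 0; 0, (w : ℂ)] := by
  ext i j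
  fin_cases i <;> fin_cases j <;> simp [diagHom]

/-- The rotation with cosine `c` and sine `s`. -/
noncomputable def planeRot (c s : ℝ) (h : c ^ 2 + s ^ 2 = 1) : unitaryGroup (Fin 2) ℂ :=
  ⟨!![(c : ℂ), -s; s, c], by
    have h' : (c : ℂ) ^ 2 + (s : ℂ) ^ 2 = 1 := by exact_mod_cast h
    rw [mem_unitaryGroup_iff]
    ext i j
    fin_cases i <;> fin_cases j <;> simp [Matrix.mul_apply, Fin.sum_univ_two, star_apply] <;>
      first | ring1 | (rw [← h']; ring1)⟩

theorem planeRot_eq_commutator (c s : ℝ) (h : c ^ 2 + s ^ 2 = 1) :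
    ∃ A B : unitaryGroup (Fin 2) ℂ, planeRot c s h = ⁅A, B⁆ := by
  obtain ⟨θ, rfl, rfl⟩ : ∃ θ : ℝ, c = Real.cos (θ + θ) ∧ s = Real.sin (θ + θ) := by
    refine ⟨Complex.arg (c + s * Complex.I) / 2, ?_⟩
    have hn : ‖(c + s * Complex.I : ℂ)‖ = 1 := by
      rw [Complex.norm_add_mul_I, h, Real.sqrt_one]
    have h0 : (c + s * Complex.I : ℂ) ≠ 0 := by
      intro h0; simp [h0] at hn
    rw [add_halves, Complex.cos_arg h0, Complex.sin_arg, hn]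
    simp
  refine ⟨planeRot (Real.cos θ) (Real.sin θ) (Real.cos_sq_add_sin_sq θ),
    diagHom (Fin 2) ![1, Circle.exp Real.pi], ?_⟩
  rw [commutatorElement_def, eq_mul_inv_iff_mul_eq, eq_mul_inv_iff_mul_eq]
  apply Subtype.ext
  ext i j
  have h2 := Complex.cos_sq_add_sin_sq (θ : ℂ)
  fin_cases i <;> fin_cases j <;>
    simp [planeRot, diagHom_fin_two, Complex.cos_add, Complex.sin_add]
  · linear_combination Complex.cos θ * h2
  · linear_combination Complex.sin θ * h2
  · linear_combination Complex.sin θ * h2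
  · linear_combination -Complex.cos θ * h2

theorem diagHom_eq_commutator (z : Circle) :
    ∃ A B : unitaryGroup (Fin 2) ℂ, diagHom (Fin 2) ![z, z⁻¹] = ⁅A, B⁆ := by
  refine ⟨diagHom (Fin 2) ![z, 1], planeRot 0 1 (by simp), ?_⟩
  rw [commutatorElement_def, eq_mul_inv_iff_mul_eq, eq_mul_inv_iff_mul_eq]
  apply Subtype.ext
  ext i j
  fin_cases i <;> fin_cases j <;> simp [planeRot, diagHom_fin_two]

omit [Fintype ι] [DecidableEq ι] in
theorem pair_injective {i j : ι} (h : i ≠ j) : Function.Injective ![i, j] := by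
  intro x y
  fin_cases x <;> fin_cases y <;> simp [h, h.symm]

theorem diagHom_mem_of_scalar_mem (H : Subgroup (unitaryGroup ι ℂ))
    (hs : ∀ z : Circle, diagHom ι (fun _ => z) ∈ H)
    (hD : ∀ i j, i ≠ j → ∀ z : Circle, diagHom ι (Pi.mulSingle i z * Pi.mulSingle j z⁻¹) ∈ H)
    (w : ι → Circle) : diagHom ι w ∈ H := by
  have hK (i : ι) (z : Circle) : Pi.mulSingle i z ∈ H.comap (diagHom ι) := by
    have hne : Nonempty ι := ⟨i⟩
    obtain ⟨w, rfl⟩ : ∃ w : Circle, w ^ Fintype.card ι = z := by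
      refine ⟨Circle.exp (Complex.arg z / Fintype.card ι), ?_⟩
      rw [← Circle.exp_nsmul, nsmul_eq_mul, mul_div_cancel₀ _ (by simp), Circle.exp_arg]
    have h1 : ∏ j, ((Pi.mulSingle i w : ι → Circle) * Pi.mulSingle j w⁻¹) ∈
        H.comap (diagHom ι) := by
      refine Subgroup.prod_mem _ fun j _ => ?_
      by_cases hij : i = j
      · subst hij
        rw [← Pi.mulSingle_mul, mul_inv_cancel, Pi.mulSingle_one]
        exact one_mem _
      · exact hD i j hij w
    rw [Finset.prod_mul_distrib, Finset.prod_const, Finset.card_univ,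
      Finset.univ_prod_mulSingle (fun _ => w⁻¹), ← Pi.mulSingle_pow] at h1
    exact (Subgroup.mul_mem_cancel_right (H.comap (diagHom ι))
      (show (fun _ => w⁻¹) ∈ H.comap (diagHom ι) from hs w⁻¹)).1 h1
  have := Subgroup.prod_mem (H.comap (diagHom ι)) (t := Finset.univ) fun i _ => hK i (w i)
  rwa [Finset.univ_prod_mulSingle] at this

/-- A vector `v` is turned into a multiple of a basis vector by two-level operations on the
coordinates in its support. -/
theorem exists_mulVec_eq_zero (H : Subgroup (unitaryGroup ι ℂ))
    (hD : ∀ w, diagHom ι w ∈ H)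
    (hR : ∀ i j, ∀ h : i ≠ j, ∀ c s hcs,
      coordHom ![i, j] (pair_injective h) (planeRot c s hcs) ∈ H)
    {i : ι} {T : Finset ι} (hT : i ∉ T) (v : ι → ℂ) (hv : ∀ k ∉ insert i T, v k = 0) :
    ∃ U ∈ H, (∀ w : ι → ℂ, (∀ k ∈ insert i T, w k = 0) → (U : Matrix ι ι ℂ) *ᵥ w = w) ∧
      ∀ k ≠ i, ((U : Matrix ι ι ℂ) *ᵥ v) k = 0 := by
  induction T using Finset.induction_on generalizing v with
  | empty => exact ⟨1, one_mem _, by simp, by simpa using hv⟩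
  | insert j T hj ih =>
    have hij : i ≠ j := by rintro rfl; simp at hT
    obtain ⟨a, ha⟩ : ∃ a : Circle, (a : ℂ) * v i = ‖v i‖ := by
      by_cases h0 : v i = 0
      · exact ⟨1, by simp [h0]⟩
      · refine ⟨(Circle.exp (Complex.arg (v i)))⁻¹, ?_⟩
        rw [Circle.coe_inv, Circle.coe_exp, inv_mul_eq_iff_eq_mul₀ (Complex.exp_ne_zero _),
          mul_comm, Complex.norm_mul_exp_arg_mul_I]
    obtain ⟨b, hb⟩ : ∃ a : Circle, (a : ℂ) * v j = ‖v j‖ := by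
      by_cases h0 : v j = 0
      · exact ⟨1, by simp [h0]⟩
      · refine ⟨(Circle.exp (Complex.arg (v j)))⁻¹, ?_⟩
        rw [Circle.coe_inv, Circle.coe_exp, inv_mul_eq_iff_eq_mul₀ (Complex.exp_ne_zero _),
          mul_comm, Complex.norm_mul_exp_arg_mul_I]
    obtain ⟨c, s, hcs, h0⟩ : ∃ c s : ℝ, c ^ 2 + s ^ 2 = 1 ∧ s * ‖v i‖ + c * ‖v j‖ = 0 := by
      by_cases h : ‖v i‖ ^ 2 + ‖v j‖ ^ 2 = 0
      · refine ⟨1, 0, by norm_num, ?_⟩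
        have : ‖v j‖ = 0 := by nlinarith [sq_nonneg ‖v i‖, sq_nonneg ‖v j‖]
        simp [this]
      · have hp : 0 < ‖v i‖ ^ 2 + ‖v j‖ ^ 2 := lt_of_le_of_ne (by positivity) (Ne.symm h)
        have hr := Real.sq_sqrt hp.le
        have hr0 := (Real.sqrt_pos.2 hp).ne'
        set r := Real.sqrt (‖v i‖ ^ 2 + ‖v j‖ ^ 2)
        refine ⟨‖v i‖ / r, -‖v j‖ / r, ?_, ?_⟩
        · field_simp
          linarith
        · field_simp
          ring
    set w : ι → Circle := Pi.mulSingle i a * Pi.mulSingle j b with hw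
    have hwi : w i = a := by simp [hw, hij]
    have hwj : w j = b := by simp [hw, hij.symm]
    have hwk (k : ι) (hi : k ≠ i) (hj : k ≠ j) : w k = 1 := by simp [hw, hi, hj]
    set R := coordHom ![i, j] (pair_injective hij) (planeRot c s hcs)
    set U₁ := R * diagHom ι w with hU₁
    have hU₁v (u : ι → ℂ) : (U₁ : Matrix ι ι ℂ) *ᵥ u =
        (R : Matrix ι ι ℂ) *ᵥ ((diagHom ι w : Matrix ι ι ℂ) *ᵥ u) := by
      rw [hU₁, UnitaryGroup.mul_val, Matrix.mulVec_mulVec]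
    have hk (u : ι → ℂ) (k : ι) (hi : k ≠ i) (hj : k ≠ j) : ((U₁ : Matrix ι ι ℂ) *ᵥ u) k = u k := by
      rw [hU₁v, coordHom_mulVec_apply_of_notMem, diagHom_mulVec, hwk k hi hj]
      · simp
      · intro x; fin_cases x <;> simpa
    have hj0 : ((U₁ : Matrix ι ι ℂ) *ᵥ v) j = 0 := by
      rw [hU₁v]
      refine (coordHom_mulVec_apply (pair_injective hij) _ _ 1).trans ?_
      simp [planeRot, diagHom_mulVec, hwi, hwj, ha, hb, vecHead, vecTail]
      exact_mod_cast h0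
    obtain ⟨U₂, hU₂, hfix, hz⟩ := ih (fun h => hT (by simp [h])) ((U₁ : Matrix ι ι ℂ) *ᵥ v) (by
      intro k hkT
      by_cases hkj : k = j
      · rw [hkj, hj0]
      · have hki : k ≠ i := by rintro rfl; simp at hkT
        rw [hk _ _ hki hkj]
        exact hv k (by simp_all))
    refine ⟨U₂ * U₁, mul_mem hU₂ (mul_mem (hR i j hij c s hcs) (hD w)), ?_, ?_⟩
    · intro u hu
      have h1 : (U₁ : Matrix ι ι ℂ) *ᵥ u = u := by
        have h2 : (diagHom ι w : Matrix ι ι ℂ) *ᵥ u = u := by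
          ext k
          rw [diagHom_mulVec]
          by_cases hi : k = i
          · simp [hi, hu i (by simp)]
          by_cases hj : k = j
          · simp [hj, hu j (by simp)]
          simp [hwk k hi hj]
        rw [hU₁v, h2]
        ext k
        by_cases hkij : ∃ x, k = ![i, j] x
        · obtain ⟨x, rfl⟩ := hkij
          have : u ∘ ![i, j] = 0 := by
            ext y; fin_cases y <;> simp [hu]
          rw [coordHom_mulVec_apply, this, mulVec_zero]
          fin_cases x <;> simp [hu]
        · push Not at hkij
          exact coordHom_mulVec_apply_of_notMem _ _ _ hkij
      rw [UnitaryGroup.mul_val, ← Matrix.mulVec_mulVec, h1]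
      exact hfix u fun k hk => hu k (by simp at hk ⊢; tauto)
    · intro k hk
      rw [UnitaryGroup.mul_val, ← Matrix.mulVec_mulVec]
      exact hz k hk

/-- Diagonal matrices and plane rotations generate the unitary group. -/
theorem eq_top_of_planeRot_mem (H : Subgroup (unitaryGroup ι ℂ))
    (hD : ∀ w, diagHom ι w ∈ H)
    (hR : ∀ i j, ∀ h : i ≠ j, ∀ c s hcs,
      coordHom ![i, j] (pair_injective h) (planeRot c s hcs) ∈ H) : H = ⊤ := by
  suffices ∀ (S : Finset ι) (U : unitaryGroup ι ℂ),
      (∀ w : ι → ℂ, (∀ k ∈ S, w k = 0) → (U : Matrix ι ι ℂ) *ᵥ w = w) → U ∈ H by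
    refine eq_top_iff.2 fun U _ => this Finset.univ U fun w hw => ?_
    have : w = 0 := by ext k; simpa using hw k
    simp [this]
  intro S
  induction S using Finset.induction_on with
  | empty =>
    intro U hU
    have : U = 1 := unitary_ext_mulVec fun v => by simpa using hU v
    exact this ▸ one_mem _
  | insert i S hi ih =>
    intro U hU
    have hinv (w : ι → ℂ) : (U : Matrix ι ι ℂ)ᴴ *ᵥ ((U : Matrix ι ι ℂ) *ᵥ w) = w := by
      rw [Matrix.mulVec_mulVec, ← star_eq_conjTranspose, mem_unitaryGroup_iff'.1 U.2,
        Matrix.one_mulVec]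
    obtain ⟨V, hV, hfix, hz⟩ := exists_mulVec_eq_zero H hD hR hi
      ((U : Matrix ι ι ℂ) *ᵥ Pi.single i 1) (by
        intro k hk
        have h1 := hinv (Pi.single k 1)
        rw [hU (Pi.single k 1) (by
          intro l hl
          rw [Pi.single_eq_of_ne]
          rintro rfl
          exact hk hl)] at h1
        have h2 := congrFun h1 i
        rw [Matrix.mulVec_single_one, Pi.single_eq_of_ne (by rintro rfl; simp at hk)] at h2
        rw [Matrix.mulVec_single_one]
        simpa using h2)
    have hcol : ((V * U : unitaryGroup ι ℂ) : Matrix ι ι ℂ) *ᵥ Pi.single i 1 =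
        Pi.single i (((V * U : unitaryGroup ι ℂ) : Matrix ι ι ℂ) i i) := by
      ext k
      by_cases hk : k = i
      · subst hk; simp
      · rw [UnitaryGroup.mul_val, ← Matrix.mulVec_mulVec, hz k hk, Pi.single_eq_of_ne hk]
    set W := V * U with hW
    set c := (W : Matrix ι ι ℂ) i i with hc
    have hc1 : star c * c = 1 := by
      have h1 := congrFun (congrFun (mem_unitaryGroup_iff'.1 W.2) i) i
      rw [Matrix.mul_apply, Finset.sum_eq_single i] at h1
      · simpa using h1
      · intro k _ hk
        have := congrFun hcol k
        rw [Matrix.mulVec_single_one, Pi.single_eq_of_ne hk] at this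
        simp at this
        simp [this]
      · simp
    have hcn : ‖star c‖ = 1 := by
      have h1 := congrArg norm hc1
      rw [norm_mul, norm_star, norm_one] at h1
      rw [norm_star]
      nlinarith [norm_nonneg c]
    set z : Circle := ⟨star c, mem_sphere_zero_iff_norm.2 hcn⟩
    have hmem := ih (diagHom ι (Pi.mulSingle i z) * W) (by
      intro w hw
      have hdec : w = Pi.single i (w i) + (w - Pi.single i (w i)) := by abel
      have hrest : (W : Matrix ι ι ℂ) *ᵥ (w - Pi.single i (w i)) = w - Pi.single i (w i) := by
        have h0 : ∀ k ∈ insert i S, (w - (Pi.single i (w i) : ι → ℂ)) k = 0 := by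
          intro k hk
          rcases Finset.mem_insert.1 hk with rfl | hk
          · simp
          · rw [Pi.sub_apply, hw k hk, Pi.single_eq_of_ne (ne_of_mem_of_not_mem hk hi), sub_zero]
        rw [hW, UnitaryGroup.mul_val, ← Matrix.mulVec_mulVec, hU _ h0, hfix _ h0]
      have hone : (W : Matrix ι ι ℂ) *ᵥ Pi.single i (w i) = Pi.single i (c * w i) := by
        have : (Pi.single i (w i) : ι → ℂ) = w i • Pi.single i 1 := by
          rw [← Pi.single_smul, smul_eq_mul, mul_one]
        rw [this, Matrix.mulVec_smul, hcol, ← Pi.single_smul, smul_eq_mul, mul_comm]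
      rw [UnitaryGroup.mul_val, ← Matrix.mulVec_mulVec]
      ext k
      rw [diagHom_mulVec, hdec, Matrix.mulVec_add, hone, hrest]
      by_cases hk : k = i
      · subst hk
        have : (z : ℂ) = star c := rfl
        simp only [Pi.mulSingle_eq_same, this, Pi.add_apply, Pi.single_eq_same, Pi.sub_apply,
          sub_self, add_zero, ← mul_assoc, hc1, one_mul]
      · simp [hk])
    rw [Subgroup.mul_mem_cancel_left _ (hD _), hW, Subgroup.mul_mem_cancel_left _ hV] at hmem
    exact hmem

/-- Scalars and commutators in the two-level unitary groups generate the unitary group. -/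
theorem eq_top_of_commutator_mem (H : Subgroup (unitaryGroup ι ℂ))
    (hs : ∀ z : Circle, diagHom ι (fun _ => z) ∈ H)
    (hH : ∀ i j, ∀ h : i ≠ j, ∀ A B : unitaryGroup (Fin 2) ℂ,
      coordHom ![i, j] (pair_injective h) ⁅A, B⁆ ∈ H) : H = ⊤ := by
  refine eq_top_of_planeRot_mem H (diagHom_mem_of_scalar_mem H hs ?_) ?_
  · intro i j hij z
    obtain ⟨A, B, hAB⟩ := diagHom_eq_commutator z
    have h := hH i j hij A B
    rw [← hAB, coordHom_diagHom (w := Pi.mulSingle i z * Pi.mulSingle j z⁻¹)] at h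
    · exact h
    · intro x; fin_cases x <;> simp [hij, hij.symm]
    · intro k hk
      have h0 := hk 0
      have h1 := hk 1
      simp at h0 h1
      simp [h0, h1]
  · intro i j hij c s hcs
    obtain ⟨A, B, hAB⟩ := planeRot_eq_commutator c s hcs
    exact hAB ▸ hH i j hij A B

/-- Membership of the two-level commutators in a subgroup is transitive in the levels. -/
theorem coordHom_commutator_mem_trans (H : Subgroup (unitaryGroup ι ℂ)) {i j k : ι}
    (hij : i ≠ j) (hjk : j ≠ k) (hik : i ≠ k)
    (h₁ : ∀ A B : unitaryGroup (Fin 2) ℂ, coordHom ![i, j] (pair_injective hij) ⁅A, B⁆ ∈ H)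
    (h₂ : ∀ A B : unitaryGroup (Fin 2) ℂ, coordHom ![j, k] (pair_injective hjk) ⁅A, B⁆ ∈ H)
    (A B : unitaryGroup (Fin 2) ℂ) : coordHom ![i, k] (pair_injective hik) ⁅A, B⁆ ∈ H := by
  set W := coordHom ![j, k] (pair_injective hjk) (planeRot 0 1 (by simp)) with hWdef
  have hW : W ∈ H := by
    obtain ⟨A, B, hAB⟩ := planeRot_eq_commutator 0 1 (by simp)
    rw [hWdef, hAB]
    exact h₂ A B
  have hcol (v : ι → ℂ) (h : v k = 0) : (W : Matrix ι ι ℂ) *ᵥ v =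
      fun l => if l = j then 0 else if l = k then v j else v l := by
    ext l
    by_cases hl : ∃ x, l = ![j, k] x
    · obtain ⟨x, rfl⟩ := hl
      rw [coordHom_mulVec_apply]
      fin_cases x <;> simp [planeRot, h, hjk.symm, vecHead, vecTail]
    · push Not at hl
      rw [coordHom_mulVec_apply_of_notMem _ _ _ hl]
      have h0 := hl 0
      have h1 := hl 1
      simp at h0 h1
      simp [h0, h1]
  have hWV : (W : Matrix ι ι ℂ) * basisIso ![i, j] = basisIso ![i, k] := by
    ext l x
    have := congrFun (hcol (fun l => basisIso ![i, j] l x) (by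
      fin_cases x <;> simp [basisIso_apply, hik.symm, hjk.symm])) l
    refine this.trans ?_
    fin_cases x <;> simp [basisIso_apply] <;> grind
  have := conj_isometryHom W (basisIso_isometry (pair_injective hij))
    (basisIso_isometry (pair_injective hik)) hWV ⁅A, B⁆
  rw [coordHom, ← this]
  exact mul_mem (mul_mem hW (h₁ A B)) (inv_mem hW)

/-- The block diagonal unitaries with respect to an identification of the index set with a
product. -/
def blockHom (φ : ι ≃ m × o) : (o → unitaryGroup m ℂ) →* unitaryGroup ι ℂ where
  toFun M := ⟨(blockDiagonal fun x => (M x : Matrix m m ℂ)).submatrix φ φ, by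
    rw [mem_unitaryGroup_iff, star_eq_conjTranspose, conjTranspose_submatrix,
      submatrix_mul_equiv, blockDiagonal_conjTranspose, ← blockDiagonal_mul]
    have h (x : o) : (M x : Matrix m m ℂ) * (M x : Matrix m m ℂ)ᴴ = 1 :=
      mem_unitaryGroup_iff.1 (M x).2
    simp only [h]
    exact (congrArg (fun X => submatrix X φ φ) blockDiagonal_one).trans (submatrix_one_equiv φ)⟩
  map_one' := Subtype.ext <|
    (congrArg (fun X => submatrix X φ φ) blockDiagonal_one).trans (submatrix_one_equiv φ)
  map_mul' A B := Subtype.ext <| by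
    simp only [Pi.mul_apply, UnitaryGroup.mul_val, blockDiagonal_mul]
    exact (submatrix_mul_equiv _ _ _ _ _).symm

theorem blockHom_apply (φ : ι ≃ m × o) (M : o → unitaryGroup m ℂ) (i j : ι) :
    (blockHom φ M : Matrix ι ι ℂ) i j =
      if (φ i).2 = (φ j).2 then (M (φ i).2 : Matrix m m ℂ) (φ i).1 (φ j).1 else 0 := by
  simp [blockHom, blockDiagonal_apply]

theorem blockHom_mulVec (φ : ι ≃ m × o) (M : o → unitaryGroup m ℂ) (v : ι → ℂ) (i : ι) :
    ((blockHom φ M : Matrix ι ι ℂ) *ᵥ v) i =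
      ((M (φ i).2 : Matrix m m ℂ) *ᵥ fun y => v (φ.symm (y, (φ i).2))) (φ i).1 := by
  simp only [mulVec, dotProduct, blockHom_apply]
  rw [← φ.symm.sum_comp, Fintype.sum_prod_type]
  simp

theorem continuous_blockHom (φ : ι ≃ m × o) : Continuous (blockHom φ) := by
  refine Continuous.subtype_mk ?_ _
  refine Continuous.matrix_submatrix (Continuous.matrix_blockDiagonal ?_) _ _
  exact continuous_pi fun x => continuous_subtype_val.comp (continuous_apply x)

end Generation

section Qudits

open scoped commutatorElement

variable {d N : ℕ}

/-- The gates acting on the qudit `t`, controlled by all other qudits. -/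
def controlledHom {J : Type*} [Fintype J] [DecidableEq J] (d : ℕ) (t : J) :
    (({j // j ≠ t} → Fin d) → unitaryGroup (Fin d) ℂ) →* unitaryGroup (J → Fin d) ℂ :=
  blockHom (Equiv.funSplitAt t (Fin d))

/-- The gates on `N + 1` qudits acting trivially on the qudit `a`. -/
def spectatorHom (d : ℕ) (a : Fin (N + 1)) : UG d N →* UG d (N + 1) :=
  (blockHom ((Fin.insertNthEquiv (fun _ => Fin d) a).symm.trans (Equiv.prodComm _ _))).comp
    (Pi.constMonoidHom _ _)

theorem spectatorHom_apply (a : Fin (N + 1)) (u : UG d N) (f g : QIdx d (N + 1)) :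
    (spectatorHom d a u : Matrix (QIdx d (N + 1)) (QIdx d (N + 1)) ℂ) f g =
      if f a = g a then
        (u : Matrix (QIdx d N) (QIdx d N) ℂ) (fun j => f (a.succAbove j))
          (fun j => g (a.succAbove j)) else 0 :=
  blockHom_apply _ _ _ _

theorem continuous_spectatorHom (a : Fin (N + 1)) : Continuous (spectatorHom d a) :=
  (continuous_blockHom _).comp (continuous_pi fun _ => continuous_id)

theorem controlledHom_apply {J : Type*} [Fintype J] [DecidableEq J] (t : J)
    (M : ({j // j ≠ t} → Fin d) → unitaryGroup (Fin d) ℂ) (f g : J → Fin d) :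
    (controlledHom d t M : Matrix (J → Fin d) (J → Fin d) ℂ) f g =
      if (fun j : {j // j ≠ t} => f j) = (fun j : {j // j ≠ t} => g j) then
        (M fun j => f j : Matrix (Fin d) (Fin d) ℂ) (f t) (g t) else 0 :=
  blockHom_apply _ _ _ _

theorem controlledHom_mulSingle {J : Type*} [Fintype J] [DecidableEq J] (t : J) (p : J → Fin d)
    (A : unitaryGroup (Fin d) ℂ) :
    controlledHom d t (Pi.mulSingle (fun j => p j) A) =
      coordHom (Function.update p t) (Function.update_injective p t) A := by
  refine unitary_ext_mulVec fun v => ?_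
  ext f
  rw [controlledHom, blockHom_mulVec]
  by_cases hf : ∃ x, f = Function.update p t x
  · obtain ⟨x, rfl⟩ := hf
    rw [coordHom_mulVec_apply]
    have h1 : (fun j : {j // j ≠ t} => Function.update p t x j) =
        fun j : {j // j ≠ t} => p j := by
      ext j; simp [j.2]
    have h2 (y : Fin d) : (Equiv.funSplitAt t (Fin d)).symm (y, fun j => p j.1) =
        Function.update p t y := by
      ext j
      by_cases hj : j = t
      · subst hj; simp
      · simp [hj]
    simp only [Equiv.funSplitAt_apply, h1, Pi.mulSingle_eq_same, h2, Function.update_self]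
    rfl
  · push Not at hf
    rw [coordHom_mulVec_apply_of_notMem _ _ _ hf, Pi.mulSingle_eq_of_ne]
    · simp only [UnitaryGroup.one_val, one_mulVec]
      exact congrArg v ((Equiv.funSplitAt t (Fin d)).symm_apply_apply f)
    · intro h
      refine hf (f t) ?_
      ext j
      by_cases hj : j = t
      · subst hj; simp
      · have := congrFun h ⟨j, hj⟩
        simp at this
        simp [hj, this]

theorem spectatorHom_controlledHom (a : Fin (N + 1)) (t : Fin N)
    (M : ({j // j ≠ t} → Fin d) → unitaryGroup (Fin d) ℂ) :
    spectatorHom d a (controlledHom d t M) = controlledHom d (a.succAbove t) fun r =>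
      M fun j => r ⟨a.succAbove j, fun h => j.2 (Fin.succAbove_right_injective h)⟩ := by
  apply Subtype.ext
  ext f g
  rw [spectatorHom_apply, controlledHom_apply, controlledHom_apply, ← ite_and]
  refine if_congr ?_ rfl rfl
  simp only [funext_iff, Subtype.forall, Fin.forall_iff_succAbove a, ne_eq,
    Fin.succAbove_right_inj, (Fin.succAbove_ne a t).symm, not_false_eq_true, forall_const]

theorem coordHom_update_commutator_mem (hN : 2 ≤ N) (H : Subgroup (UG d (N + 1)))
    (hH : ∀ a u, spectatorHom d a u ∈ H) (p : QIdx d (N + 1)) (t : Fin (N + 1))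
    (A B : unitaryGroup (Fin d) ℂ) :
    coordHom (Function.update p t) (Function.update_injective p t) ⁅A, B⁆ ∈ H := by
  obtain ⟨a, b, hta, htb, hab⟩ : ∃ a b : Fin (N + 1), t ≠ a ∧ t ≠ b ∧ a ≠ b := by
    obtain ⟨a, ha⟩ := Finset.exists_mem_notMem_of_card_lt_card (s := {t}) (t := Finset.univ)
      (by simp; omega)
    obtain ⟨b, hb⟩ := Finset.exists_mem_notMem_of_card_lt_card (s := {t, a}) (t := Finset.univ)
      (lt_of_le_of_lt Finset.card_le_two (by simp; omega))
    simp at ha hb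
    exact ⟨a, b, Ne.symm ha, Ne.symm hb.1, Ne.symm hb.2⟩
  have key (a : Fin (N + 1)) (hta : t ≠ a) (A : unitaryGroup (Fin d) ℂ) :
      ∃ M, controlledHom d t M ∈ H ∧ M (fun j => p j) = A ∧
        ∀ r : {j // j ≠ t} → Fin d, (∃ j, j.1 ≠ a ∧ r j ≠ p j) → M r = 1 := by
    obtain ⟨s, rfl⟩ := Fin.exists_succAbove_eq hta
    have hmem := hH a (controlledHom d s (Pi.mulSingle (fun j => p (a.succAbove j.1)) A))
    rw [spectatorHom_controlledHom] at hmem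
    refine ⟨_, hmem, Pi.mulSingle_eq_same _ _, ?_⟩
    rintro r ⟨⟨j, hj⟩, hja, hr⟩
    obtain ⟨k, rfl⟩ := Fin.exists_succAbove_eq hja
    refine Pi.mulSingle_eq_of_ne (fun h => hr ?_) _
    exact congrFun h (⟨k, fun h => hj (congrArg _ h)⟩ : {j // j ≠ s})
  obtain ⟨M, hM, hMA, hM1⟩ := key a hta A
  obtain ⟨M', hM', hMB, hM1'⟩ := key b htb B
  have hcomm : ⁅M, M'⁆ = Pi.mulSingle (fun j : {j // j ≠ t} => p j) ⁅A, B⁆ := by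
    ext1 r
    change ⁅M r, M' r⁆ = _
    by_cases hr : r = fun j : {j // j ≠ t} => p j
    · rw [hr, hMA, hMB, Pi.mulSingle_eq_same]
    · rw [Pi.mulSingle_eq_of_ne hr]
      obtain ⟨j, hj⟩ := Function.ne_iff.1 hr
      by_cases hja : j.1 = a
      · rw [hM1' r ⟨j, hja ▸ hab, hj⟩, commutatorElement_one_right]
      · rw [hM1 r ⟨j, hja, hj⟩, commutatorElement_one_left]
  rw [← controlledHom_mulSingle, ← hcomm, map_commutatorElement]
  exact mul_mem (mul_mem (mul_mem hM hM') (inv_mem hM)) (inv_mem hM')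

/-- For `N ≥ 2`, the gates on `N` out of `N + 1` qudits generate all gates on `N + 1` qudits. -/
theorem eq_top_of_spectatorHom_mem (hN : 2 ≤ N) (H : Subgroup (UG d (N + 1)))
    (hs : ∀ z : Circle, diagHom _ (fun _ => z) ∈ H)
    (hH : ∀ a u, spectatorHom d a u ∈ H) : H = ⊤ := by
  refine eq_top_of_commutator_mem H hs fun f g hfg => ?_
  suffices h : ∀ S : Finset (Fin (N + 1)), ∀ hne : f ≠ S.piecewise g f,
      ∀ A B : unitaryGroup (Fin 2) ℂ,
        coordHom ![f, S.piecewise g f] (pair_injective hne) ⁅A, B⁆ ∈ H by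
    have := h Finset.univ
    simp only [Finset.piecewise_univ] at this
    exact this hfg
  intro S
  induction S using Finset.induction_on with
  | empty => simp
  | insert t S ht ih =>
    rw [Finset.piecewise_insert]
    set k := S.piecewise g f with hk
    intro hne
    by_cases hkt : k = Function.update k t (g t)
    · simpa only [← hkt] using ih (hkt ▸ hne)
    have hlast (A B : unitaryGroup (Fin 2) ℂ) :
        coordHom ![k, Function.update k t (g t)] (pair_injective hkt) ⁅A, B⁆ ∈ H := by
      have hkt' : k t ≠ g t := fun h => hkt (by rw [← h, Function.update_eq_self])
      have h := coordHom_update_commutator_mem hN H hH k t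
        (coordHom ![k t, g t] (pair_injective hkt') A) (coordHom ![k t, g t] (pair_injective hkt') B)
      rw [← map_commutatorElement, coordHom_coordHom] at h
      have he : Function.update k t ∘ ![k t, g t] = ![k, Function.update k t (g t)] := by
        ext x : 1
        fin_cases x <;> simp
      simpa only [he] using h
    by_cases hfk : f = k
    · simpa only [← hfk] using hlast
    · exact coordHom_commutator_mem_trans H hfk hkt hne (ih hfk) hlast

theorem permMatrix_conj_apply (σ : Equiv.Perm (Fin N)) (X : Matrix (QIdx d N) (QIdx d N) ℂ)
    (f g : QIdx d N) :
    (permMatrix d N σ * X * permMatrix d N σ⁻¹) f g = X (f ∘ ⇑σ⁻¹) (g ∘ ⇑σ⁻¹) := by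
  have h1 (h : QIdx d N) : f = h ∘ σ ↔ h = f ∘ ⇑σ⁻¹ :=
    ⟨fun e => by ext; simp [e], fun e => by ext; simp [e]⟩
  simp [Matrix.mul_apply, permMatrix, h1]

theorem spectatorHom_mem_gateConj {n : ℕ} (h : n ≤ N) (Γ : Set (UG d n)) (a : Fin (N + 1))
    {v : UG d N} (hv : v ∈ gateConj d n N h Γ) :
    spectatorHom d a v ∈ gateConj d n (N + 1) (h.trans N.le_succ) Γ := by
  obtain ⟨u, hu, σ, hσ⟩ := hv
  set ρ : Equiv.Perm (Fin (N + 1)) := (finSuccEquiv' (Fin.last N)).trans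
    ((Equiv.optionCongr σ⁻¹).trans (finSuccEquiv' a).symm) with hρ
  have hρl : ρ (Fin.last N) = a := by simp [hρ]
  have hρc (j : Fin N) : ρ j.castSucc = a.succAbove (σ⁻¹ j) := by
    have h1 := finSuccEquiv'_succAbove (Fin.last N) j
    rw [Fin.succAbove_last] at h1
    simp [hρ, h1]
  refine ⟨u, hu, ρ⁻¹, ?_⟩
  ext f g
  rw [permMatrix_conj_apply, spectatorHom_apply, hσ, permMatrix_conj_apply, inv_inv]
  simp only [tensorExt, of_apply, Function.comp_apply]
  have hcast (i : Fin n) : ρ (Fin.castLE (h.trans N.le_succ) i) =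
      a.succAbove (σ⁻¹ (Fin.castLE h i)) := hρc (Fin.castLE h i)
  simp only [hcast, Fin.forall_fin_succ', hρc, hρl, Fin.val_castSucc, Fin.val_last, h,
    forall_const]
  by_cases ha : f a = g a <;> simp [ha]

theorem IsNUniversal.succ {n : ℕ} (hN : 2 ≤ N) {Γ : Set (UG d n)} (h : IsNUniversal d n N Γ) :
    IsNUniversal d n (N + 1) Γ := by
  obtain ⟨hnN, hdense⟩ := h
  refine ⟨hnN.trans N.le_succ, ?_⟩
  set G := Subgroup.closure (gateConj d n (N + 1) (hnN.trans N.le_succ) Γ ∪ scalarSet _) with hG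
  suffices htop : G.topologicalClosure = ⊤ by
    rw [IsCompleteGateSet, dense_iff_closure_eq, ← hG, ← Subgroup.topologicalClosure_coe, htop,
      Subgroup.coe_top]
  have hscalar : ∀ s ∈ scalarSet (QIdx d (N + 1)), s ∈ G.topologicalClosure := fun s hs =>
    G.le_topologicalClosure (Subgroup.subset_closure (Or.inr hs))
  refine eq_top_of_spectatorHom_mem hN _ (fun z => hscalar _ ⟨z, ?_⟩) fun a u => ?_
  · simp [diagHom, smul_one_eq_diagonal]
  · have hclosed : IsClosed ((G.topologicalClosure.comap (spectatorHom d a) : Subgroup (UG d N)) :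
        Set (UG d N)) :=
      G.isClosed_topologicalClosure.preimage (continuous_spectatorHom a)
    have hle : Subgroup.closure (gateConj d n N hnN Γ ∪ scalarSet _) ≤
        G.topologicalClosure.comap (spectatorHom d a) := by
      rw [Subgroup.closure_le]
      rintro v (hv | ⟨α, hα⟩)
      · exact G.le_topologicalClosure
          (Subgroup.subset_closure (Or.inl (spectatorHom_mem_gateConj hnN Γ a hv)))
      · refine hscalar _ ⟨α, ?_⟩
        ext f g
        rw [spectatorHom_apply, hα]
        simp only [Matrix.smul_apply, Matrix.one_apply, funext_iff, Fin.forall_iff_succAbove a, smul_eq_mul,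
          mul_ite, mul_one, mul_zero, ite_and]
    exact closure_minimal hle hclosed (hdense u)

end Qudits

/-- For `d, n ≥ 2`, an `n`-qudit gate set `Γ` is universal if and only if
it is `N`-universal for some integer `N ≥ n`. -/
theorem universal_iff_exists_nUniversal {d n : ℕ} (hd : 2 ≤ d) (hn : 2 ≤ n)
    (Γ : Set (UG d n)) (hΓ : Γ.Finite) :
    IsUniversal d n Γ ↔ ∃ N, n ≤ N ∧ IsNUniversal d n N Γ := by
  refine ⟨fun ⟨N, hN, h⟩ => ⟨N, hN, h N le_rfl⟩, fun ⟨N, hN, h⟩ => ⟨N, hN, fun M hM => ?_⟩⟩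
  induction M, hM using Nat.le_induction with
  | base => exact h
  | succ M hM ih => exact ih.succ (hn.trans (hN.trans hM))
end

section
/- Let Γ ⊆ U(2). Then Γ is complete if and only if M_{12}(Γ) = M_{12}(GL_2(ℂ)). -/
open Matrix

/-- The `k`-th tensor power of a matrix (acting on `V^{⊗k}` where `V = ℂ^ι`). -/
def tpow {ι : Type*} [Fintype ι] (k : ℕ) (g : Matrix ι ι ℂ) :
    Matrix (Fin k → ι) (Fin k → ι) ℂ :=
  Matrix.of fun f f' => ∏ i, g (f i) (f' i)

/-- The space of linear functionals on `End(V^{⊗k})` invariant under the conjugation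
action `X ↦ g^{⊗k} X (g^{⊗k})⁻¹` of all `g ∈ C`. -/
noncomputable def invFunctionals {ι : Type*} [Fintype ι] [DecidableEq ι] (k : ℕ)
    (C : Set (Matrix ι ι ℂ)) :
    Submodule ℂ ((Matrix (Fin k → ι) (Fin k → ι) ℂ) →ₗ[ℂ] ℂ) where
  carrier := {f | ∀ g ∈ C, ∀ X, f (tpow k g * X * tpow k g⁻¹) = f X}
  add_mem' := by intro a b ha hb g hg X; simp [ha g hg X, hb g hg X]
  zero_mem' := by intro g hg X; simp
  smul_mem' := by intro c a ha g hg X; simp [ha g hg X]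

/-- `M_{2k}(C)`: the dimension of the space of invariant linear functionals on
`End(V^{⊗k})` for the conjugation action of `C`. -/
noncomputable def Mdim {ι : Type*} [Fintype ι] [DecidableEq ι] (k : ℕ)
    (C : Set (Matrix ι ι ℂ)) : ℕ :=
  Module.finrank ℂ (invFunctionals k C)

/-- The Kronecker product of a finite family of matrices. -/
def kron {ι : Type*} {k : ℕ} (B : Fin k → Matrix ι ι ℂ) :
    Matrix (Fin k → ι) (Fin k → ι) ℂ :=
  Matrix.of fun I J => ∏ m, B m (I m) (J m)

lemma tpow_eq_kron {ι : Type*} [Fintype ι] (k : ℕ) (g : Matrix ι ι ℂ) :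
    tpow k g = kron fun _ => g := rfl

lemma kron_mul {ι : Type*} [Fintype ι] [DecidableEq ι] {k : ℕ} (A B : Fin k → Matrix ι ι ℂ) :
    kron A * kron B = kron fun m => A m * B m := by
  ext I J
  simp only [kron, Matrix.mul_apply, Matrix.of_apply, ← Finset.prod_mul_distrib]
  rw [Finset.prod_univ_sum]
  simp

lemma trace_kron {ι : Type*} [Fintype ι] [DecidableEq ι] {k : ℕ} (A : Fin k → Matrix ι ι ℂ) :
    (kron A).trace = ∏ m, (A m).trace := by
  simp only [kron, Matrix.trace, Matrix.diag_apply, Matrix.of_apply]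
  rw [Finset.prod_univ_sum]
  simp

lemma tpow_one {ι : Type*} [Fintype ι] [DecidableEq ι] (k : ℕ) :
    tpow k (1 : Matrix ι ι ℂ) = 1 := by
  ext I J
  by_cases h : I = J
  · subst h; simp [tpow]
  · obtain ⟨m, hm⟩ := Function.ne_iff.mp h
    rw [Matrix.one_apply_ne h]
    exact Finset.prod_eq_zero (Finset.mem_univ m) (Matrix.one_apply_ne hm)

lemma tpow_mul {ι : Type*} [Fintype ι] [DecidableEq ι] (k : ℕ) (g h : Matrix ι ι ℂ) :
    tpow k (g * h) = tpow k g * tpow k h := by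
  simp only [tpow_eq_kron, kron_mul]

lemma tpow_smul {ι : Type*} [Fintype ι] [DecidableEq ι] (k : ℕ) (c : ℂ) (g : Matrix ι ι ℂ) :
    tpow k (c • g) = c ^ k • tpow k g := by
  ext I J
  simp [tpow, Finset.prod_mul_distrib]

open Quaternion

/-- The standard representation of the quaternions by complex `2 × 2` matrices. -/
noncomputable def quatMatrix (q : ℍ[ℝ]) : Matrix (Fin 2) (Fin 2) ℂ :=
  !![⟨q.re, q.imI⟩, ⟨q.imJ, q.imK⟩; ⟨-q.imJ, q.imK⟩, ⟨q.re, -q.imI⟩]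

lemma quatMatrix_mul (p q : ℍ[ℝ]) : quatMatrix (p * q) = quatMatrix p * quatMatrix q := by
  ext i j
  fin_cases i <;> fin_cases j <;>
    simp [quatMatrix, Matrix.mul_apply, Complex.ext_iff] <;> constructor <;> ring

lemma quatMatrix_one : quatMatrix 1 = 1 := by
  ext i j
  fin_cases i <;> fin_cases j <;> simp [quatMatrix, Complex.ext_iff]

lemma quatMatrix_neg (q : ℍ[ℝ]) : quatMatrix (-q) = -quatMatrix q := by
  ext i j
  fin_cases i <;> fin_cases j <;> simp [quatMatrix, Complex.ext_iff]

lemma quatMatrix_star (q : ℍ[ℝ]) : quatMatrix (star q) = star (quatMatrix q) := by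
  ext i j
  fin_cases i <;> fin_cases j <;> simp [quatMatrix, Matrix.star_apply, Complex.ext_iff]

lemma trace_quatMatrix (q : ℍ[ℝ]) : (quatMatrix q).trace = ((2 * q.re : ℝ) : ℂ) := by
  simp [quatMatrix, Matrix.trace_fin_two, Complex.ext_iff]; ring

lemma trace_kron_conj {k : ℕ} (a b : Fin k → ℍ[ℝ]) (u : ℍ[ℝ]) :
    (kron (fun m => quatMatrix (a m)) * (tpow k (quatMatrix u) *
      kron (fun m => quatMatrix (b m)) * tpow k (quatMatrix (star u)))).trace =
      ((∏ m, (2 * (a m * (u * b m * star u)).re) : ℝ) : ℂ) := by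
  simp only [tpow_eq_kron, kron_mul, ← quatMatrix_mul, trace_kron, trace_quatMatrix]
  push_cast
  rfl

/-- Functionals on `End (V^{⊗6})` invariant under `S` are invariant under all unit quaternions. -/
def InvariantsSpread (S : Set ℍ[ℝ]) : Prop :=
  ∀ f : Matrix (Fin 6 → Fin 2) (Fin 6 → Fin 2) ℂ →ₗ[ℂ] ℂ,
    (∀ s ∈ S, ∀ X, f (tpow 6 (quatMatrix s) * X * tpow 6 (quatMatrix (star s))) = f X) →
    ∀ u : ℍ[ℝ], u * star u = 1 →
      ∀ X, f (tpow 6 (quatMatrix u) * X * tpow 6 (quatMatrix (star u))) = f X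

/-- A multiplicative set of unit quaternions closed under conjugation. -/
structure IsUnitQuatGroup (S : Set ℍ[ℝ]) : Prop where
  one_mem : 1 ∈ S
  mul_mem : ∀ {s t}, s ∈ S → t ∈ S → s * t ∈ S
  star_mem : ∀ {s}, s ∈ S → star s ∈ S
  mul_star : ∀ {s}, s ∈ S → s * star s = 1
  star_mul : ∀ {s}, s ∈ S → star s * s = 1

/-- The functional `X ↦ tr ((A₁ ⊗ ⋯ ⊗ A₆) X)`. -/
noncomputable def traceKron (a : Fin 6 → ℍ[ℝ]) :
    Matrix (Fin 6 → Fin 2) (Fin 6 → Fin 2) ℂ →ₗ[ℂ] ℂ :=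
  (Matrix.traceLinearMap _ ℂ ℂ).comp (LinearMap.mulLeft ℂ (kron fun m => quatMatrix (a m)))

lemma traceKron_apply (a : Fin 6 → ℍ[ℝ]) (X : Matrix (Fin 6 → Fin 2) (Fin 6 → Fin 2) ℂ) :
    traceKron a X = (kron (fun m => quatMatrix (a m)) * X).trace := rfl

lemma traceKron_conj (a : Fin 6 → ℍ[ℝ]) (s : ℍ[ℝ])
    (X : Matrix (Fin 6 → Fin 2) (Fin 6 → Fin 2) ℂ) :
    traceKron a (tpow 6 (quatMatrix s) * X * tpow 6 (quatMatrix (star s))) =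
      traceKron (fun m => star s * a m * s) X := by
  simp only [traceKron_apply, quatMatrix_mul, tpow_eq_kron]
  rw [← kron_mul, ← kron_mul, ← Matrix.mul_assoc, ← Matrix.mul_assoc, Matrix.trace_mul_comm,
    ← Matrix.mul_assoc, ← Matrix.mul_assoc]

lemma InvariantsSpread.sum_prod_re {S : Set ℍ[ℝ]} (hinv : InvariantsSpread S)
    (hS : IsUnitQuatGroup S) {F : Finset ℍ[ℝ]} (hF : ∀ s, s ∈ F ↔ s ∈ S)
    (a b : Fin 6 → ℍ[ℝ]) {u : ℍ[ℝ]} (hu : u * star u = 1) :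
    ∑ s ∈ F, ∏ m, (a m * ((s * u) * b m * star (s * u))).re =
      ∑ s ∈ F, ∏ m, (a m * (s * b m * star s)).re := by
  have key := hinv (∑ s ∈ F, traceKron fun m => star s * a m * s) (fun t ht X => by
    simp only [LinearMap.sum_apply, traceKron_conj]
    refine Finset.sum_nbij' (fun s => s * t) (fun s => s * star t) ?_ ?_ ?_ ?_ ?_
    · intro s hs
      exact (hF _).2 (hS.mul_mem ((hF _).1 hs) ht)
    · intro s hs
      exact (hF _).2 (hS.mul_mem ((hF _).1 hs) (hS.star_mem ht))
    · intro s _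
      simp [mul_assoc, hS.mul_star ht]
    · intro s _
      simp [mul_assoc, hS.star_mul ht]
    · intro s _
      congr 2
      ext1 m
      simp [mul_assoc]) u hu (kron fun m => quatMatrix (b m))
  simp only [LinearMap.sum_apply, ← traceKron_conj] at key
  have e : ∀ s, tpow 6 (quatMatrix s) * (tpow 6 (quatMatrix u) *
      (kron fun m => quatMatrix (b m)) * tpow 6 (quatMatrix (star u))) *
      tpow 6 (quatMatrix (star s)) = tpow 6 (quatMatrix (s * u)) *
      (kron fun m => quatMatrix (b m)) * tpow 6 (quatMatrix (star (s * u))) := by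
    intro s
    simp only [star_mul, quatMatrix_mul, tpow_mul, Matrix.mul_assoc]
  simp only [e, traceKron_apply, trace_kron_conj, Finset.prod_mul_distrib] at key
  rw [← Complex.ofReal_sum, ← Complex.ofReal_sum, Complex.ofReal_inj, ← Finset.mul_sum,
    ← Finset.mul_sum] at key
  exact mul_left_cancel₀ (by simp) key

lemma InvariantsSpread.sum_prod_sum_re {S : Set ℍ[ℝ]} (hinv : InvariantsSpread S)
    (hS : IsUnitQuatGroup S) {F : Finset ℍ[ℝ]} (hF : ∀ s, s ∈ F ↔ s ∈ S)
    {n : ℕ} (a b : Fin 6 → Fin n → ℍ[ℝ]) {u : ℍ[ℝ]} (hu : u * star u = 1) :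
    ∑ s ∈ F, ∏ m, ∑ e, (a m e * ((s * u) * b m e * star (s * u))).re =
      ∑ s ∈ F, ∏ m, ∑ e, (a m e * (s * b m e * star s)).re := by
  simp only [Finset.prod_univ_sum]
  rw [Finset.sum_comm, Finset.sum_comm (s := F)]
  refine Finset.sum_congr rfl fun x _ => ?_
  exact hinv.sum_prod_re hS hF (fun m => a m (x m)) (fun m => b m (x m)) hu

/-- The standard basis of the quaternions. -/
noncomputable def quatBasis : Fin 4 → ℍ[ℝ] :=
  ![⟨1, 0, 0, 0⟩, ⟨0, 1, 0, 0⟩, ⟨0, 0, 1, 0⟩, ⟨0, 0, 0, 1⟩]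

@[simp] lemma quatBasis_zero : (quatBasis 0).re = 1 ∧ (quatBasis 0).imI = 0 ∧
    (quatBasis 0).imJ = 0 ∧ (quatBasis 0).imK = 0 := by
  simp [quatBasis]

@[simp] lemma quatBasis_one : (quatBasis 1).re = 0 ∧ (quatBasis 1).imI = 1 ∧
    (quatBasis 1).imJ = 0 ∧ (quatBasis 1).imK = 0 := by
  simp [quatBasis]

@[simp] lemma quatBasis_two : (quatBasis 2).re = 0 ∧ (quatBasis 2).imI = 0 ∧
    (quatBasis 2).imJ = 1 ∧ (quatBasis 2).imK = 0 := by
  simp [quatBasis]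

@[simp] lemma quatBasis_three : (quatBasis 3).re = 0 ∧ (quatBasis 3).imI = 0 ∧
    (quatBasis 3).imJ = 0 ∧ (quatBasis 3).imK = 1 := by
  simp [quatBasis]

lemma sum_quatBasis (κ s : ℍ[ℝ]) :
    ∑ e, (star (quatBasis e) * (s * (quatBasis e * κ) * star s)).re =
      4 * (s.re * (κ * star s).re) := by
  simp [Fin.sum_univ_four]
  ring

lemma re_sq_add_of_unit {s : ℍ[ℝ]} (hs : s * star s = 1) :
    s.re ^ 2 + s.imI ^ 2 + s.imJ ^ 2 + s.imK ^ 2 = 1 := by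
  have := congrArg (fun q : ℍ[ℝ] => q.re) hs
  simp at this
  linarith

lemma unit_of_re_sq_add {s : ℍ[ℝ]} (hs : s.re ^ 2 + s.imI ^ 2 + s.imJ ^ 2 + s.imK ^ 2 = 1) :
    s * star s = 1 := by
  ext <;> simp <;> linarith

/-- The quaternion `exp (t κ)` when `κ² = -1`. -/
noncomputable def quatExp (κ : ℍ[ℝ]) (t : ℝ) : ℍ[ℝ] := (Real.cos t : ℍ[ℝ]) + (Real.sin t : ℍ[ℝ]) * κ

lemma quatExp_unit {κ : ℍ[ℝ]} (h0 : κ.re = 0) (h1 : κ.imI ^ 2 + κ.imJ ^ 2 + κ.imK ^ 2 = 1) (t : ℝ) :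
    quatExp κ t * star (quatExp κ t) = 1 := by
  apply unit_of_re_sq_add
  simp [quatExp, h0]
  linear_combination Real.sin t ^ 2 * h1 + Real.sin_sq_add_cos_sq t

lemma prod_fin_six_ite (A B : ℝ) {j : ℕ} (hj : j ≤ 5) :
    (∏ m : Fin 6, if (m : ℕ) < j then A else if (m : ℕ) = j then B else 1) = A ^ j * B := by
  interval_cases j <;> simp only [Fin.prod_univ_six] <;> norm_num <;>
    first | ring1 | exact Or.inl (by ring1)

section FiniteGroup

variable {S : Set ℍ[ℝ]} {F : Finset ℍ[ℝ]}

lemma sum_re_pow_mul (hinv : InvariantsSpread S) (hS : IsUnitQuatGroup S)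
    (hF : ∀ s, s ∈ F ↔ s ∈ S)
    {κ u : ℍ[ℝ]} (hu : u * star u = 1) {j : ℕ} (hj : j ≤ 5) :
    ∑ s ∈ F, (s * u).re ^ (2 * j + 1) * (κ * star (s * u)).re =
      ∑ s ∈ F, s.re ^ (2 * j + 1) * (κ * star s).re := by
  have key := hinv.sum_prod_sum_re hS hF
    (fun m e => if (m : ℕ) < j then star (quatBasis e) else if (m : ℕ) = j then
      star (quatBasis e) else ((1 / 4 : ℝ) : ℍ[ℝ]))
    (fun m e => if (m : ℕ) < j then quatBasis e * 1 else if (m : ℕ) = j then quatBasis e * κ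
      else 1) hu
  have e : ∀ s : ℍ[ℝ], s * star s = 1 →
      (∏ m : Fin 6, ∑ e, ((if (m : ℕ) < j then star (quatBasis e) else if (m : ℕ) = j then
        star (quatBasis e) else ((1 / 4 : ℝ) : ℍ[ℝ])) *
        (s * (if (m : ℕ) < j then quatBasis e * 1 else if (m : ℕ) = j then quatBasis e * κ
          else 1) * star s)).re) = 4 ^ (j + 1) * (s.re ^ (2 * j + 1) * (κ * star s).re) := by
    intro s hs
    have h3 := sum_quatBasis 1 s
    rw [one_mul, Quaternion.re_star] at h3
    trans ∏ m : Fin 6, if (m : ℕ) < j then 4 * (s.re * s.re) else if (m : ℕ) = j then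
      4 * (s.re * (κ * star s).re) else 1
    · refine Finset.prod_congr rfl fun m _ => ?_
      rcases lt_trichotomy (m : ℕ) j with h | h | h
      · simpa only [if_pos h] using h3
      · simpa only [if_neg h.not_lt, if_pos h] using sum_quatBasis κ s
      · simp only [if_neg h.not_gt, if_neg h.ne', mul_one, hs, Quaternion.re_coe]
        norm_num
    · rw [prod_fin_six_ite _ _ hj]
      ring
  have hu' : ∀ s ∈ F, (s * u) * star (s * u) = 1 := by
    intro s hs
    rw [star_mul, mul_assoc, ← mul_assoc u, hu, one_mul, hS.mul_star ((hF s).1 hs)]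
  rw [Finset.sum_congr rfl fun s hs => e _ (hu' s hs),
    Finset.sum_congr rfl fun s hs => e s (hS.mul_star ((hF s).1 hs)), ← Finset.mul_sum,
    ← Finset.mul_sum] at key
  exact mul_left_cancel₀ (by positivity) key

lemma eq_zero_of_hasDerivAt_of_const {G : ℝ → ℝ} {c d : ℝ} (h : ∀ t, G t = c)
    (hd : HasDerivAt G d 0) : d = 0 := by
  have : G = fun _ => c := funext h
  rw [this] at hd
  exact hd.unique (hasDerivAt_const _ _)

lemma sum_re_pow_deriv (hinv : InvariantsSpread S) (hS : IsUnitQuatGroup S)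
    (hF : ∀ s, s ∈ F ↔ s ∈ S)
    {κ : ℍ[ℝ]} (h0 : κ.re = 0) (h1 : κ.imI ^ 2 + κ.imJ ^ 2 + κ.imK ^ 2 = 1)
    {j : ℕ} (hj : j ≤ 5) :
    ∑ s ∈ F, (s.re ^ (2 * j + 2) - (2 * j + 1) * s.re ^ (2 * j) * (κ * star s).re ^ 2) = 0 := by
  refine eq_zero_of_hasDerivAt_of_const
    (fun t => sum_re_pow_mul hinv hS hF (κ := κ) (quatExp_unit h0 h1 t) hj) ?_
  refine HasDerivAt.fun_sum fun s _ => ?_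
  have e1 : ∀ t, (s * quatExp κ t).re = Real.cos t * s.re - Real.sin t * (κ * star s).re := by
    intro t
    simp [quatExp, h0]
    ring
  have e2 : ∀ t, (κ * star (s * quatExp κ t)).re =
      Real.cos t * (κ * star s).re + Real.sin t * s.re := by
    intro t
    simp [quatExp, h0]
    linear_combination s.re * Real.sin t * h1
  simp only [e1, e2]
  have hc := Real.hasDerivAt_cos 0
  have hs := Real.hasDerivAt_sin 0
  have := (((hc.mul_const s.re).sub (hs.mul_const (κ * star s).re)).pow (2 * j + 1)).mul
    ((hc.mul_const (κ * star s).re).add (hs.mul_const s.re))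
  refine this.congr_deriv ?_
  simp
  ring

lemma sum_re_pow_succ (hinv : InvariantsSpread S) (hS : IsUnitQuatGroup S)
    (hF : ∀ s, s ∈ F ↔ s ∈ S)
    {j : ℕ} (hj : j ≤ 5) :
    (2 * j + 4) * ∑ s ∈ F, s.re ^ (2 * j + 2) = (2 * j + 1) * ∑ s ∈ F, s.re ^ (2 * j) := by
  have hI := sum_re_pow_deriv hinv hS hF (κ := quatBasis 1) (by simp) (by simp) hj
  have hJ := sum_re_pow_deriv hinv hS hF (κ := quatBasis 2) (by simp) (by simp) hj
  have hK := sum_re_pow_deriv hinv hS hF (κ := quatBasis 3) (by simp) (by simp) hj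
  rw [← sub_eq_zero, Finset.mul_sum, Finset.mul_sum, ← Finset.sum_sub_distrib]
  have hsum := congrArg₂ (· + ·) (congrArg₂ (· + ·) hI hJ) hK
  rw [← Finset.sum_add_distrib, ← Finset.sum_add_distrib, add_zero, add_zero] at hsum
  refine Eq.trans ?_ hsum
  refine Finset.sum_congr rfl fun s hs => ?_
  have hu := re_sq_add_of_unit (hS.mul_star ((hF s).1 hs))
  have eI : (quatBasis 1 * star s).re = s.imI := by simp
  have eJ : (quatBasis 2 * star s).re = s.imJ := by simp
  have eK : (quatBasis 3 * star s).re = s.imK := by simp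
  rw [eI, eJ, eK]
  linear_combination (2 * (j : ℝ) + 1) * s.re ^ (2 * j) * hu

lemma exists_re_sq_gt (hinv : InvariantsSpread S) (hS : IsUnitQuatGroup S)
    (hF : ∀ s, s ∈ F ↔ s ∈ S) : ∃ s ∈ F, s.re ^ 2 < 1 ∧ 7 / 10 < s.re ^ 2 := by
  have h0 := sum_re_pow_succ hinv hS hF (j := 0) (by norm_num)
  have h1 := sum_re_pow_succ hinv hS hF (j := 1) (by norm_num)
  have h2 := sum_re_pow_succ hinv hS hF (j := 2) (by norm_num)
  have h3 := sum_re_pow_succ hinv hS hF (j := 3) (by norm_num)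
  have h4 := sum_re_pow_succ hinv hS hF (j := 4) (by norm_num)
  have h5 := sum_re_pow_succ hinv hS hF (j := 5) (by norm_num)
  have hN : (0 : ℝ) < ∑ s ∈ F, s.re ^ (2 * 0) := by
    have : 0 < F.card := Finset.card_pos.2 ⟨1, (hF 1).2 hS.one_mem⟩
    simpa using this
  have hlt : ∑ s ∈ F, (7 / 10 - s.re ^ 2) * (1 - s.re ^ 2) *
      ((s.re ^ 2) ^ 2 - 5 / 14 * s.re ^ 2 + 1 / 80) ^ 2 < 0 := by
    have e : ∀ s : ℍ[ℝ], (7 / 10 - s.re ^ 2) * (1 - s.re ^ 2) *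
      ((s.re ^ 2) ^ 2 - 5 / 14 * s.re ^ 2 + 1 / 80) ^ 2 =
      7 / 64000 * s.re ^ (2 * 0) + (-(7 / 10) * (5 / 560) - 17 / 64000) * s.re ^ (2 * 0 + 2) +
      (7 / 10 * (25 / 196 + 1 / 40) + 17 / 10 * (5 / 560) + 1 / 6400) * s.re ^ (2 * 1 + 2) +
      (-(7 / 10) * (5 / 7) - 17 / 10 * (25 / 196 + 1 / 40) - 5 / 560) * s.re ^ (2 * 2 + 2) +
      (7 / 10 + 17 / 10 * (5 / 7) + (25 / 196 + 1 / 40)) * s.re ^ (2 * 3 + 2) +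
      (-(17 / 10) - 5 / 7) * s.re ^ (2 * 4 + 2) + s.re ^ (2 * 5 + 2) := by
      intro s
      ring
    simp only [e, Finset.sum_add_distrib, ← Finset.mul_sum]
    norm_num at h0 h1 h2 h3 h4 h5 ⊢
    have hN' : (0 : ℝ) < F.card := by simpa using hN
    linarith
  obtain ⟨s, hs, hneg⟩ := Finset.exists_lt_of_sum_lt (g := fun _ => (0 : ℝ))
    (by simpa using hlt)
  have hu := re_sq_add_of_unit (hS.mul_star ((hF s).1 hs))
  have hle : s.re ^ 2 ≤ 1 := by nlinarith [sq_nonneg s.imI, sq_nonneg s.imJ, sq_nonneg s.imK]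
  refine ⟨s, hs, ?_, ?_⟩
  · refine lt_of_le_of_ne hle fun h => ?_
    rw [h] at hneg
    norm_num at hneg
  · by_contra! h
    exact absurd hneg (not_lt.2 (mul_nonneg (mul_nonneg (by linarith) (by linarith))
      (sq_nonneg _)))

end FiniteGroup

lemma re_quatExp_conj {κ : ℍ[ℝ]} (h0 : κ.re = 0)
    (n g b : ℍ[ℝ]) (t : ℝ) :
    (n * ((g * quatExp κ t) * b * star (g * quatExp κ t))).re =
      Real.cos t ^ 2 * (n * (g * b * star g)).re +
      Real.cos t * Real.sin t * (n * (g * (κ * b - b * κ) * star g)).re -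
      Real.sin t ^ 2 * (n * (g * (κ * b * κ) * star g)).re := by
  have hstar : star κ = -κ := by ext <;> simp [h0]
  have : (g * quatExp κ t) * b * star (g * quatExp κ t) =
      (Real.cos t ^ 2) • (g * b * star g) +
      (Real.cos t * Real.sin t) • (g * (κ * b - b * κ) * star g) -
      (Real.sin t ^ 2) • (g * (κ * b * κ) * star g) := by
    have e : quatExp κ t = Real.cos t • (1 : ℍ[ℝ]) + Real.sin t • κ := by
      ext <;> simp [quatExp]
    rw [e]
    simp only [star_mul, star_add, Quaternion.star_smul, star_one, hstar]
    simp only [mul_add, add_mul, mul_sub, sub_mul, smul_mul_assoc, mul_smul_comm, mul_one, one_mul,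
      smul_neg, mul_neg, neg_mul, mul_assoc, smul_sub, pow_two]
    module
  rw [this]
  simp only [mul_sub, mul_add, mul_smul_comm, Quaternion.re_sub, Quaternion.re_add,
    Quaternion.re_smul, smul_eq_mul]

lemma re_mul_conj (n g b : ℍ[ℝ]) :
    (n * (g * b * star g)).re = ((star g * n * g) * b).re := by
  simp
  ring

section FiniteGroup

variable {S : Set ℍ[ℝ]} {F : Finset ℍ[ℝ]}

lemma sum_re_conj_pow_mul (hinv : InvariantsSpread S) (hS : IsUnitQuatGroup S)
    (hF : ∀ s, s ∈ F ↔ s ∈ S)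
    {u : ℍ[ℝ]} (hu : u * star u = 1) (n b : ℍ[ℝ]) {j : ℕ} (hj : j ≤ 5) :
    ∑ g ∈ F, (n * ((g * u) * n * star (g * u))).re ^ j * (n * ((g * u) * b * star (g * u))).re =
      ∑ g ∈ F, (n * (g * n * star g)).re ^ j * (n * (g * b * star g)).re := by
  have key := hinv.sum_prod_re hS hF
    (fun m => if (m : ℕ) < j then n else if (m : ℕ) = j then n else 1)
    (fun m => if (m : ℕ) < j then n else if (m : ℕ) = j then b else 1) hu
  have e : ∀ s : ℍ[ℝ], s * star s = 1 →
      (∏ m : Fin 6, ((if (m : ℕ) < j then n else if (m : ℕ) = j then n else 1) *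
        (s * (if (m : ℕ) < j then n else if (m : ℕ) = j then b else 1) * star s)).re) =
      (n * (s * n * star s)).re ^ j * (n * (s * b * star s)).re := by
    intro s hs
    rw [← prod_fin_six_ite _ _ hj]
    refine Finset.prod_congr rfl fun m _ => ?_
    split_ifs
    · rfl
    · rfl
    · rw [mul_one, hs]
      simp
  have hu' : ∀ s ∈ F, (s * u) * star (s * u) = 1 := by
    intro s hs
    rw [star_mul, mul_assoc, ← mul_assoc u, hu, one_mul, hS.mul_star ((hF s).1 hs)]
  rwa [Finset.sum_congr rfl fun s hs => e _ (hu' s hs),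
    Finset.sum_congr rfl fun s hs => e s (hS.mul_star ((hF s).1 hs))] at key

lemma sum_re_conj_deriv (hinv : InvariantsSpread S) (hS : IsUnitQuatGroup S)
    (hF : ∀ s, s ∈ F ↔ s ∈ S)
    {κ : ℍ[ℝ]} (h0 : κ.re = 0)
    (h1 : κ.imI ^ 2 + κ.imJ ^ 2 + κ.imK ^ 2 = 1) (n : ℍ[ℝ]) {j : ℕ} (hj : j ≤ 5) :
    ∑ g ∈ F, (j * (n * (g * n * star g)).re ^ (j - 1) *
      (n * (g * (κ * n - n * κ) * star g)).re ^ 2 + (n * (g * n * star g)).re ^ j *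
      (n * (g * (κ * (κ * n - n * κ) - (κ * n - n * κ) * κ) * star g)).re) = 0 := by
  refine eq_zero_of_hasDerivAt_of_const
    (fun t => sum_re_conj_pow_mul hinv hS hF (quatExp_unit h0 h1 t) n (κ * n - n * κ) hj) ?_
  refine HasDerivAt.fun_sum fun s _ => ?_
  simp only [re_quatExp_conj h0]
  have hc := Real.hasDerivAt_cos 0
  have hs := Real.hasDerivAt_sin 0
  have hgen : ∀ A B C : ℝ, HasDerivAt (fun t => Real.cos t ^ 2 * A + Real.cos t * Real.sin t * B -
      Real.sin t ^ 2 * C) B 0 := by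
    intro A B C
    have := (((hc.fun_pow 2).mul_const A).fun_add ((hc.fun_mul hs).mul_const B)).fun_sub
      ((hs.fun_pow 2).mul_const C)
    refine this.congr_deriv ?_
    simp
  refine (((hgen _ _ _).fun_pow j).fun_mul (hgen _ _ _)).congr_deriv ?_
  simp
  ring

lemma commutator_quatBasis {v n : ℍ[ℝ]} (hv : v.re = 0) (hn : n.re = 0) :
    (v * (quatBasis 1 * n - n * quatBasis 1)).re ^ 2 +
      (v * (quatBasis 2 * n - n * quatBasis 2)).re ^ 2 +
      (v * (quatBasis 3 * n - n * quatBasis 3)).re ^ 2 =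
      4 * ((v.imI ^ 2 + v.imJ ^ 2 + v.imK ^ 2) * (n.imI ^ 2 + n.imJ ^ 2 + n.imK ^ 2) -
        (v * n).re ^ 2) := by
  simp [hn, hv]
  ring

lemma commutator_commutator_quatBasis {v n : ℍ[ℝ]} (hv : v.re = 0) (hn : n.re = 0) :
    (v * (quatBasis 1 * (quatBasis 1 * n - n * quatBasis 1) -
        (quatBasis 1 * n - n * quatBasis 1) * quatBasis 1)).re +
      (v * (quatBasis 2 * (quatBasis 2 * n - n * quatBasis 2) -
        (quatBasis 2 * n - n * quatBasis 2) * quatBasis 2)).re +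
      (v * (quatBasis 3 * (quatBasis 3 * n - n * quatBasis 3) -
        (quatBasis 3 * n - n * quatBasis 3) * quatBasis 3)).re = -8 * (v * n).re := by
  simp [hn, hv]
  ring

lemma sum_re_conj_pow_succ (hinv : InvariantsSpread S) (hS : IsUnitQuatGroup S)
    (hF : ∀ s, s ∈ F ↔ s ∈ S)
    {n : ℍ[ℝ]} (hn : n.re = 0) {j : ℕ} (hj : j ≤ 5) :
    ∑ g ∈ F, (j * (n * (g * n * star g)).re ^ (j - 1) * (4 * ((n.imI ^ 2 + n.imJ ^ 2 + n.imK ^ 2) ^ 2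
      - (n * (g * n * star g)).re ^ 2)) - 8 * (n * (g * n * star g)).re ^ (j + 1)) = 0 := by
  have hI := sum_re_conj_deriv hinv hS hF (κ := quatBasis 1) (by simp) (by simp) n hj
  have hJ := sum_re_conj_deriv hinv hS hF (κ := quatBasis 2) (by simp) (by simp) n hj
  have hK := sum_re_conj_deriv hinv hS hF (κ := quatBasis 3) (by simp) (by simp) n hj
  have hsum := congrArg₂ (· + ·) (congrArg₂ (· + ·) hI hJ) hK
  rw [← Finset.sum_add_distrib, ← Finset.sum_add_distrib, add_zero, add_zero] at hsum
  refine Eq.trans ?_ hsum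
  refine Finset.sum_congr rfl fun g hg => ?_
  have hu := re_sq_add_of_unit (hS.mul_star ((hF g).1 hg))
  simp only [re_mul_conj]
  have hv0 : (star g * n * g).re = 0 := by
    simp [hn]
    ring
  have hv : (star g * n * g).imI ^ 2 + (star g * n * g).imJ ^ 2 + (star g * n * g).imK ^ 2 =
      n.imI ^ 2 + n.imJ ^ 2 + n.imK ^ 2 := by
    have : (star g * n * g).imI ^ 2 + (star g * n * g).imJ ^ 2 + (star g * n * g).imK ^ 2 =
      (g.re ^ 2 + g.imI ^ 2 + g.imJ ^ 2 + g.imK ^ 2) ^ 2 *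
      (n.imI ^ 2 + n.imJ ^ 2 + n.imK ^ 2) := by
      simp [hn]
      ring
    rw [this, hu]
    ring
  generalize star g * n * g = v at hv0 hv
  have h2 := commutator_quatBasis hv0 hn
  have h3 := commutator_commutator_quatBasis hv0 hn
  rw [hv] at h2
  linear_combination (-(j * (v * n).re ^ (j - 1))) * h2 - (v * n).re ^ j * h3

lemma exists_re_conj_sq (hinv : InvariantsSpread S) (hS : IsUnitQuatGroup S)
    (hF : ∀ s, s ∈ F ↔ s ∈ S)
    {n : ℍ[ℝ]} (hn : n.re = 0)
    (hpos : 0 < n.imI ^ 2 + n.imJ ^ 2 + n.imK ^ 2) :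
    ∃ g ∈ F, (n * (g * n * star g)).re ^ 2 < (n.imI ^ 2 + n.imJ ^ 2 + n.imK ^ 2) ^ 2 ∧
      3 / 20 * (n.imI ^ 2 + n.imJ ^ 2 + n.imK ^ 2) ^ 2 < (n * (g * n * star g)).re ^ 2 := by
  have h1 := sum_re_conj_pow_succ hinv hS hF hn (j := 1) (by norm_num)
  have h3 := sum_re_conj_pow_succ hinv hS hF hn (j := 3) (by norm_num)
  generalize n.imI ^ 2 + n.imJ ^ 2 + n.imK ^ 2 = σ at *
  obtain ⟨P, hP⟩ : ∃ P : ℍ[ℝ] → ℝ, ∀ g, P g = (n * (g * n * star g)).re := ⟨_, fun _ => rfl⟩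
  simp only [← hP] at h1 h3 ⊢
  have hN : (0 : ℝ) < F.card := by
    exact_mod_cast Finset.card_pos.2 ⟨1, (hF 1).2 hS.one_mem⟩
  have m1 : 3 * ∑ g ∈ F, P g ^ 2 = σ ^ 2 * F.card := by
    have : ∀ g, ((1 : ℕ) : ℝ) * P g ^ (1 - 1) * (4 * (σ ^ 2 - P g ^ 2)) - 8 * P g ^ (1 + 1) =
      4 * σ ^ 2 - 12 * P g ^ 2 := by
      intro g
      norm_num
      ring
    simp only [this, Finset.sum_sub_distrib, ← Finset.mul_sum, Finset.sum_const, nsmul_eq_mul] at h1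
    linarith
  have m3 : 5 * ∑ g ∈ F, P g ^ 4 = 3 * (σ ^ 2 * ∑ g ∈ F, P g ^ 2) := by
    have : ∀ g, ((3 : ℕ) : ℝ) * P g ^ (3 - 1) * (4 * (σ ^ 2 - P g ^ 2)) - 8 * P g ^ (3 + 1) =
      12 * (σ ^ 2 * P g ^ 2) - 20 * P g ^ 4 := by
      intro g
      norm_num
      ring
    simp only [this, Finset.sum_sub_distrib, ← Finset.mul_sum] at h3
    linarith
  have hlt : 0 < ∑ g ∈ F, (σ ^ 2 - P g ^ 2) * (P g ^ 2 - 3 / 20 * σ ^ 2) := by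
    have : ∀ g, (σ ^ 2 - P g ^ 2) * (P g ^ 2 - 3 / 20 * σ ^ 2) =
      23 / 20 * (σ ^ 2 * P g ^ 2) - P g ^ 4 - 3 / 20 * σ ^ 4 := by
      intro g
      ring
    simp only [this, Finset.sum_sub_distrib, ← Finset.mul_sum, Finset.sum_const, nsmul_eq_mul]
    have hσ : 0 < σ ^ 4 * F.card := by positivity
    have : σ ^ 2 * ∑ g ∈ F, P g ^ 2 = σ ^ 4 * F.card / 3 := by
      linear_combination σ ^ 2 * m1 / 3
    linarith
  obtain ⟨g, hg, hpos'⟩ := Finset.exists_lt_of_sum_lt (f := fun _ => (0 : ℝ))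
    (by simpa using hlt)
  have hσ : 0 < σ ^ 2 := by positivity
  refine ⟨g, hg, ?_, ?_⟩ <;> by_contra! h <;> nlinarith

lemma re_commutator {h h' : ℍ[ℝ]} (hh : h * star h = 1) (hh' : h' * star h' = 1)
    (hre : h'.re = h.re) :
    (h * h' * star h * star h').re =
      1 - 2 * ((h.imI ^ 2 + h.imJ ^ 2 + h.imK ^ 2) ^ 2 -
        (h.imI * h'.imI + h.imJ * h'.imJ + h.imK * h'.imK) ^ 2) := by
  have h1 := re_sq_add_of_unit hh
  have h2 := re_sq_add_of_unit hh'
  have e : (h * h' * star h * star h').re =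
      (h.re ^ 2 + h.imI ^ 2 + h.imJ ^ 2 + h.imK ^ 2) *
      (h'.re ^ 2 + h'.imI ^ 2 + h'.imJ ^ 2 + h'.imK ^ 2) -
      2 * ((h.imI ^ 2 + h.imJ ^ 2 + h.imK ^ 2) * (h'.imI ^ 2 + h'.imJ ^ 2 + h'.imK ^ 2) -
        (h.imI * h'.imI + h.imJ * h'.imJ + h.imK * h'.imK) ^ 2) := by
    simp
    ring
  have h3 : h'.imI ^ 2 + h'.imJ ^ 2 + h'.imK ^ 2 = h.imI ^ 2 + h.imJ ^ 2 + h.imK ^ 2 := by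
    rw [hre] at h2
    linarith
  rw [e, h1, h2, h3]
  ring

/-- Closeness to the identity contradicts minimality via commutators of conjugates. -/
lemma false_of_finite (hinv : InvariantsSpread S) (hS : IsUnitQuatGroup S)
    (hF : ∀ s, s ∈ F ↔ s ∈ S) : False := by
  obtain ⟨s₀, hs₀, hlt₀, hgt₀⟩ := exists_re_sq_gt hinv hS hF
  obtain ⟨h, hh, hmax⟩ := (F.filter fun s => s.re ^ 2 < 1).exists_max_image (fun s => s.re ^ 2)
    ⟨s₀, Finset.mem_filter.2 ⟨hs₀, hlt₀⟩⟩
  rw [Finset.mem_filter] at hh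
  obtain ⟨hhF, hlt⟩ := hh
  have hgt : 7 / 10 < h.re ^ 2 := hgt₀.trans_le (hmax _ (Finset.mem_filter.2 ⟨hs₀, hlt₀⟩))
  have hhS := (hF h).1 hhF
  have hu := re_sq_add_of_unit (hS.mul_star hhS)
  obtain ⟨g, hg, hP1, hP2⟩ := exists_re_conj_sq hinv hS hF (n := h.im) (by simp)
    (by simp; linarith)
  have hgS := (hF g).1 hg
  have hgu := re_sq_add_of_unit (hS.mul_star hgS)
  have hconj : g * h * star g ∈ S := hS.mul_mem (hS.mul_mem hgS hhS) (hS.star_mem hgS)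
  have hkS : h * (g * h * star g) * star h * star (g * h * star g) ∈ S :=
    hS.mul_mem (hS.mul_mem (hS.mul_mem hhS hconj) (hS.star_mem hhS)) (hS.star_mem hconj)
  have hre : (g * h * star g).re = h.re := by
    have : (g * h * star g).re = (g.re ^ 2 + g.imI ^ 2 + g.imJ ^ 2 + g.imK ^ 2) * h.re := by
      simp
      ring
    rw [this, hgu, one_mul]
  have hk := re_commutator (hS.mul_star hhS) (hS.mul_star hconj) hre
  have hdot : (h.im * (g * h.im * star g)).re = -(h.imI * (g * h * star g).imI +
      h.imJ * (g * h * star g).imJ + h.imK * (g * h * star g).imK) := by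
    simp
    ring
  rw [hdot, neg_sq] at hP1 hP2
  simp only [Quaternion.imI_im, Quaternion.imJ_im, Quaternion.imK_im] at hP1 hP2
  generalize hp : (h.imI * (g * h * star g).imI +
      h.imJ * (g * h * star g).imJ + h.imK * (g * h * star g).imK) ^ 2 = p at *
  have hσ : h.imI ^ 2 + h.imJ ^ 2 + h.imK ^ 2 = 1 - h.re ^ 2 := by linarith
  rw [hσ] at hk hP1 hP2
  generalize h.re ^ 2 = r at *
  generalize h * (g * h * star g) * star h * star (g * h * star g) = k at *
  have hσ3 : (1 - r) < 3 / 10 := by linarith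
  have hσ0 : 0 < 1 - r := by linarith
  have hσ2 : (1 - r) ^ 2 < 9 / 100 := by nlinarith
  have hk1 : k.re < 1 := by rw [hk]; linarith
  have hk2 : 1 - 17 / 10 * (1 - r) ^ 2 < k.re := by rw [hk]; linarith
  have hk3 : k.re ^ 2 < 1 := by nlinarith
  have hk4 := hmax k (Finset.mem_filter.2 ⟨(hF k).2 hkS, hk3⟩)
  have hk5 : (1 - 17 / 10 * (1 - r) ^ 2) ^ 2 < k.re ^ 2 := by
    apply pow_lt_pow_left₀ hk2 (by linarith) (by norm_num)
  have hk6 : 1 - (1 - r) < (1 - 17 / 10 * (1 - r) ^ 2) ^ 2 := by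
    generalize 1 - r = x at *
    have hx : 0 ≤ (x - 3 / 10) ^ 2 * (x + 3 / 5) := by positivity
    have hx' : 0 < 1 - 17 / 5 * x + 289 / 100 * x ^ 3 := by linarith
    linarith [mul_pos hσ0 hx']
  linarith

end FiniteGroup

section InfiniteGroup

open Filter Topology

variable {S : Set ℍ[ℝ]}

lemma norm_eq_one_of_unit {s : ℍ[ℝ]} (hs : s * star s = 1) : ‖s‖ = 1 := by
  have h := Quaternion.normSq_eq_norm_mul_self s
  rw [Quaternion.normSq_def, hs, Quaternion.re_one] at h
  nlinarith [norm_nonneg s]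

lemma exists_seq_tendsto_one (hS : IsUnitQuatGroup S) (hinf : S.Infinite) :
    ∃ s : ℕ → ℍ[ℝ], (∀ j, s j ∈ S) ∧ (∀ j, s j ≠ 1) ∧ Tendsto s atTop (𝓝 1) := by
  have : ProperSpace ℍ[ℝ] := FiniteDimensional.proper ℝ ℍ[ℝ]
  obtain ⟨a, -, φ, hφ, ha⟩ := (isCompact_sphere (0 : ℍ[ℝ]) 1).tendsto_subseq
    (x := fun j => (hinf.natEmbedding S j : ℍ[ℝ])) fun j => by
      simpa using norm_eq_one_of_unit (hS.mul_star (hinf.natEmbedding S j).2)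
  have hmem : ∀ j, ((hinf.natEmbedding S j : S) : ℍ[ℝ]) ∈ S := fun j => Subtype.coe_prop _
  have hone : a * star a = 1 := tendsto_nhds_unique (ha.mul ha.star)
    (tendsto_const_nhds.congr fun j => (hS.mul_star (hmem (φ j))).symm)
  refine ⟨fun j => (hinf.natEmbedding S (φ (j + 1)) : ℍ[ℝ]) *
    star (hinf.natEmbedding S (φ j) : ℍ[ℝ]), fun j => hS.mul_mem (hmem _) (hS.star_mem (hmem _)),
    fun j h => ?_, ?_⟩
  · have h2 := congrArg (· * (hinf.natEmbedding S (φ j) : ℍ[ℝ])) h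
    simp only [mul_assoc, hS.star_mul (hmem _), mul_one, one_mul] at h2
    have := hφ.injective ((hinf.natEmbedding S).injective (Subtype.ext h2))
    omega
  · rw [← hone]
    exact (ha.comp (tendsto_add_atTop_nat 1)).mul ha.star

/-- An infinite group of unit quaternions has a tangent direction at the identity. -/
lemma exists_tangent (hS : IsUnitQuatGroup S) (hinf : S.Infinite) :
    ∃ n : ℍ[ℝ], n.re = 0 ∧ n.imI ^ 2 + n.imJ ^ 2 + n.imK ^ 2 = 1 ∧
      ∃ (d : ℕ → ℝ) (x : ℕ → ℍ[ℝ]), (∀ j, 0 < d j) ∧ Tendsto d atTop (𝓝 0) ∧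
        Tendsto x atTop (𝓝 n) ∧ ∀ j, 1 + d j • x j ∈ S := by
  have : ProperSpace ℍ[ℝ] := FiniteDimensional.proper ℝ ℍ[ℝ]
  obtain ⟨s, hsS, hs1, hs⟩ := exists_seq_tendsto_one hS hinf
  have hd : ∀ j, 0 < ‖s j - 1‖ := fun j => norm_pos_iff.2 (sub_ne_zero.2 (hs1 j))
  have hd0 : Tendsto (fun j => ‖s j - 1‖) atTop (𝓝 0) := tendsto_iff_norm_sub_tendsto_zero.1 hs
  have hre : ∀ j, (s j).re = 1 - ‖s j - 1‖ ^ 2 / 2 := by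
    intro j
    have h1 := re_sq_add_of_unit (hS.mul_star (hsS j))
    have h2 := Quaternion.normSq_eq_norm_mul_self (s j - 1)
    rw [Quaternion.normSq_def'] at h2
    simp at h2
    linarith
  obtain ⟨n, hn, φ, hφ, hlim⟩ := (isCompact_sphere (0 : ℍ[ℝ]) 1).tendsto_subseq
    (x := fun j => ‖s j - 1‖⁻¹ • (s j - 1)) fun j => by
      rw [mem_sphere_zero_iff_norm, norm_smul, norm_inv, norm_norm, inv_mul_cancel₀ (hd j).ne']
  have hd0' := hd0.comp hφ.tendsto_atTop
  have hn0 : n.re = 0 := by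
    refine tendsto_nhds_unique ((Quaternion.continuous_re.tendsto n).comp hlim) ?_
    have : Tendsto (fun j => -‖s (φ j) - 1‖ / 2) atTop (𝓝 (-0 / 2)) := hd0'.neg.div_const 2
    rw [neg_zero, zero_div] at this
    refine this.congr fun j => ?_
    simp only [Function.comp, Quaternion.re_smul, Quaternion.re_sub, Quaternion.re_one, hre,
      smul_eq_mul]
    field_simp [(hd (φ j)).ne']
    ring
  refine ⟨n, hn0, ?_, fun j => ‖s (φ j) - 1‖, _, fun j => hd _, hd0', hlim, fun j => ?_⟩
  · have h2 := Quaternion.normSq_eq_norm_mul_self n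
    rw [Quaternion.normSq_def', mem_sphere_zero_iff_norm.1 hn, hn0] at h2
    linarith
  · simp only [Function.comp]
    rw [smul_inv_smul₀ (hd (φ j)).ne', add_sub_cancel]
    exact hsS _

lemma re_mul_unit_conj_sq {S : Set ℍ[ℝ]} (hinv : InvariantsSpread S) {n : ℍ[ℝ]}
    (h : ∀ g ∈ S, star g * n * g = n ∨ star g * n * g = -n)
    (hS : IsUnitQuatGroup S) {u : ℍ[ℝ]} (hu : u * star u = 1) :
    (n * (u * n * star u)).re ^ 2 = (n * n).re ^ 2 := by
  have hf : ∀ s ∈ S, ∀ X, traceKron ![n, n, 1, 1, 1, 1]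
      (tpow 6 (quatMatrix s) * X * tpow 6 (quatMatrix (star s))) =
      traceKron ![n, n, 1, 1, 1, 1] X := by
    intro s hs X
    rw [traceKron_conj, traceKron_apply, traceKron_apply]
    congr 2
    ext I J
    rcases h s hs with h' | h' <;>
      simp [kron, Fin.prod_univ_six, h', hS.star_mul hs, quatMatrix_neg]
  have key := hinv _ hf
  have h1 := (key u hu (kron fun m => quatMatrix (![n, n, 1, 1, 1, 1] m))).trans
    (key 1 (by simp) (kron fun m => quatMatrix (![n, n, 1, 1, 1, 1] m))).symm
  rw [traceKron_apply, traceKron_apply, trace_kron_conj, trace_kron_conj, Complex.ofReal_inj,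
    Fin.prod_univ_six, Fin.prod_univ_six] at h1
  simp only [Matrix.cons_val, mul_one, one_mul, star_one, hu, Quaternion.re_one] at h1
  linarith

lemma false_of_axis_conditions {x y z : ℝ} (hx : x ^ 2 * (y ^ 2 + z ^ 2) = 0)
    (hy : y ^ 2 * (x ^ 2 + z ^ 2) = 0) (hxyz : (x * y + y * z + z * x) ^ 2 = 1) : False := by
  have aux : ∀ a b c : ℝ, a ^ 2 * (b ^ 2 + c ^ 2) = 0 → a = 0 ∨ b = 0 ∧ c = 0 := by
    intro a b c h
    rcases mul_eq_zero.1 h with h | h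
    · exact Or.inl (pow_eq_zero_iff two_ne_zero |>.1 h)
    · have hb := sq_nonneg b
      have hc := sq_nonneg c
      exact Or.inr ⟨pow_eq_zero_iff two_ne_zero |>.1 (by linarith),
        pow_eq_zero_iff two_ne_zero |>.1 (by linarith)⟩
  rcases aux x y z hx with h | ⟨h, h'⟩
  · rcases aux y x z hy with h' | ⟨-, h'⟩ <;> simp [h, h'] at hxyz
  · simp [h, h'] at hxyz

lemma exists_not_commute (hS : IsUnitQuatGroup S) (hinv : InvariantsSpread S) {n : ℍ[ℝ]}
    (hn : n.re = 0) (hn1 : n.imI ^ 2 + n.imJ ^ 2 + n.imK ^ 2 = 1) :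
    ∃ g ∈ S, n * (g * n * star g) - g * n * star g * n ≠ 0 := by
  by_contra! hcomm
  have hpm : ∀ g ∈ S, star g * n * g = n ∨ star g * n * g = -n := by
    intro g hg
    have hc := hcomm _ (hS.star_mem hg)
    rw [star_star] at hc
    have hu := re_sq_add_of_unit (hS.mul_star hg)
    have hv0 : (star g * n * g).re = 0 := by
      simp [hn]
      ring
    have hv : (star g * n * g).imI ^ 2 + (star g * n * g).imJ ^ 2 + (star g * n * g).imK ^ 2 =
        1 := by
      have : (star g * n * g).imI ^ 2 + (star g * n * g).imJ ^ 2 + (star g * n * g).imK ^ 2 =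
        (g.re ^ 2 + g.imI ^ 2 + g.imJ ^ 2 + g.imK ^ 2) ^ 2 *
        (n.imI ^ 2 + n.imJ ^ 2 + n.imK ^ 2) := by
        simp [hn]
        ring
      rw [this, hu, hn1]
      norm_num
    generalize star g * n * g = v at hv0 hv hc
    have hn2 : n * n = -1 := by
      ext <;> simp [hn] <;> linarith
    have hv2 : v * v = -1 := by
      ext <;> simp [hv0] <;> linarith
    have : (v - n) * (v + n) = 0 := by
      rw [sub_mul, mul_add, mul_add, hn2, hv2, sub_eq_zero.1 hc]
      abel
    rcases mul_eq_zero.1 this with h | h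
    · exact Or.inl (sub_eq_zero.1 h)
    · exact Or.inr (eq_neg_of_add_eq_zero_left h)
  have hI := re_mul_unit_conj_sq hinv hpm hS (u := quatBasis 1) (unit_of_re_sq_add (by simp))
  have hJ := re_mul_unit_conj_sq hinv hpm hS (u := quatBasis 2) (unit_of_re_sq_add (by simp))
  have hC := re_mul_unit_conj_sq hinv hpm hS
    (u := (1 / 2 : ℝ) • (quatBasis 0 + quatBasis 1 + quatBasis 2 + quatBasis 3))
    (unit_of_re_sq_add (by simp; norm_num))
  simp [hn] at hI hJ hC
  refine false_of_axis_conditions (x := n.imI) (y := n.imJ) (z := n.imK) ?_ ?_ ?_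
  · linear_combination -hI / 4
  · linear_combination -hJ / 4
  · linear_combination hC + (n.imI ^ 2 + n.imJ ^ 2 + n.imK ^ 2 + 1) * hn1

lemma eq_re_of_orthogonal {n m w : ℍ[ℝ]} (hn : n.re = 0) (hm : m.re = 0)
    (hcomm : n * m - m * n ≠ 0) (h1 : (n * star w).re = 0) (h2 : (m * star w).re = 0)
    (h3 : ((n * m - m * n) * star w).re = 0) : w = w.re := by
  obtain ⟨c, hc⟩ : ∃ c, c = n * m - m * n := ⟨_, rfl⟩
  rw [← hc] at hcomm h3
  have c0 : c.re = 0 := by rw [hc]; simp; ring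
  have c1 : c.imI = 2 * (n.imJ * m.imK - n.imK * m.imJ) := by rw [hc]; simp [hn, hm]; ring
  have c2 : c.imJ = 2 * (n.imK * m.imI - n.imI * m.imK) := by rw [hc]; simp [hn, hm]; ring
  have c3 : c.imK = 2 * (n.imI * m.imJ - n.imJ * m.imI) := by rw [hc]; simp [hn, hm]; ring
  have hpos : c.imI ^ 2 + c.imJ ^ 2 + c.imK ^ 2 ≠ 0 := by
    intro h
    apply hcomm
    have hI : c.imI = 0 := by nlinarith [sq_nonneg c.imI, sq_nonneg c.imJ, sq_nonneg c.imK]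
    have hJ : c.imJ = 0 := by nlinarith [sq_nonneg c.imI, sq_nonneg c.imJ, sq_nonneg c.imK]
    have hK : c.imK = 0 := by nlinarith [sq_nonneg c.imI, sq_nonneg c.imJ, sq_nonneg c.imK]
    ext <;> simpa
  simp [hn, hm, c0] at h1 h2 h3
  have key : ∀ x y z a b c p q r : ℝ, x * p + y * q + z * r = 0 → a * p + b * q + c * r = 0 →
      2 * (y * c - z * b) * p + 2 * (z * a - x * c) * q + 2 * (x * b - y * a) * r = 0 →
      (2 * (y * c - z * b)) ^ 2 + (2 * (z * a - x * c)) ^ 2 + (2 * (x * b - y * a)) ^ 2 ≠ 0 →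
      p = 0 := by
    intro x y z a b c p q r h1 h2 h3 hpos
    apply (mul_eq_zero.1 _).resolve_left hpos
    linear_combination (4 * (b * (x * b - y * a) - c * (z * a - x * c))) * h1 +
      (4 * ((z * a - x * c) * z - (x * b - y * a) * y)) * h2 + (2 * (y * c - z * b)) * h3
  rw [c1, c2, c3] at h3 hpos
  ext
  · simp
  · rw [Quaternion.imI_coe]
    exact key n.imI n.imJ n.imK m.imI m.imJ m.imK _ w.imJ w.imK h1 h2 h3 hpos
  · rw [Quaternion.imJ_coe]
    refine key n.imJ n.imK n.imI m.imJ m.imK m.imI _ w.imK w.imI ?_ ?_ ?_ ?_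
    · linarith
    · linarith
    · linarith
    · convert hpos using 1; ring
  · rw [Quaternion.imK_coe]
    refine key n.imK n.imI n.imJ m.imK m.imI m.imJ _ w.imI w.imJ ?_ ?_ ?_ ?_
    · linarith
    · linarith
    · linarith
    · convert hpos using 1; ring

lemma mem_of_infinite (hS : IsUnitQuatGroup S) (hinv : InvariantsSpread S) (hcl : IsClosed S)
    (hinf : S.Infinite) {v : ℍ[ℝ]} (hv : v * star v = 1) : v ∈ S := by
  have : ProperSpace ℍ[ℝ] := FiniteDimensional.proper ℝ ℍ[ℝ]
  obtain ⟨n, hn, hn1, d, x, hd, hd0, hx, hmem⟩ := exists_tangent hS hinf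
  obtain ⟨g, hg, hcomm⟩ := exists_not_commute hS hinv hn hn1
  have hcpt : IsCompact S := (isCompact_sphere (0 : ℍ[ℝ]) 1).of_isClosed_subset hcl
    fun s hs => mem_sphere_zero_iff_norm.2 (norm_eq_one_of_unit (hS.mul_star hs))
  obtain ⟨s, hs, hmax⟩ := hcpt.exists_isMaxOn ⟨1, hS.one_mem⟩
    (f := fun t : ℍ[ℝ] => (t * star v).re)
    (Quaternion.continuous_re.comp (continuous_id.mul continuous_const)).continuousOn
  obtain ⟨w, rfl⟩ : ∃ w, v = s * w :=
    ⟨star s * v, by rw [← mul_assoc, hS.mul_star hs, one_mul]⟩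
  have hw : w * star w = 1 := by
    have := re_sq_add_of_unit hv
    have hs' := re_sq_add_of_unit (hS.mul_star hs)
    apply unit_of_re_sq_add
    have e : (s * w).re ^ 2 + (s * w).imI ^ 2 + (s * w).imJ ^ 2 + (s * w).imK ^ 2 =
        (s.re ^ 2 + s.imI ^ 2 + s.imJ ^ 2 + s.imK ^ 2) *
        (w.re ^ 2 + w.imI ^ 2 + w.imJ ^ 2 + w.imK ^ 2) := by
      simp
      ring
    rwa [hs', one_mul, this, eq_comm] at e
  have hL : ∀ t ∈ S, (t * star w).re ≤ (star w).re := by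
    intro t ht
    have h := hmax (hS.mul_mem hs ht)
    have e1 : (s * t * star (s * w)).re =
        (s.re ^ 2 + s.imI ^ 2 + s.imJ ^ 2 + s.imK ^ 2) * (t * star w).re := by
      simp
      ring
    have e2 : (s * star (s * w)).re =
        (s.re ^ 2 + s.imI ^ 2 + s.imJ ^ 2 + s.imK ^ 2) * (star w).re := by
      simp
      ring
    simpa only [Set.mem_ofPred_eq, e1, e2, re_sq_add_of_unit (hS.mul_star hs), one_mul] using h
  have hLcont : Continuous fun t : ℍ[ℝ] => (t * star w).re :=
    Quaternion.continuous_re.comp (continuous_id.mul continuous_const)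
  have hle : ∀ (y : ℕ → ℍ[ℝ]) (a : ℍ[ℝ]), Tendsto y atTop (𝓝 a) → (∀ j, 1 + d j • y j ∈ S) →
      (a * star w).re ≤ 0 := by
    intro y a hy hyS
    refine le_of_tendsto ((hLcont.tendsto a).comp hy) (Eventually.of_forall fun j => ?_)
    have h := hL _ (hyS j)
    rw [add_mul, one_mul, smul_mul_assoc, Quaternion.re_add, Quaternion.re_smul, smul_eq_mul] at h
    have h' : d j * (y j * star w).re ≤ 0 := by linarith
    exact nonpos_of_mul_nonpos_right h' (hd j)
  have horth : ∀ g ∈ S, ((g * n * star g) * star w).re = 0 := by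
    intro g hg
    have hstar : star n = -n := by ext <;> simp [hn]
    apply le_antisymm
    · refine hle (fun j => g * x j * star g) _ ((hx.const_mul g).mul_const _) fun j => ?_
      have := hS.mul_mem (hS.mul_mem hg (hmem j)) (hS.star_mem hg)
      rwa [mul_add, add_mul, mul_one, hS.mul_star hg, mul_smul_comm, smul_mul_assoc] at this
    · have := hle (fun j => g * star (x j) * star g) _ ((hx.star.const_mul g).mul_const _)
        fun j => by
          have := hS.mul_mem (hS.mul_mem hg (hS.star_mem (hmem j))) (hS.star_mem hg)
          rwa [star_add, star_one, Quaternion.star_smul, mul_add, add_mul, mul_one,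
            hS.mul_star hg, mul_smul_comm, smul_mul_assoc] at this
      rw [hstar, mul_neg, neg_mul, neg_mul, Quaternion.re_neg] at this
      linarith
  have h1 := horth 1 hS.one_mem
  have h2 := horth g hg
  have h3 : ((n * (g * n * star g) - g * n * star g * n) * star w).re = 0 := by
    have hstar : star n = -n := by ext <;> simp [hn]
    have hlim : Tendsto (fun j => x j * (g * n * star g) + (g * n * star g) * star (x j) +
        d j • (x j * (g * n * star g) * star (x j))) atTop
        (𝓝 (n * (g * n * star g) + (g * n * star g) * star n +
          (0 : ℝ) • (n * (g * n * star g) * star n))) :=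
      ((hx.mul_const _).add (hx.star.const_mul _)).add
        (hd0.smul ((hx.mul_const _).mul hx.star))
    rw [zero_smul, add_zero, hstar, mul_neg, ← sub_eq_add_neg] at hlim
    refine tendsto_nhds_unique ((hLcont.tendsto _).comp hlim)
      (tendsto_const_nhds.congr fun j => ?_)
    have h := horth _ (hS.mul_mem (hmem j) hg)
    have e : (1 + d j • x j) * g * n * star ((1 + d j • x j) * g) = g * n * star g +
        d j • (x j * (g * n * star g) + (g * n * star g) * star (x j) +
        d j • (x j * (g * n * star g) * star (x j))) := by
      simp only [star_mul, star_add, Quaternion.star_smul, add_mul, mul_add, one_mul,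
        smul_mul_assoc, mul_smul_comm, smul_add, mul_assoc]
      abel
    rw [e, add_mul, Quaternion.re_add, h2, zero_add, smul_mul_assoc, Quaternion.re_smul,
      smul_eq_mul] at h
    exact ((mul_eq_zero.1 h).resolve_left (hd j).ne').symm
  rw [star_one, one_mul, mul_one] at h1
  have hm0 : (g * n * star g).re = 0 := by
    simp [hn]
    ring
  generalize g * n * star g = m at h2 h3 hm0 hcomm
  have hw0 : w = w.re := eq_re_of_orthogonal hn hm0 hcomm h1 h2 h3
  have hw1 := re_sq_add_of_unit hw
  rw [hw0] at hw1
  simp at hw1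
  rcases hw1 with hw1 | hw1
  · rw [hw0, hw1]
    simpa using hs
  · exfalso
    rw [hw0, hw1] at hL
    apply hinf
    refine (Set.finite_singleton (1 : ℍ[ℝ])).subset fun t ht => ?_
    have h := hL t ht
    simp at h
    have hu := re_sq_add_of_unit (hS.mul_star ht)
    rw [Set.mem_singleton_iff]
    have hI : t.imI ^ 2 ≤ 0 := by nlinarith [sq_nonneg t.imI, sq_nonneg t.imJ, sq_nonneg t.imK]
    have hJ : t.imJ ^ 2 ≤ 0 := by nlinarith [sq_nonneg t.imI, sq_nonneg t.imJ, sq_nonneg t.imK]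
    have hK : t.imK ^ 2 ≤ 0 := by nlinarith [sq_nonneg t.imI, sq_nonneg t.imJ, sq_nonneg t.imK]
    have hI := pow_eq_zero_iff (two_ne_zero) |>.1 (le_antisymm hI (sq_nonneg _))
    have hJ := pow_eq_zero_iff (two_ne_zero) |>.1 (le_antisymm hJ (sq_nonneg _))
    have hK := pow_eq_zero_iff (two_ne_zero) |>.1 (le_antisymm hK (sq_nonneg _))
    ext
    · rw [Quaternion.re_one]
      rw [hI, hJ, hK] at hu
      nlinarith
    · simpa using hI
    · simpa using hJ
    · simpa using hK

end InfiniteGroup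

section ConjInvariant

variable {ι : Type*} [Fintype ι] {k : ℕ}

lemma continuous_tpow (k : ℕ) : Continuous (tpow k : Matrix ι ι ℂ → _) := by
  refine continuous_matrix fun I J => ?_
  simp only [tpow, Matrix.of_apply]
  fun_prop

/-- The matrices `g` such that `f` is invariant under `X ↦ g^{⊗k} X (g^*)^{⊗k}`. -/
def conjInvariant (f : Matrix (Fin k → ι) (Fin k → ι) ℂ →ₗ[ℂ] ℂ) : Set (Matrix ι ι ℂ) :=
  {g | ∀ X, f (tpow k g * X * tpow k (star g)) = f X}

variable {f : Matrix (Fin k → ι) (Fin k → ι) ℂ →ₗ[ℂ] ℂ}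

lemma isClosed_conjInvariant : IsClosed (conjInvariant f) := by
  have hf : Continuous f := LinearMap.continuous_of_finiteDimensional f
  have : conjInvariant f = ⋂ X, {g | f (tpow k g * X * tpow k (star g)) = f X} := by
    ext g
    simp [conjInvariant]
  rw [this]
  refine isClosed_iInter fun X => isClosed_eq (hf.comp ?_) continuous_const
  exact ((continuous_tpow k).matrix_mul continuous_const).matrix_mul
    ((continuous_tpow k).comp continuous_star)

variable [DecidableEq ι]

lemma star_mul_self_of_mem_unitaryGroup (u : Matrix.unitaryGroup ι ℂ) :
    star (u : Matrix ι ι ℂ) * u = 1 := Unitary.coe_star_mul_self u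

lemma one_mem_conjInvariant : 1 ∈ conjInvariant f := by
  intro X
  simp [tpow_one]

lemma mul_mem_conjInvariant {g h : Matrix ι ι ℂ} (hg : g ∈ conjInvariant f)
    (hh : h ∈ conjInvariant f) : g * h ∈ conjInvariant f := by
  intro X
  rw [← hh X, ← hg (tpow k h * X * tpow k (star h)), star_mul, tpow_mul, tpow_mul]
  simp only [Matrix.mul_assoc]

lemma star_mem_conjInvariant {g : Matrix ι ι ℂ} (hg : g ∈ conjInvariant f)
    (hu : g * star g = 1) : star g ∈ conjInvariant f := by
  intro X
  rw [← hg]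
  have e : tpow k g * (tpow k (star g) * X * tpow k (star (star g))) * tpow k (star g) =
      (tpow k g * tpow k (star g)) * X * (tpow k g * tpow k (star g)) := by
    simp only [star_star, Matrix.mul_assoc]
  rw [e, ← tpow_mul, hu, tpow_one, Matrix.one_mul, Matrix.mul_one]

lemma smul_mem_conjInvariant {c : ℂ} (hc : c * star c = 1) {g : Matrix ι ι ℂ}
    (hg : g ∈ conjInvariant f) : c • g ∈ conjInvariant f := by
  intro X
  rw [← hg X, StarModule.star_smul, tpow_smul, tpow_smul, Matrix.smul_mul, Matrix.smul_mul,
    Matrix.mul_smul, smul_smul, ← mul_pow, hc, one_pow, one_smul]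

lemma mem_invFunctionals_closure_iff {G : Set (Matrix.unitaryGroup ι ℂ)} :
    f ∈ invFunctionals k (closure ((fun u : Matrix.unitaryGroup ι ℂ => (u : Matrix ι ι ℂ)) '' G)) ↔
      ∀ u ∈ G, (u : Matrix ι ι ℂ) ∈ conjInvariant f := by
  have hinv : ∀ g ∈ closure ((fun u : Matrix.unitaryGroup ι ℂ => (u : Matrix ι ι ℂ)) '' G),
      g⁻¹ = star g := by
    intro g hg
    have hcl : IsClosed {g : Matrix ι ι ℂ | star g * g = 1} :=
      isClosed_eq (continuous_star.matrix_mul continuous_id) continuous_const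
    refine Matrix.inv_eq_left_inv (hcl.closure_subset_iff.2 ?_ hg)
    rintro _ ⟨u, -, rfl⟩
    exact star_mul_self_of_mem_unitaryGroup u
  constructor
  · intro h u hu X
    have hu' := subset_closure (Set.mem_image_of_mem (fun u : Matrix.unitaryGroup ι ℂ =>
      (u : Matrix ι ι ℂ)) hu)
    have := h _ hu' X
    rwa [hinv _ hu'] at this
  · intro h g hg X
    rw [hinv g hg]
    refine isClosed_conjInvariant.closure_subset_iff.2 ?_ hg X
    rintro _ ⟨u, hu, rfl⟩
    exact h u hu

lemma invFunctionals_isUnit_le {G : Set (Matrix.unitaryGroup ι ℂ)} :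
    invFunctionals k {g : Matrix ι ι ℂ | IsUnit g} ≤
      invFunctionals k
        (closure ((fun u : Matrix.unitaryGroup ι ℂ => (u : Matrix ι ι ℂ)) '' G)) := by
  intro f hf
  rw [mem_invFunctionals_closure_iff]
  intro u _ X
  have := hf u (IsUnit.of_mul_eq_one_right _ (star_mul_self_of_mem_unitaryGroup u)) X
  rwa [Matrix.inv_eq_left_inv (star_mul_self_of_mem_unitaryGroup u)] at this

end ConjInvariant

section UnitaryTwo

/-- The special unitary matrix attached to a unit quaternion. -/
noncomputable def quatUnitary (q : {q : ℍ[ℝ] // q * star q = 1}) :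
    Matrix.unitaryGroup (Fin 2) ℂ :=
  ⟨quatMatrix q, Matrix.mem_unitaryGroup_iff.2 (by
    rw [← quatMatrix_star, ← quatMatrix_mul, q.2, quatMatrix_one])⟩

lemma continuous_quatMatrix : Continuous quatMatrix := by
  have hmk : Continuous fun p : ℝ × ℝ => (⟨p.1, p.2⟩ : ℂ) :=
    Complex.equivRealProdCLM.symm.continuous
  have hI := Quaternion.continuous_imI
  have hJ := Quaternion.continuous_imJ
  have hK := Quaternion.continuous_imK
  have hR := Quaternion.continuous_re
  refine continuous_matrix fun i j => ?_
  fin_cases i <;> fin_cases j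
  · exact hmk.comp (hR.prodMk hI)
  · exact hmk.comp (hJ.prodMk hK)
  · exact hmk.comp (hJ.neg.prodMk hK)
  · exact hmk.comp (hR.prodMk hI.neg)

lemma continuous_quatUnitary : Continuous quatUnitary :=
  (continuous_quatMatrix.comp continuous_subtype_val).subtype_mk _

/-- A unimodular scalar as a unitary matrix. -/
def scalarUnitary (c : ℂ) (hc : c * star c = 1) : Matrix.unitaryGroup (Fin 2) ℂ :=
  ⟨c • 1, Matrix.mem_unitaryGroup_iff.2 (by
    rw [StarModule.star_smul, star_one, smul_mul_smul_comm, hc, one_mul, one_smul])⟩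

lemma exists_eq_scalarUnitary_mul_quatUnitary (u : Matrix.unitaryGroup (Fin 2) ℂ) :
    ∃ (c : ℂ) (hc : c * star c = 1) (q : {q : ℍ[ℝ] // q * star q = 1}),
      u = scalarUnitary c hc * quatUnitary q := by
  have huu : (u : Matrix (Fin 2) (Fin 2) ℂ) * star (u : Matrix (Fin 2) (Fin 2) ℂ) = 1 :=
    Unitary.coe_mul_star_self u
  have hdet : (u : Matrix (Fin 2) (Fin 2) ℂ).det * star (u : Matrix (Fin 2) (Fin 2) ℂ).det = 1 := by
    have := congrArg Matrix.det huu
    rwa [Matrix.det_mul, Matrix.star_eq_conjTranspose, Matrix.det_conjTranspose,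
      Matrix.det_one] at this
  obtain ⟨c, hc⟩ := IsAlgClosed.exists_pow_nat_eq (u : Matrix (Fin 2) (Fin 2) ℂ).det two_pos
  have hc1 : c * star c = 1 := by
    rw [← hc] at hdet
    have h : (‖c‖ ^ 2) ^ 2 = 1 := by
      have := congrArg norm hdet
      simp only [star_pow, norm_mul, norm_pow, Complex.star_def, Complex.norm_conj, norm_one] at this
      linarith
    have h' : ‖c‖ ^ 2 = 1 := by nlinarith [sq_nonneg ‖c‖]
    rw [Complex.star_def, Complex.mul_conj, Complex.normSq_eq_norm_sq, h']
    simp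
  obtain ⟨M, hM⟩ : ∃ M, M = star c • (u : Matrix (Fin 2) (Fin 2) ℂ) := ⟨_, rfl⟩
  have hMdet : M.det = 1 := by
    rw [hM, Matrix.det_smul, ← hc, Fintype.card_fin, ← mul_pow, mul_comm, hc1, one_pow]
  have hMM : M * star M = 1 := by
    rw [hM, StarModule.star_smul, star_star, smul_mul_smul_comm, huu, mul_comm, hc1, one_smul]
  have hadj : star M = M.adjugate := by
    have h1 : M * M.adjugate = 1 := by rw [Matrix.mul_adjugate, hMdet, one_smul]
    calc star M = (M.adjugate * M) * star M := by
          rw [Matrix.adjugate_mul, hMdet, one_smul, one_mul]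
      _ = M.adjugate := by rw [mul_assoc, hMM, mul_one]
  have h11 : M 1 1 = star (M 0 0) := by
    have := congrFun₂ hadj 0 0
    simpa [Matrix.adjugate_fin_two, Matrix.star_apply] using this.symm
  have h10 : M 1 0 = -star (M 0 1) := by
    have := congrFun₂ hadj 1 0
    have : star (M 0 1) = -M 1 0 := by
      simpa [Matrix.adjugate_fin_two, Matrix.star_apply] using this
    rw [this, neg_neg]
  have hMq : M = quatMatrix ⟨(M 0 0).re, (M 0 0).im, (M 0 1).re, (M 0 1).im⟩ := by
    ext i j
    fin_cases i <;> fin_cases j <;> simp [quatMatrix, h11, h10, Complex.ext_iff]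
  refine ⟨c, hc1, ⟨_, unit_of_re_sq_add (s := ⟨(M 0 0).re, (M 0 0).im, (M 0 1).re, (M 0 1).im⟩) ?_⟩,
    Subtype.ext ?_⟩
  · rw [Matrix.det_fin_two, h11, h10] at hMdet
    have := congrArg Complex.re hMdet
    simp at this
    simp
    linarith
  · simp only [scalarUnitary, quatUnitary, Submonoid.coe_mul]
    rw [← hMq, hM, smul_mul_smul_comm, hc1, one_mul, one_smul]

end UnitaryTwo

section Completeness

open Topology

/-- The unit quaternions whose special unitary matrix lies in `T`. -/
def unitQuats (T : Subgroup (Matrix.unitaryGroup (Fin 2) ℂ)) : Set ℍ[ℝ] :=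
  Subtype.val '' (quatUnitary ⁻¹' (T : Set (Matrix.unitaryGroup (Fin 2) ℂ)))

variable {T : Subgroup (Matrix.unitaryGroup (Fin 2) ℂ)}

lemma mem_unitQuats_iff (q : {q : ℍ[ℝ] // q * star q = 1}) :
    (q : ℍ[ℝ]) ∈ unitQuats T ↔ quatUnitary q ∈ T :=
  Subtype.val_injective.mem_set_image

lemma isUnitQuatGroup_unitQuats : IsUnitQuatGroup (unitQuats T) where
  one_mem := by
    refine (mem_unitQuats_iff ⟨1, by simp⟩).2 ?_
    convert T.one_mem
    exact Subtype.ext quatMatrix_one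
  mul_mem := by
    rintro _ _ ⟨p, hp, rfl⟩ ⟨q, hq, rfl⟩
    refine (mem_unitQuats_iff ⟨p * q, ?_⟩).2 ?_
    · rw [star_mul, mul_assoc, ← mul_assoc (q : ℍ[ℝ]), q.2, one_mul, p.2]
    · convert T.mul_mem hp hq
      exact Subtype.ext (quatMatrix_mul _ _)
  star_mem := by
    rintro _ ⟨p, hp, rfl⟩
    refine (mem_unitQuats_iff ⟨star p, ?_⟩).2 ?_
    · rw [star_star, star_comm_self', p.2]
    · convert T.inv_mem hp
      exact Subtype.ext (quatMatrix_star _)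
  mul_star := by
    rintro _ ⟨p, -, rfl⟩
    exact p.2
  star_mul := by
    rintro _ ⟨p, -, rfl⟩
    rw [star_comm_self', p.2]

lemma isClosed_unitQuats (hT : IsClosed (T : Set (Matrix.unitaryGroup (Fin 2) ℂ))) :
    IsClosed (unitQuats T) := by
  have hcl : IsClosed {q : ℍ[ℝ] | q * star q = 1} :=
    isClosed_eq (continuous_id.mul continuous_star) continuous_const
  exact hcl.isClosedEmbedding_subtypeVal.isClosedMap _ (hT.preimage continuous_quatUnitary)

/-- A closed subgroup of `U(2)` containing the scalars is everything as soon as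
its invariants on `End (V^{⊗6})` are invariant under `SU(2)`. -/
lemma eq_top_of_invariantsSpread (hT : IsClosed (T : Set (Matrix.unitaryGroup (Fin 2) ℂ)))
    (hscalar : ∀ c hc, scalarUnitary c hc ∈ T) (hinv : InvariantsSpread (unitQuats T)) :
    T = ⊤ := by
  have hS := isUnitQuatGroup_unitQuats (T := T)
  have hinf : (unitQuats T).Infinite := fun hfin =>
    false_of_finite hinv hS (F := hfin.toFinset) (by simp)
  refine (Subgroup.eq_top_iff' T).2 fun u => ?_
  obtain ⟨c, hc, q, rfl⟩ := exists_eq_scalarUnitary_mul_quatUnitary u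
  exact T.mul_mem (hscalar c hc)
    ((mem_unitQuats_iff q).1 (mem_of_infinite hS hinv (isClosed_unitQuats hT) hinf q.2))

lemma coe_scalarUnitary_mul_quatUnitary (c : ℂ) (hc : c * star c = 1)
    (q : {q : ℍ[ℝ] // q * star q = 1}) :
    ((scalarUnitary c hc * quatUnitary q : Matrix.unitaryGroup (Fin 2) ℂ) :
      Matrix (Fin 2) (Fin 2) ℂ) = c • quatMatrix q := by
  simp [scalarUnitary, quatUnitary]

lemma scalarUnitary_mem_scalarSet (c : ℂ) (hc : c * star c = 1) :
    scalarUnitary c hc ∈ scalarSet (Fin 2) := ⟨c, rfl⟩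

lemma isCompleteGateSet_of_invFunctionals_eq {Γ : Set (Matrix.unitaryGroup (Fin 2) ℂ)}
    (h : invFunctionals 6 (closure ((fun u : Matrix.unitaryGroup (Fin 2) ℂ =>
        (u : Matrix (Fin 2) (Fin 2) ℂ)) '' (Subgroup.closure Γ : Set _))) =
      invFunctionals 6 {g : Matrix (Fin 2) (Fin 2) ℂ | IsUnit g}) :
    IsCompleteGateSet Γ := by
  set T := (Subgroup.closure (Γ ∪ scalarSet (Fin 2))).topologicalClosure with hT
  have hle : Subgroup.closure (Γ ∪ scalarSet (Fin 2)) ≤ T := Subgroup.le_topologicalClosure _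
  have hscalar : ∀ c hc, scalarUnitary c hc ∈ T := fun c hc =>
    hle (Subgroup.subset_closure (Or.inr (scalarUnitary_mem_scalarSet c hc)))
  have htop : T = ⊤ := by
    refine eq_top_of_invariantsSpread (Subgroup.isClosed_topologicalClosure _) hscalar ?_
    intro f hf u hu X
    have hmem : f ∈ invFunctionals 6 {g : Matrix (Fin 2) (Fin 2) ℂ | IsUnit g} := by
      rw [← h, mem_invFunctionals_closure_iff]
      intro v hv
      have hvT : v ∈ T := hle (Subgroup.closure_mono Set.subset_union_left hv)
      obtain ⟨c, hc, q, rfl⟩ := exists_eq_scalarUnitary_mul_quatUnitary v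
      rw [coe_scalarUnitary_mul_quatUnitary]
      refine smul_mem_conjInvariant hc fun Y => ?_
      rw [← quatMatrix_star]
      exact hf q ((mem_unitQuats_iff q).2 ((T.mul_mem_cancel_left (hscalar c hc)).1 hvT)) Y
    have h1 : quatMatrix u * quatMatrix (star u) = 1 := by
      rw [← quatMatrix_mul, hu, quatMatrix_one]
    have := hmem (quatMatrix u) (IsUnit.of_mul_eq_one _ h1) X
    rwa [Matrix.inv_eq_right_inv h1] at this
  have := congrArg (fun H : Subgroup (Matrix.unitaryGroup (Fin 2) ℂ) =>
    (H : Set (Matrix.unitaryGroup (Fin 2) ℂ))) htop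
  rw [IsCompleteGateSet, dense_iff_closure_eq]
  simpa [hT, Subgroup.topologicalClosure_coe] using this

end Completeness

section GeneralLinear

variable {ι : Type*} [Fintype ι] [DecidableEq ι] {k : ℕ}
  {f : Matrix (Fin k → ι) (Fin k → ι) ℂ →ₗ[ℂ] ℂ}

/-- The submonoid of matrices `g` with `f (g^{⊗k} X) = f (X g^{⊗k})` for all `X`. -/
def commSubmonoid (f : Matrix (Fin k → ι) (Fin k → ι) ℂ →ₗ[ℂ] ℂ) :
    Submonoid (Matrix ι ι ℂ) where
  carrier := {g | ∀ X, f (tpow k g * X) = f (X * tpow k g)}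
  one_mem' := by
    intro X
    simp [tpow_one]
  mul_mem' := by
    intro a b ha hb X
    rw [tpow_mul, Matrix.mul_assoc, ha, Matrix.mul_assoc, hb, Matrix.mul_assoc]

lemma mem_commSubmonoid_of_mem_conjInvariant {g : Matrix ι ι ℂ} (hu : star g * g = 1)
    (hg : g ∈ conjInvariant f) : g ∈ commSubmonoid f := by
  intro X
  have := hg (X * tpow k g)
  rw [← this, Matrix.mul_assoc, Matrix.mul_assoc, ← tpow_mul, mul_eq_one_comm.1 hu, tpow_one,
    Matrix.mul_one]

lemma infinite_unit_circle : {c : ℂ | c * star c = 1}.Infinite := by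
  refine Set.Infinite.of_image Complex.re ((Set.Icc_infinite (zero_lt_one' ℝ)).mono fun x hx => ?_)
  refine ⟨⟨x, √(1 - x ^ 2)⟩, ?_, rfl⟩
  have h : 0 ≤ 1 - x ^ 2 := by nlinarith [hx.1, hx.2]
  have hs := Real.mul_self_sqrt h
  simp only [Set.mem_ofPred_eq, Complex.star_def, Complex.mul_conj, Complex.normSq_mk, hs]
  simp
  norm_cast
  ring

open Polynomial in
/-- Matrices in `commSubmonoid f` along a polynomial family of diagonal matrices are detected
on the unit circle. -/
lemma diagonal_eval_mem_commSubmonoid (P : ι → ℂ[X])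
    (h : ∀ c : ℂ, c * star c = 1 → Matrix.diagonal (fun i => (P i).eval c) ∈ commSubmonoid f)
    (c : ℂ) : Matrix.diagonal (fun i => (P i).eval c) ∈ commSubmonoid f := by
  have htp : ∀ d : ι → ℂ, tpow k (Matrix.diagonal d) = Matrix.diagonal fun I => ∏ m, d (I m) := by
    intro d
    ext I J
    by_cases hIJ : I = J
    · subst hIJ
      simp [tpow]
    · obtain ⟨m, hm⟩ := Function.ne_iff.mp hIJ
      rw [Matrix.diagonal_apply_ne _ hIJ]
      exact Finset.prod_eq_zero (Finset.mem_univ m) (Matrix.diagonal_apply_ne _ hm)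
  have hf : ∀ M, f M = ∑ I, ∑ J, M I J * f (Matrix.single I J 1) := by
    intro M
    conv_lhs => rw [Matrix.matrix_eq_sum_single M]
    simp only [map_sum]
    refine Finset.sum_congr rfl fun I _ => Finset.sum_congr rfl fun J _ => ?_
    rw [← smul_eq_mul, ← map_smul, Matrix.smul_single, smul_eq_mul, mul_one]
  intro X
  set Q : ℂ[X] := ∑ I, ∑ J, C (X I J * f (Matrix.single I J 1)) *
    (∏ m, P (I m) - ∏ m, P (J m)) with hQ
  have hQeval : ∀ a : ℂ, Q.eval a = f (tpow k (Matrix.diagonal fun i => (P i).eval a) * X) -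
      f (X * tpow k (Matrix.diagonal fun i => (P i).eval a)) := by
    intro a
    rw [hf, hf (X * _), ← Finset.sum_sub_distrib, hQ, eval_finsetSum]
    refine Finset.sum_congr rfl fun I _ => ?_
    rw [← Finset.sum_sub_distrib, eval_finsetSum]
    refine Finset.sum_congr rfl fun J _ => ?_
    rw [htp, Matrix.diagonal_mul, Matrix.mul_diagonal, eval_mul, eval_C, eval_sub, eval_prod,
      eval_prod]
    ring
  have hQ0 : Q = 0 := Polynomial.eq_zero_of_infinite_isRoot Q
    (infinite_unit_circle.mono fun a ha => by
      rw [Set.mem_ofPred_eq, IsRoot, hQeval, h a ha X, sub_self])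
  rw [← sub_eq_zero, ← hQeval, hQ0, eval_zero]

end GeneralLinear

section GeneralLinearTwo

variable {k : ℕ} {f : Matrix (Fin k → Fin 2) (Fin k → Fin 2) ℂ →ₗ[ℂ] ℂ}

open Polynomial in
lemma mem_commSubmonoid_of_unitary
    (h : ∀ u : Matrix.unitaryGroup (Fin 2) ℂ, (u : Matrix (Fin 2) (Fin 2) ℂ) ∈ commSubmonoid f)
    (g : Matrix (Fin 2) (Fin 2) ℂ) : g ∈ commSubmonoid f := by
  have hswap : (!![0, 1; 1, 0] : Matrix (Fin 2) (Fin 2) ℂ) ∈ commSubmonoid f := by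
    refine h ⟨_, Matrix.mem_unitaryGroup_iff.2 ?_⟩
    ext i j
    fin_cases i <;> fin_cases j <;> simp [Matrix.mul_apply]
  have hdiag1 : ∀ a : ℂ, Matrix.diagonal ![a, 1] ∈ commSubmonoid f := by
    intro a
    have e : ∀ c : ℂ, (fun i => ((![X, 1] : Fin 2 → ℂ[X]) i).eval c) = ![c, 1] := by
      intro c
      ext i
      fin_cases i <;> simp
    have := diagonal_eval_mem_commSubmonoid (f := f) ![X, 1] (fun c hc => ?_) a
    · rwa [e] at this
    · rw [e]
      refine h ⟨_, Matrix.mem_unitaryGroup_iff.2 ?_⟩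
      rw [Complex.star_def] at hc
      ext i j
      fin_cases i <;> fin_cases j <;>
        simp [Matrix.mul_apply, Matrix.star_apply, hc]
  have hdiag : ∀ d : Fin 2 → ℂ, Matrix.diagonal d ∈ commSubmonoid f := by
    intro d
    have e : Matrix.diagonal d = Matrix.diagonal ![d 0, 1] *
        (!![0, 1; 1, 0] * Matrix.diagonal ![d 1, 1] * !![0, 1; 1, 0]) := by
      have hd : ∀ d : Fin 2 → ℂ, Matrix.diagonal d = !![d 0, 0; 0, d 1] := by
        intro d
        ext i j
        fin_cases i <;> fin_cases j <;> simp
      simp only [hd, Matrix.mul_fin_two]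
      simp
    rw [e]
    exact mul_mem (hdiag1 _) (mul_mem (mul_mem hswap (hdiag1 _)) hswap)
  have hsymm : (!![0, 1; 1, 1] : Matrix (Fin 2) (Fin 2) ℂ) ∈ commSubmonoid f := by
    have hH : (!![0, 1; 1, 1] : Matrix (Fin 2) (Fin 2) ℂ).IsHermitian := by
      ext i j
      fin_cases i <;> fin_cases j <;> simp
    rw [hH.spectral_theorem, Unitary.conjStarAlgAut_apply]
    exact mul_mem (mul_mem (h _) (hdiag _)) (h (star hH.eigenvectorUnitary))
  have hupper : ∀ c : ℂ, (!![1, c; 0, 1] : Matrix (Fin 2) (Fin 2) ℂ) ∈ commSubmonoid f := by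
    intro c
    by_cases hc : c = 0
    · have : (!![1, c; 0, 1] : Matrix (Fin 2) (Fin 2) ℂ) = 1 := by
        rw [hc, Matrix.one_fin_two]
      rw [this]
      exact one_mem _
    · have e : (!![1, c; 0, 1] : Matrix (Fin 2) (Fin 2) ℂ) = Matrix.diagonal ![c, 1] *
          (!![0, 1; 1, 0] * !![0, 1; 1, 1]) * Matrix.diagonal ![c⁻¹, 1] := by
        ext i j
        fin_cases i <;> fin_cases j <;> simp [Matrix.mul_apply, Fin.sum_univ_two, hc]
      rw [e]
      exact mul_mem (mul_mem (hdiag _) (mul_mem hswap hsymm)) (hdiag _)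
  have hlower : ∀ c : ℂ, (!![1, 0; c, 1] : Matrix (Fin 2) (Fin 2) ℂ) ∈ commSubmonoid f := by
    intro c
    have e : (!![1, 0; c, 1] : Matrix (Fin 2) (Fin 2) ℂ) =
        !![0, 1; 1, 0] * !![1, c; 0, 1] * !![0, 1; 1, 0] := by
      ext i j
      fin_cases i <;> fin_cases j <;> simp [Matrix.mul_apply, Fin.sum_univ_two]
    rw [e]
    exact mul_mem (mul_mem hswap (hupper c)) hswap
  refine Matrix.diagonal_transvection_induction _ g (fun D _ => hdiag D) ?_
    fun A B => mul_mem
  rintro ⟨i, j, hij, c⟩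
  have e01 : Matrix.transvection (0 : Fin 2) 1 c = !![1, c; 0, 1] := by
    ext i j
    fin_cases i <;> fin_cases j <;> simp [Matrix.transvection]
  have e10 : Matrix.transvection (1 : Fin 2) 0 c = !![1, 0; c, 1] := by
    ext i j
    fin_cases i <;> fin_cases j <;> simp [Matrix.transvection]
  fin_cases i <;> fin_cases j
  · exact absurd rfl hij
  · change Matrix.transvection (0 : Fin 2) 1 c ∈ _
    rw [e01]
    exact hupper c
  · change Matrix.transvection (1 : Fin 2) 0 c ∈ _
    rw [e10]
    exact hlower c
  · exact absurd rfl hij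

lemma invFunctionals_eq_of_isCompleteGateSet {Γ : Set (Matrix.unitaryGroup (Fin 2) ℂ)}
    (hΓ : IsCompleteGateSet Γ) :
    invFunctionals k (closure ((fun u : Matrix.unitaryGroup (Fin 2) ℂ =>
        (u : Matrix (Fin 2) (Fin 2) ℂ)) '' (Subgroup.closure Γ : Set _))) =
      invFunctionals k {g : Matrix (Fin 2) (Fin 2) ℂ | IsUnit g} := by
  refine le_antisymm (fun f hf => ?_) invFunctionals_isUnit_le
  rw [mem_invFunctionals_closure_iff] at hf
  have hD : ∀ u ∈ Subgroup.closure (Γ ∪ scalarSet (Fin 2)),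
      (u : Matrix (Fin 2) (Fin 2) ℂ) ∈ conjInvariant f := by
    intro u hu
    induction hu using Subgroup.closure_induction with
    | mem x hx =>
      rcases hx with hx | ⟨c, hc⟩
      · exact hf x (Subgroup.subset_closure hx)
      · have hx : (x : Matrix (Fin 2) (Fin 2) ℂ) * star (x : Matrix (Fin 2) (Fin 2) ℂ) = 1 :=
          Unitary.coe_mul_star_self x
        rw [hc, StarModule.star_smul, star_one, smul_mul_smul_comm, one_mul] at hx
        have hc1 : c * star c = 1 := by simpa using congrFun₂ hx 0 0
        rw [hc]
        exact smul_mem_conjInvariant hc1 one_mem_conjInvariant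
    | one => exact one_mem_conjInvariant
    | mul x y _ _ hx hy => exact mul_mem_conjInvariant hx hy
    | inv x _ hx => exact star_mem_conjInvariant hx (Unitary.coe_mul_star_self x)
  have hU : ∀ u : Matrix.unitaryGroup (Fin 2) ℂ,
      (u : Matrix (Fin 2) (Fin 2) ℂ) ∈ conjInvariant f := fun u =>
    (isClosed_conjInvariant.preimage continuous_subtype_val).closure_subset_iff.2 hD
      (hΓ u)
  intro g hg X
  have := mem_commSubmonoid_of_unitary (f := f) (fun u => mem_commSubmonoid_of_mem_conjInvariant
    (star_mul_self_of_mem_unitaryGroup u) (hU u)) g (X * tpow k g⁻¹)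
  rw [Matrix.mul_assoc, this, Matrix.mul_assoc, ← tpow_mul,
    Matrix.nonsing_inv_mul _ ((Matrix.isUnit_iff_isUnit_det g).1 hg), tpow_one, Matrix.mul_one]

end GeneralLinearTwo

/-- For `Γ ⊆ U(2)`: `Γ` is complete if and only if
`M_12(G) = M_12(GL_2(ℂ))`, where `G` is the smallest closed subgroup of `U(2)`
containing `Γ`. -/
theorem complete_iff_M12_eq (Γ : Set (Matrix.unitaryGroup (Fin 2) ℂ)) :
    IsCompleteGateSet Γ ↔
      Mdim 6 (closure ((fun u : Matrix.unitaryGroup (Fin 2) ℂ =>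
            (u : Matrix (Fin 2) (Fin 2) ℂ)) ''
          (Subgroup.closure Γ : Set (Matrix.unitaryGroup (Fin 2) ℂ))))
        = Mdim 6 {g : Matrix (Fin 2) (Fin 2) ℂ | IsUnit g} := by
  refine ⟨fun h => ?_, fun h => ?_⟩
  · rw [Mdim, Mdim, invFunctionals_eq_of_isCompleteGateSet h]
  · exact isCompleteGateSet_of_invFunctionals_eq
      (Submodule.eq_of_le_of_finrank_eq invFunctionals_isUnit_le h.symm).symm
end

section
/- Let d ≥ 2, let Γ be an n-qudit gate set, let N ≥ n, and let Σ be an arbitrary generating set of the symmetric group S_N, regarded as unitary operators on (ℂ^d)^{⊗N} permuting the tensor factors. Then Γ is N-universal if and only if Γ_N ∪ Σ is complete as an N-qudit gate set. -/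
open Matrix

/-- `Γ_N` : the extensions `u ⊗ I` of the gates of `Γ` to `N` qudits. -/
def gateExtSet (d n N : ℕ) (h : n ≤ N) (Γ : Set (UG d n)) : Set (UG d N) :=
  {v | ∃ u ∈ Γ, (v : Matrix (QIdx d N) (QIdx d N) ℂ) =
      tensorExt h (u : Matrix (QIdx d n) (QIdx d n) ℂ)}

/-- The permutations from `Σ`, regarded as unitary gates on `N` qudits. -/
def permGateSet (d N : ℕ) (Sgen : Set (Equiv.Perm (Fin N))) : Set (UG d N) :=
  {v | ∃ σ ∈ Sgen, (v : Matrix (QIdx d N) (QIdx d N) ℂ) = permMatrix d N σ}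

open scoped Matrix.Norms.L2Operator in
/-- Every unitary matrix has a unitary `k`-th root for every `k ≠ 0`. -/
lemma Matrix.unitaryGroup.exists_pow_eq {ι : Type*} [Fintype ι] [DecidableEq ι] {k : ℕ}
    (hk : k ≠ 0) (u : Matrix.unitaryGroup ι ℂ) : ∃ v : Matrix.unitaryGroup ι ℂ, v ^ k = u := by
  let a : Matrix ι ι ℂ := u.1
  have hu : a ∈ unitary (Matrix ι ι ℂ) := u.2
  have hn : IsStarNormal a := isStarNormal_of_mem_unitary hu
  have hcont (f : ℂ → ℂ) : ContinuousOn f (spectrum ℂ a) :=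
    (Matrix.finite_spectrum a).continuousOn f
  let f : ℂ → ℂ := fun z => z ^ ((k : ℂ)⁻¹)
  have hf (z : ℂ) : f z ^ k = z := Complex.cpow_nat_inv_pow z hk
  have hv : cfc f a ∈ unitary (Matrix ι ι ℂ) := by
    rw [cfc_unitary_iff f a hn (hcont f)]
    intro z hz
    have hz1 : ‖z‖ = 1 := by
      simpa using spectrum.subset_circle_of_unitary hu hz
    have hw : ‖f z‖ = 1 := by
      rw [← pow_eq_one_iff_of_nonneg (norm_nonneg _) hk, ← norm_pow, hf, hz1]
    rw [Complex.star_def, ← Complex.normSq_eq_conj_mul_self, Complex.normSq_eq_norm_sq, hw]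
    simp
  refine ⟨⟨cfc f a, hv⟩, Subtype.ext ?_⟩
  change cfc f a ^ k = a
  rw [← cfc_pow f k a (hcont f) hn]
  simp only [hf]
  exact cfc_id' ℂ a hn

/-- In a group in which every element has `k`-th roots for all `k ≠ 0`, every subgroup of finite
index is the whole group. -/
lemma Subgroup.eq_top_of_finiteIndex_of_forall_exists_pow_eq {G : Type*} [Group G]
    (hroot : ∀ k : ℕ, k ≠ 0 → ∀ g : G, ∃ x, x ^ k = g) (H : Subgroup G) [H.FiniteIndex] :
    H = ⊤ := by
  refine eq_top_iff.2 fun g _ => ?_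
  obtain ⟨x, rfl⟩ := hroot H.normalCore.index FiniteIndex.index_ne_zero g
  exact H.normalCore_le (H.normalCore.pow_index_mem x)

open scoped Pointwise in
/-- If a subgroup `H`, together with a finite subgroup normalizing it, generates a dense subgroup
of a topological group all of whose elements have `k`-th roots, then `H` is already dense. -/
lemma Subgroup.dense_of_dense_sup_finite {G : Type*} [Group G] [TopologicalSpace G]
    [IsTopologicalGroup G] (hroot : ∀ k : ℕ, k ≠ 0 → ∀ g : G, ∃ x, x ^ k = g)
    (H R : Subgroup G) [Finite R] (hR : R ≤ normalizer (H : Set G))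
    (hd : Dense ((H ⊔ R : Subgroup G) : Set G)) : Dense (H : Set G) := by
  let T := H.topologicalClosure
  have hclosed : IsClosed ((R : Set G) * (T : Set G)) :=
    H.isClosed_topologicalClosure.mul_left_of_isCompact (Set.toFinite (R : Set G)).isCompact
  have huniv : (R : Set G) * (T : Set G) = Set.univ := by
    refine Set.eq_univ_of_univ_subset ?_
    rw [← hd.closure_eq, sup_comm, coe_mul_of_left_le_normalizer_right R H hR]
    exact closure_minimal (Set.mul_subset_mul_left H.le_topologicalClosure) hclosed
  have : Finite (G ⧸ T) := by
    refine Finite.of_surjective (fun r : R => (QuotientGroup.mk (r : G) : G ⧸ T)) fun q => ?_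
    obtain ⟨g, rfl⟩ := QuotientGroup.mk_surjective q
    obtain ⟨r, hr, t, ht, rfl⟩ := Set.mem_mul.1 (huniv.symm ▸ Set.mem_univ g)
    exact ⟨⟨r, hr⟩, QuotientGroup.eq.2 (by simpa using ht)⟩
  have : T.FiniteIndex := finiteIndex_of_finite_quotient
  have hT := eq_top_of_finiteIndex_of_forall_exists_pow_eq hroot T
  rw [dense_iff_closure_eq, ← H.topologicalClosure_coe]
  exact congrArg _ hT

lemma permMatrix_mul_permMatrix (d N : ℕ) (σ τ : Equiv.Perm (Fin N)) :
    permMatrix d N σ * permMatrix d N τ = permMatrix d N (τ * σ) := by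
  ext f g
  rw [Matrix.mul_apply, Finset.sum_eq_single (g ∘ τ)]
  · simp only [permMatrix, Matrix.of_apply, Equiv.Perm.coe_mul, Function.comp_assoc]
    simp only [if_true, mul_one]
    congr
  · intro k _ hk
    simp [permMatrix, hk]
  · simp

lemma permMatrix_one_eq_one (d N : ℕ) : permMatrix d N 1 = 1 := by
  ext f g
  simp [permMatrix, Matrix.one_apply]

lemma star_permMatrix (d N : ℕ) (σ : Equiv.Perm (Fin N)) :
    star (permMatrix d N σ) = permMatrix d N σ⁻¹ := by
  ext f g
  have : g = f ∘ σ ↔ f = g ∘ ⇑σ⁻¹ := by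
    constructor
    · rintro rfl
      ext i
      simp
    · rintro rfl
      ext i
      simp
  simp only [Matrix.star_apply, permMatrix, Matrix.of_apply, this]
  split_ifs <;> simp

/-- The unitary representation of `S_N` on `(ℂ^d)^{⊗N}`, sending `σ` to `permMatrix d N σ⁻¹`. -/
def permUnitary (d N : ℕ) : Equiv.Perm (Fin N) →* UG d N where
  toFun σ := ⟨permMatrix d N σ⁻¹, by
    rw [Matrix.mem_unitaryGroup_iff, star_permMatrix, permMatrix_mul_permMatrix]
    simp [permMatrix_one_eq_one]⟩
  map_one' := Subtype.ext (by simpa using permMatrix_one_eq_one d N)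
  map_mul' σ τ := Subtype.ext (by simp [permMatrix_mul_permMatrix])

lemma coe_permUnitary (d N : ℕ) (σ : Equiv.Perm (Fin N)) :
    (permUnitary d N σ : Matrix (QIdx d N) (QIdx d N) ℂ) = permMatrix d N σ⁻¹ := rfl

lemma commute_of_mem_scalarSet {ι : Type*} [Fintype ι] [DecidableEq ι]
    {s : Matrix.unitaryGroup ι ℂ} (hs : s ∈ scalarSet ι) (g : Matrix.unitaryGroup ι ℂ) :
    Commute g s := by
  obtain ⟨α, hα⟩ := hs
  exact Subtype.ext (by simp [hα])

lemma permUnitary_conj_mem_gateConj {d n N : ℕ} (h : n ≤ N) {Γ : Set (UG d n)}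
    (σ : Equiv.Perm (Fin N)) {v : UG d N} (hv : v ∈ gateConj d n N h Γ) :
    permUnitary d N σ * v * (permUnitary d N σ)⁻¹ ∈ gateConj d n N h Γ := by
  obtain ⟨u, hu, τ, hτ⟩ := hv
  refine ⟨u, hu, τ * σ⁻¹, ?_⟩
  rw [← map_inv]
  simp only [Submonoid.coe_mul, coe_permUnitary, hτ, _root_.mul_inv_rev, inv_inv,
    ← permMatrix_mul_permMatrix, mul_assoc]

lemma permUnitary_range_le_normalizer {d n N : ℕ} (h : n ≤ N) (Γ : Set (UG d n)) :
    (permUnitary d N).range ≤ Subgroup.normalizer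
      (Subgroup.closure (gateConj d n N h Γ ∪ scalarSet (QIdx d N)) : Set (UG d N)) := by
  rintro _ ⟨σ, rfl⟩
  refine Subgroup.normalizer_le_normalizer_closure _ ?_
  have key (τ : Equiv.Perm (Fin N)) (v : UG d N)
      (hv : v ∈ gateConj d n N h Γ ∪ scalarSet (QIdx d N)) :
      permUnitary d N τ * v * (permUnitary d N τ)⁻¹ ∈
        gateConj d n N h Γ ∪ scalarSet (QIdx d N) := by
    rcases hv with hv | hv
    · exact Or.inl (permUnitary_conj_mem_gateConj h τ hv)
    · rw [(commute_of_mem_scalarSet hv _).eq, mul_inv_cancel_right]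
      exact Or.inr hv
  refine Subgroup.mem_set_normalizer_iff.2 fun v => ⟨key σ v, fun hv => ?_⟩
  simpa [mul_assoc] using key σ⁻¹ _ hv

lemma gateExtSet_subset_gateConj {d n N : ℕ} (h : n ≤ N) (Γ : Set (UG d n)) :
    gateExtSet d n N h Γ ⊆ gateConj d n N h Γ := by
  rintro v ⟨u, hu, hv⟩
  exact ⟨u, hu, 1, by simp [hv, permMatrix_one_eq_one]⟩

lemma permGateSet_subset_range (d N : ℕ) (S : Set (Equiv.Perm (Fin N))) :
    permGateSet d N S ⊆ (permUnitary d N).range := by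
  rintro v ⟨σ, -, hv⟩
  exact ⟨σ⁻¹, Subtype.ext (by rw [coe_permUnitary, hv, inv_inv])⟩

lemma permUnitary_mem_closure_permGateSet {d N : ℕ} {S : Set (Equiv.Perm (Fin N))}
    (hS : Subgroup.closure S = ⊤) (σ : Equiv.Perm (Fin N)) :
    permUnitary d N σ ∈ Subgroup.closure (permGateSet d N S) := by
  suffices Subgroup.closure S ≤ (Subgroup.closure (permGateSet d N S)).comap (permUnitary d N) from
    this (hS ▸ Subgroup.mem_top σ)
  refine (Subgroup.closure_le _).2 fun τ hτ => ?_
  rw [← inv_inv τ, SetLike.mem_coe, Subgroup.mem_comap, map_inv]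
  exact inv_mem (Subgroup.subset_closure ⟨τ, hτ, by rw [coe_permUnitary, inv_inv]⟩)

lemma gateConj_subset_closure {d n N : ℕ} (h : n ≤ N) (Γ : Set (UG d n))
    {S : Set (Equiv.Perm (Fin N))} (hS : Subgroup.closure S = ⊤) :
    gateConj d n N h Γ ⊆ Subgroup.closure (gateExtSet d n N h Γ ∪ permGateSet d N S) := by
  rintro v ⟨u, hu, σ, hv⟩
  have hperm : permUnitary d N σ ∈
      Subgroup.closure (gateExtSet d n N h Γ ∪ permGateSet d N S) :=
    Subgroup.closure_mono Set.subset_union_right (permUnitary_mem_closure_permGateSet hS σ)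
  have hext : permUnitary d N σ * v * (permUnitary d N σ)⁻¹ ∈ gateExtSet d n N h Γ := by
    refine ⟨u, hu, ?_⟩
    have hσ : permMatrix d N σ⁻¹ * permMatrix d N σ = 1 := by
      simp [permMatrix_mul_permMatrix, permMatrix_one_eq_one]
    rw [← map_inv]
    simp only [Submonoid.coe_mul, coe_permUnitary, hv, inv_inv]
    calc _ = (permMatrix d N σ⁻¹ * permMatrix d N σ) * tensorExt h (u : Matrix _ _ ℂ) *
          (permMatrix d N σ⁻¹ * permMatrix d N σ) := by simp only [mul_assoc]
      _ = _ := by rw [hσ, one_mul, mul_one]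
  have := mul_mem (mul_mem (inv_mem hperm) (Subgroup.subset_closure (Or.inl hext))) hperm
  simpa [mul_assoc] using this

/-- For `d ≥ 2`, `N ≥ n` and `Σ` a generating set of `S_N`, the `n`-qudit
gate set `Γ` is `N`-universal if and only if `Γ_N ∪ Σ` is complete. -/
theorem nUniversal_iff_ext_union_perms_complete {d n N : ℕ} (hd : 2 ≤ d) (h : n ≤ N)
    (Γ : Set (UG d n)) (hΓ : Γ.Finite)
    (Sgen : Set (Equiv.Perm (Fin N))) (hSgen : Subgroup.closure Sgen = ⊤) :
    IsNUniversal d n N Γ ↔ IsCompleteGateSet (gateExtSet d n N h Γ ∪ permGateSet d N Sgen) := by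
  constructor
  · rintro ⟨_, hdense⟩
    refine hdense.mono (SetLike.coe_subset_coe.2 ((Subgroup.closure_le _).2 ?_))
    refine Set.union_subset ((gateConj_subset_closure h Γ hSgen).trans ?_) ?_
    · exact Subgroup.closure_mono Set.subset_union_left
    · exact Set.subset_union_right.trans Subgroup.subset_closure
  · intro hdense
    refine ⟨h, Subgroup.dense_of_dense_sup_finite
      (fun _ => Matrix.unitaryGroup.exists_pow_eq) _ (permUnitary d N).range
      (permUnitary_range_le_normalizer h Γ)
      (hdense.mono (SetLike.coe_subset_coe.2 ((Subgroup.closure_le _).2 ?_)))⟩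
    have hH := (Subgroup.subset_closure (k := gateConj d n N h Γ ∪ scalarSet (QIdx d N))).trans
      (SetLike.coe_subset_coe.2 (le_sup_left (b := (permUnitary d N).range)))
    refine Set.union_subset (Set.union_subset ?_ ?_) (Set.subset_union_right.trans hH)
    · exact ((gateExtSet_subset_gateConj h Γ).trans Set.subset_union_left).trans hH
    · exact (permGateSet_subset_range d N Sgen).trans (SetLike.coe_subset_coe.2 le_sup_right)
end
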